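/- arXiv:1208.3054 — 2 statements merged into one kernel-verified Lean document; each statement's English description precedes it below -/
import Mathlib

section
/- Let G = (V, E) be a finite simple connected undirected graph, L : V → ℕ a capacity function and k a positive integer, and suppose LP1 has a feasible solution (x, y). Then there exist a 68-feasible assignment (x', y') and a set S of pairwise vertex-disjoint non-separable 21-caterpillar structures for (x', y') such that every vertex v not belonging to any caterpillar structure of S has an integral y'-value, and every vertex v belonging to some caterpillar structure of S satisfies radius_{(x',y')}(v) ≤ 47. -/
/-- The LP relaxation LP1 of the capacitated `k`-center problem, at distance threshold `δ`
(a `δ`-feasible assignment).  `x u v` is the (fractional) amount of client `v` assigned to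
center `u`, and `y u` is the (fractional) opening of a center at `u`.  Distances larger
than `δ`, in particular between vertices in different connected components, forbid any
assignment. -/
def LPFeasible {V : Type} [Fintype V] (G : SimpleGraph V) (L : V → ℕ) (k δ : ℕ)
    (x : V → V → ℝ) (y : V → ℝ) : Prop :=
  (∀ u v, 0 ≤ x u v) ∧ (∀ u, 0 ≤ y u) ∧
  (∑ u, y u = (k : ℝ)) ∧
  (∀ u v, x u v ≤ y u) ∧
  (∀ u, ∑ v, x u v ≤ (L u : ℝ) * y u) ∧
  (∀ v, ∑ u, x u v = 1) ∧
  (∀ u, y u ≤ 1) ∧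
  (∀ u v, ¬ (G.Reachable u v ∧ G.dist u v ≤ δ) → x u v = 0)

/-- A (hard) capacitated `k`-center solution of `G` at distance `δ`: a set `S` of exactly
`k` centers and an assignment `φ` of every vertex to a center of `S` at distance at most
`δ`, such that at most `L u` vertices are assigned to each center `u`. -/
def HasCapSolution {V : Type} (G : SimpleGraph V) (L : V → ℕ) (k δ : ℕ) : Prop :=
  ∃ (S : Finset V) (φ : V → V), S.card = k ∧ (∀ v, φ v ∈ S) ∧
    (∀ v, G.Reachable v (φ v) ∧ G.dist v (φ v) ≤ δ) ∧
    (∀ u ∈ S, {v | φ v = u}.ncard ≤ L u)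

/-- `radius_{(x,y)}(u)`: the greatest integer `i` such that some vertex `v` with
`dist_G(u, v) = i` has `x u v > 0` (and `0` if there is no such `i`). -/
noncomputable def lpRadius {V : Type} (G : SimpleGraph V) (x : V → V → ℝ) (u : V) : ℕ :=
  sSup {i : ℕ | ∃ v, G.dist u v = i ∧ 0 < x u v}

/-- The `x`-part of the result of shifting `α` from `a` to `b`: with `ε = α / y a`,
`x a v` decreases by `ε * x a v` and `x b v` increases by `ε * x a v` for every `v`. -/
noncomputable def shiftX {V : Type} [DecidableEq V] (x : V → V → ℝ) (y : V → ℝ)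
    (a b : V) (α : ℝ) : V → V → ℝ :=
  fun u v =>
    if u = a then x a v - (α / y a) * x a v
    else if u = b then x b v + (α / y a) * x a v
    else x u v

/-- The `y`-part of the result of shifting `α` from `a` to `b`:
`y a` decreases by `α` and `y b` increases by `α`. -/
noncomputable def shiftY {V : Type} [DecidableEq V] (y : V → ℝ) (a b : V) (α : ℝ) :
    V → ℝ :=
  fun u => if u = a then y a - α else if u = b then y b + α else y u

/-- The data of a caterpillar structure: a spine length `p`, spine vertices
`vtx 1, …, vtx p` (the sequence `P = (v_1, …, v_p)`) and leaves
`leaf 0, …, leaf (p+1)` (the sequence `P' = (v'_0, …, v'_{p+1})`, where `none` plays the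
role of `nil`).  Values of `vtx`/`leaf` outside these index ranges are irrelevant. -/
structure Caterpillar (V : Type) where
  p : ℕ
  vtx : ℕ → V
  leaf : ℕ → Option V

/-- `V(P)`: the set of spine vertices of a caterpillar structure. -/
def Caterpillar.spine {V : Type} (C : Caterpillar V) : Set V :=
  {w | ∃ i, 1 ≤ i ∧ i ≤ C.p ∧ C.vtx i = w}

/-- `V(P')`: the set of non-nil leaves of a caterpillar structure. -/
def Caterpillar.leaves {V : Type} (C : Caterpillar V) : Set V :=
  {w | ∃ i ≤ C.p + 1, C.leaf i = some w}

/-- `C` is a `δ`-caterpillar structure for the assignment with `y`-values `y`: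
the spine vertices are distinct with `y`-value `1` and consecutive spine vertices are at
distance at most `δ`; leaves are vertices outside the spine with fractional `y`-values,
each leaf `leaf i` (`1 ≤ i ≤ p`) has `L (leaf i) ≤ L (vtx i)` and is at distance at most
`δ` from `vtx i`; `leaf 0` (resp. `leaf (p+1)`), if present, is at distance at most `δ`
from `vtx 1` (resp. `vtx p`); the non-nil leaves are pairwise distinct; and the sum of the
`y`-values of the non-nil leaves is an integer. -/
def IsCaterpillar {V : Type} (G : SimpleGraph V) (L : V → ℕ) (y : V → ℝ) (δ : ℕ)
    (C : Caterpillar V) : Prop :=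
  (∀ i j, 1 ≤ i → i < j → j ≤ C.p → C.vtx i ≠ C.vtx j) ∧
  (∀ i, 1 ≤ i → i ≤ C.p → y (C.vtx i) = 1) ∧
  (∀ i, 1 ≤ i → i + 1 ≤ C.p → G.dist (C.vtx i) (C.vtx (i + 1)) ≤ δ) ∧
  (∀ i ≤ C.p + 1, ∀ w, C.leaf i = some w → w ∉ C.spine) ∧
  (∀ i, 1 ≤ i → i ≤ C.p → ∀ w, C.leaf i = some w →
      L w ≤ L (C.vtx i) ∧ 0 < y w ∧ y w < 1 ∧ G.dist (C.vtx i) w ≤ δ) ∧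
  (∀ w, C.leaf 0 = some w → G.dist w (C.vtx 1) ≤ δ ∧ 0 < y w ∧ y w < 1) ∧
  (∀ w, C.leaf (C.p + 1) = some w → G.dist w (C.vtx C.p) ≤ δ ∧ 0 < y w ∧ y w < 1) ∧
  (∀ i j, i < j → j ≤ C.p + 1 → ∀ w w', C.leaf i = some w → C.leaf j = some w' → w ≠ w') ∧
  (∃ n : ℤ, ∑ i ∈ Finset.range (C.p + 2), (C.leaf i).elim 0 y = (n : ℝ))

/-- `Γ(C)`: the set of spine vertices `vtx i` for which there are indices
`i₀ < i < i₁` with non-nil leaves `leaf i₀` and `leaf i₁` of capacity strictly larger than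
`L (vtx i)`. -/
def Gamma {V : Type} (L : V → ℕ) (C : Caterpillar V) : Set V :=
  {w | ∃ i, 1 ≤ i ∧ i ≤ C.p ∧ C.vtx i = w ∧
    ∃ i₀ i₁, i₀ < i ∧ i < i₁ ∧ i₁ ≤ C.p + 1 ∧
      (∃ w₀, C.leaf i₀ = some w₀ ∧ L w < L w₀) ∧
      (∃ w₁, C.leaf i₁ = some w₁ ∧ L w < L w₁)}

/-- A dangerous caterpillar structure `C` is separable if there is an index `i` with
`vtx i ∈ Γ(C)` of minimum capacity in `Γ(C)` such that, on the right side
(indices `i < j ≤ p + 1`) or on the left side (indices `0 ≤ j < i`),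
`S₁ ≥ ⌈S₂⌉ - S₂`, where `S₂` is the sum of the `y`-values of the non-nil leaves on that
side and `S₁` is the sum of `1 - y w` over the non-nil leaves `w` on that side with
`L w > L (vtx i)`. -/
def Separable {V : Type} (L : V → ℕ) (y : V → ℝ) (C : Caterpillar V) : Prop :=
  ∃ i, 1 ≤ i ∧ i ≤ C.p ∧ C.vtx i ∈ Gamma L C ∧
    (∀ w ∈ Gamma L C, L (C.vtx i) ≤ L w) ∧
    (((⌈∑ j ∈ Finset.Icc (i + 1) (C.p + 1), (C.leaf j).elim 0 y⌉ : ℝ) -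
        ∑ j ∈ Finset.Icc (i + 1) (C.p + 1), (C.leaf j).elim 0 y ≤
        ∑ j ∈ Finset.Icc (i + 1) (C.p + 1),
          (C.leaf j).elim 0 (fun w => if L (C.vtx i) < L w then 1 - y w else 0)) ∨
     ((⌈∑ j ∈ Finset.range i, (C.leaf j).elim 0 y⌉ : ℝ) -
        ∑ j ∈ Finset.range i, (C.leaf j).elim 0 y ≤
        ∑ j ∈ Finset.range i,
          (C.leaf j).elim 0 (fun w => if L (C.vtx i) < L w then 1 - y w else 0)))

/-- Feasibility without the distance condition. -/
structure Feas {V : Type} [Fintype V] (L : V → ℕ) (k : ℕ) (x : V → V → ℝ) (y : V → ℝ) :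
    Prop where
  x0 : ∀ u v, 0 ≤ x u v
  y0 : ∀ u, 0 ≤ y u
  ysum : ∑ u, y u = (k : ℝ)
  xy : ∀ u v, x u v ≤ y u
  cap : ∀ u, ∑ v, x u v ≤ (L u : ℝ) * y u
  col : ∀ v, ∑ u, x u v = 1
  y1 : ∀ u, y u ≤ 1

/-- The simultaneous transfer of openings along a flow `F` of capacity type `lam`. -/
theorem flow_step {V : Type} [Fintype V] {L : V → ℕ} {k : ℕ} {x : V → V → ℝ}
    {y : V → ℝ} (hf : Feas L k x y) (F : V → V → ℝ) (hF : ∀ u v, 0 ≤ F u v) (lam : ℕ)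
    (y' : V → ℝ) (hy' : ∀ v, y' v = y v + ∑ u, F u v - ∑ w, F v w)
    (h1 : ∀ v, ∑ w, F v w ≤ y v)
    (h2 : ∀ v, (L v ≤ lam ∧ (∑ u, F u v = 0 ∨ L v = lam)) ∨
      (lam ≤ L v ∧ ∑ w, F v w ≤ ∑ u, F u v ∧ (∑ w, F v w = 0 ∨ y' v = 1)))
    (h3 : ∀ v, y' v ≤ 1) :
    ∃ x' : V → V → ℝ, Feas L k x' y' ∧
      (∀ v c, 0 < x' v c → 0 < x v c ∨ ∃ u, 0 < F u v ∧ 0 < x u c) ∧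
      (∀ v, (∀ u, F u v = 0) → (∀ w, F v w = 0) → x' v = x v) := by
  classical
  have hl0 : ∀ v, 0 ≤ ∑ c, x v c := fun v => Finset.sum_nonneg fun c _ => hf.x0 v c
  have hin0 : ∀ v, 0 ≤ ∑ u, F u v := fun v => Finset.sum_nonneg fun c _ => hF c v
  have hout0 : ∀ v, 0 ≤ ∑ u, F v u := fun v => Finset.sum_nonneg fun c _ => hF v c
  have hlam0 : (0 : ℝ) ≤ lam := Nat.cast_nonneg _
  -- rates
  have hg : ∀ v, ∃ g : ℝ, 0 ≤ g ∧ g * y v ≤ 1 ∧ g * ∑ c, x v c ≤ lam ∧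
      ((∑ c, x v c ≤ lam * y v ∧ 0 < y v ∧ g = 1 / y v) ∨
       (lam * y v < ∑ c, x v c ∧ g * ∑ c, x v c = lam) ∨ y v = 0) := by
    intro v
    rcases (hf.y0 v).eq_or_lt with h | h
    · exact ⟨0, le_rfl, by simp, by simp, Or.inr (Or.inr h.symm)⟩
    · by_cases hc : ∑ c, x v c ≤ lam * y v
      · refine ⟨1 / y v, by positivity, ?_, ?_, Or.inl ⟨hc, h, rfl⟩⟩
        · rw [one_div, inv_mul_cancel₀ h.ne']
        · rw [one_div, inv_mul_le_iff₀ h, mul_comm]; exact hc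
      · push Not at hc
        have hpos : 0 < ∑ c, x v c := lt_of_le_of_lt (by positivity) hc
        refine ⟨lam / ∑ c, x v c, by positivity, ?_, ?_, Or.inr (Or.inl ⟨hc, ?_⟩)⟩
        · rw [div_mul_eq_mul_div, div_le_one hpos]; exact hc.le
        · rw [div_mul_cancel₀ _ hpos.ne']
        · rw [div_mul_cancel₀ _ hpos.ne']
  choose g g0 gy gl gc using hg
  have hog : ∀ v, (∑ w, F v w) * g v ≤ 1 := fun v =>
    le_trans (mul_le_mul_of_nonneg_right (h1 v) (g0 v)) (by rw [mul_comm]; exact gy v)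
  let x' : V → V → ℝ := fun v c => x v c * (1 - (∑ w, F v w) * g v) + ∑ u, F u v * (g u * x u c)
  have hx'0 : ∀ v c, 0 ≤ x' v c := by
    intro v c
    refine add_nonneg (mul_nonneg (hf.x0 v c) (by linarith [hog v])) ?_
    exact Finset.sum_nonneg fun u _ => mul_nonneg (hF u v) (mul_nonneg (g0 u) (hf.x0 u c))
  have hcol : ∀ c, ∑ v, x' v c = 1 := by
    intro c
    simp only [x', Finset.sum_add_distrib]
    rw [Finset.sum_comm (f := fun v u => F u v * (g u * x u c)), ← Finset.sum_add_distrib]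
    refine Eq.trans ?_ (hf.col c)
    refine Finset.sum_congr rfl fun v _ => ?_
    rw [← Finset.sum_mul]; ring
  have hgx : ∀ u c, g u * x u c ≤ 1 := fun u c =>
    le_trans (mul_le_mul_of_nonneg_left (hf.xy u c) (g0 u)) (gy u)
  have hinx : ∀ v c, ∑ u, F u v * (g u * x u c) ≤ ∑ u, F u v := fun v c =>
    Finset.sum_le_sum fun u _ => mul_le_of_le_one_right (hF u v) (hgx u c)
  have hinl : ∀ v, ∑ c, ∑ u, F u v * (g u * x u c) ≤ (∑ u, F u v) * lam := by
    intro v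
    rw [Finset.sum_comm, Finset.sum_mul]
    refine Finset.sum_le_sum fun u _ => ?_
    rw [← Finset.mul_sum, ← Finset.mul_sum]
    exact mul_le_mul_of_nonneg_left (gl u) (hF u v)
  have hinL : ∀ v, (∑ u, F u v) * lam ≤ (∑ u, F u v) * (L v : ℝ) := by
    intro v
    rcases h2 v with ⟨-, h | h⟩ | ⟨h, -⟩
    · rw [h]; simp
    · rw [h]
    · exact mul_le_mul_of_nonneg_left (by exact_mod_cast h) (hin0 v)
  refine ⟨x', ⟨hx'0, ?_, ?_, ?_, ?_, hcol, h3⟩, ?_, ?_⟩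
  · intro v; rw [hy']; linarith [h1 v, hin0 v]
  · simp only [hy', Finset.sum_sub_distrib, Finset.sum_add_distrib]
    rw [Finset.sum_comm (f := fun v u => F u v), hf.ysum]; ring
  · intro v c
    by_cases hone : y' v = 1
    · rw [hone, ← hcol c]
      exact Finset.single_le_sum (f := fun v => x' v c) (fun u _ => hx'0 u c) (Finset.mem_univ v)
    · have key : x v c * (1 - (∑ w, F v w) * g v) ≤ y v - ∑ w, F v w := by
        rcases h2 v with ⟨hL, -⟩ | ⟨-, -, h | h⟩
        · rcases gc v with ⟨-, hy, h⟩ | ⟨h, -⟩ | h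
          · rw [h]
            have : 1 - (∑ w, F v w) * (1 / y v) = (y v - ∑ w, F v w) / y v := by
              field_simp
            rw [this, mul_div_assoc', div_le_iff₀ hy, mul_comm]
            exact mul_le_mul_of_nonneg_left (hf.xy v c) (by linarith [h1 v])
          · exfalso
            have := hf.cap v
            have h' : (L v : ℝ) * y v ≤ lam * y v :=
              mul_le_mul_of_nonneg_right (by exact_mod_cast hL) (hf.y0 v)
            linarith
          · have h1' := h1 v
            have h4 := hout0 v
            have h5 : ∑ w, F v w = 0 := by linarith
            rw [h5]; simpa using hf.xy v c
        · rw [h]; simpa using hf.xy v c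
        · exact absurd h hone
      have := hinx v c
      simp only [x']
      rw [hy']; linarith
  · intro v
    have e : ∑ c, x' v c = (∑ c, x v c) * (1 - (∑ w, F v w) * g v) +
        ∑ c, ∑ u, F u v * (g u * x u c) := by
      simp only [x', Finset.sum_add_distrib, Finset.sum_mul]
    rw [e, hy']
    have a1 := hinl v
    have a2 := hinL v
    have hcap := hf.cap v
    have hout := h1 v
    rcases gc v with ⟨-, hy, h⟩ | ⟨h, h'⟩ | h
    · have : (∑ c, x v c) * (1 - (∑ w, F v w) * g v) ≤ L v * (y v - ∑ w, F v w) := by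
        have : 1 - (∑ w, F v w) * g v = (y v - ∑ w, F v w) / y v := by
          rw [h]; field_simp
        rw [this, mul_div_assoc', div_le_iff₀ hy]
        have := mul_le_mul_of_nonneg_right hcap (sub_nonneg.2 hout)
        linarith
      linarith
    · have hll : (lam : ℝ) ≤ L v ∧ ∑ w, F v w ≤ ∑ u, F u v := by
        rcases h2 v with ⟨hL, -⟩ | ⟨hL, h4, -⟩
        · exfalso
          have h' : (L v : ℝ) * y v ≤ lam * y v :=
              mul_le_mul_of_nonneg_right (by exact_mod_cast hL) (hf.y0 v)
          linarith
        · exact ⟨by exact_mod_cast hL, h4⟩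
      have e2 : (∑ c, x v c) * (1 - (∑ w, F v w) * g v) =
          (∑ c, x v c) - (∑ w, F v w) * lam := by rw [← h']; ring
      rw [e2]
      have := mul_le_mul_of_nonneg_left hll.1 (sub_nonneg.2 hll.2)
      linarith
    · have h4 := hout0 v
      have h5 : ∑ w, F v w = 0 := by linarith
      have h6 : ∑ c, x v c = 0 := le_antisymm (by rw [h] at hcap; simpa using hcap) (hl0 v)
      rw [h5, h6, h]; linarith
  · intro v c hpos
    by_contra hcon
    push Not at hcon
    obtain ⟨hc1, hc2⟩ := hcon
    have : x' v c = 0 := by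
      simp only [x']
      rw [le_antisymm hc1 (hf.x0 v c), zero_mul, zero_add]
      refine Finset.sum_eq_zero fun u _ => ?_
      rcases (hF u v).eq_or_lt with h | h
      · rw [← h, zero_mul]
      · rw [le_antisymm (hc2 u h) (hf.x0 u c)]; ring
    linarith
  · intro v hi ho
    funext c
    simp [x', hi, ho]

/-- All clients of `v` are within distance `n`. -/
def Rad {V : Type} (G : SimpleGraph V) (x : V → V → ℝ) (n : ℕ) (v : V) : Prop :=
  ∀ c, 0 < x v c → G.dist v c ≤ n

/-- The index version of `Gamma`. -/
def GIdx {V : Type} (L : V → ℕ) (C : Caterpillar V) (l : ℕ) : Prop :=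
  1 ≤ l ∧ l ≤ C.p ∧ ∃ i₀ i₁, i₀ < l ∧ l < i₁ ∧ i₁ ≤ C.p + 1 ∧
      (∃ w₀, C.leaf i₀ = some w₀ ∧ L (C.vtx l) < L w₀) ∧
      (∃ w₁, C.leaf i₁ = some w₁ ∧ L (C.vtx l) < L w₁)

/-- All vertices of a caterpillar. -/
def verts {V : Type} (C : Caterpillar V) : Set V := C.spine ∪ C.leaves

theorem vtx_mem {V : Type} {C : Caterpillar V} {i : ℕ} (h1 : 1 ≤ i) (h2 : i ≤ C.p) :
    C.vtx i ∈ verts C := Or.inl ⟨i, h1, h2, rfl⟩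

theorem leaf_mem {V : Type} {C : Caterpillar V} {i : ℕ} {w : V} (h2 : i ≤ C.p + 1)
    (h : C.leaf i = some w) : w ∈ verts C := Or.inr ⟨i, h2, h⟩

/-- The conclusion of the recursive decomposition. -/
def Good {V : Type} [Fintype V] (G : SimpleGraph V) (L : V → ℕ) (k : ℕ)
    (x : V → V → ℝ) (y : V → ℝ) (C : Caterpillar V) : Prop :=
  ∃ (x' : V → V → ℝ) (y' : V → ℝ) (Ds : List (Caterpillar V)), Feas L k x' y' ∧
    (∀ v, v ∉ verts C → x' v = x v ∧ y' v = y v) ∧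
    (∀ D ∈ Ds, IsCaterpillar G L y' 21 D ∧ ¬ Separable L y' D ∧ verts D ⊆ verts C) ∧
    Ds.Pairwise (fun D E => Disjoint (verts D) (verts E)) ∧
    (∀ v ∈ verts C, (∀ D ∈ Ds, v ∉ verts D) → ∃ n : ℤ, y' v = (n : ℝ)) ∧
    (∀ v ∈ verts C, Rad G x' 47 v)

/-- The invariant of the recursion. -/
structure CInv {V : Type} (G : SimpleGraph V) (L : V → ℕ)
    (x : V → V → ℝ) (y : V → ℝ) (C : Caterpillar V) (lo hi : ℕ) : Prop where
  cat : IsCaterpillar G L y 21 C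
  hhi : hi ≤ C.p + 1
  win : ∀ l, GIdx L C l → lo < l ∧ l < hi
  out : ∀ l, GIdx L C l → ∀ j w, (j < lo ∨ hi < j) → j ≤ C.p + 1 → C.leaf j = some w →
    L w ≤ L (C.vtx l)
  freshv : ∀ l, 1 ≤ l → l ≤ C.p → lo < l → l < hi → Rad G x 5 (C.vtx l)
  freshl : ∀ l w, lo < l → l < hi → C.leaf l = some w → Rad G x 5 w
  radv : ∀ l, 1 ≤ l → l ≤ C.p → Rad G x 26 (C.vtx l)
  radl : ∀ l w, l ≤ C.p + 1 → C.leaf l = some w → Rad G x 47 w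

theorem elim_congr {V : Type} {C : Caterpillar V} {y y' : V → ℝ}
    (h : ∀ v ∈ verts C, y' v = y v) {j : ℕ} (hj : j ≤ C.p + 1) :
    (C.leaf j).elim 0 y' = (C.leaf j).elim 0 y := by
  cases hl : C.leaf j with
  | none => rfl
  | some w => exact h w (leaf_mem hj hl)

theorem IsCaterpillar.congr {V : Type} {G : SimpleGraph V} {L : V → ℕ} {y y' : V → ℝ} {δ : ℕ}
    {C : Caterpillar V} (hC : IsCaterpillar G L y δ C) (h : ∀ v ∈ verts C, y' v = y v) :
    IsCaterpillar G L y' δ C := by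
  obtain ⟨c1, c2, c3, c4, c5, c6, c7, c8, n, c9⟩ := hC
  refine ⟨c1, ?_, c3, c4, ?_, ?_, ?_, c8, n, ?_⟩
  · intro i h1 h2; rw [h _ (vtx_mem h1 h2)]; exact c2 i h1 h2
  · intro i h1 h2 w hw; rw [h _ (leaf_mem (by omega) hw)]; exact c5 i h1 h2 w hw
  · intro w hw; rw [h _ (leaf_mem (by omega) hw)]; exact c6 w hw
  · intro w hw; rw [h _ (leaf_mem (by omega) hw)]; exact c7 w hw
  · rw [← c9]
    refine Finset.sum_congr rfl fun j hj => elim_congr h ?_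
    have := Finset.mem_range.1 hj; omega

theorem Separable.congr {V : Type} {L : V → ℕ} {y y' : V → ℝ}
    {C : Caterpillar V} (hC : Separable L y C) (h : ∀ v ∈ verts C, y' v = y v) :
    Separable L y' C := by
  obtain ⟨i, h1, h2, h3, h4, h5⟩ := hC
  refine ⟨i, h1, h2, h3, h4, ?_⟩
  have h' : ∀ v ∈ verts C, (fun w => if L (C.vtx i) < L w then 1 - y' w else 0) v =
      (fun w => if L (C.vtx i) < L w then 1 - y w else 0) v := by
    intro v hv; simp only [h v hv]
  have a1 : ∑ j ∈ Finset.Icc (i + 1) (C.p + 1), (C.leaf j).elim 0 y' =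
      ∑ j ∈ Finset.Icc (i + 1) (C.p + 1), (C.leaf j).elim 0 y :=
    Finset.sum_congr rfl fun j hj => elim_congr h (Finset.mem_Icc.1 hj).2
  have a2 : ∑ j ∈ Finset.range i, (C.leaf j).elim 0 y' =
      ∑ j ∈ Finset.range i, (C.leaf j).elim 0 y :=
    Finset.sum_congr rfl fun j hj => elim_congr h (by have := Finset.mem_range.1 hj; omega)
  have a3 := Finset.sum_congr (rfl : Finset.Icc (i + 1) (C.p + 1) = _)
    fun j hj => elim_congr h' (Finset.mem_Icc.1 hj).2
  have a4 := Finset.sum_congr (rfl : Finset.range i = _)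
    fun j hj => elim_congr h' (j := j) (by have := Finset.mem_range.1 hj; omega)
  rw [a1, a2, a3, a4]
  exact h5

theorem CInv.congr {V : Type} {G : SimpleGraph V} {L : V → ℕ} {x x' : V → V → ℝ} {y y' : V → ℝ}
    {C : Caterpillar V} {lo hi : ℕ} (hC : CInv G L x y C lo hi)
    (h : ∀ v ∈ verts C, x' v = x v ∧ y' v = y v) : CInv G L x' y' C lo hi where
  cat := hC.cat.congr fun v hv => (h v hv).2
  hhi := hC.hhi
  win := hC.win
  out := hC.out
  freshv l h1 h2 h3 h4 c := by
    rw [(h _ (vtx_mem h1 h2)).1]; exact hC.freshv l h1 h2 h3 h4 c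
  freshl l w h1 h2 hw c := by
    rw [(h _ (leaf_mem (by have := hC.hhi; omega) hw)).1]; exact hC.freshl l w h1 h2 hw c
  radv l h1 h2 c := by
    rw [(h _ (vtx_mem h1 h2)).1]; exact hC.radv l h1 h2 c
  radl l w h1 hw c := by
    rw [(h _ (leaf_mem h1 hw)).1]; exact hC.radl l w h1 hw c

theorem CInv.rad {V : Type} {G : SimpleGraph V} {L : V → ℕ} {x : V → V → ℝ} {y : V → ℝ}
    {C : Caterpillar V} {lo hi : ℕ} (hC : CInv G L x y C lo hi) :
    ∀ v ∈ verts C, Rad G x 47 v := by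
  rintro v (⟨i, h1, h2, rfl⟩ | ⟨i, h1, h2⟩) c hc
  · have := hC.radv i h1 h2 c hc; omega
  · exact hC.radl i v h1 h2 c hc

/-- Combining the recursion on two pieces. -/
theorem good_combine {V : Type} [Fintype V] {G : SimpleGraph V} {L : V → ℕ} {k : ℕ}
    {x x₁ : V → V → ℝ} {y y₁ : V → ℝ} {C A B : Caterpillar V} {la ha lb hb n : ℕ}
    (IH : ∀ (x : V → V → ℝ) (y : V → ℝ) (C : Caterpillar V) (lo hi : ℕ), hi - lo < n →
      Feas L k x y → CInv G L x y C lo hi → Good G L k x y C)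
    (hf : Feas L k x₁ y₁) (hoff : ∀ v, v ∉ verts C → x₁ v = x v ∧ y₁ v = y v)
    (hA : CInv G L x₁ y₁ A la ha) (hB : CInv G L x₁ y₁ B lb hb)
    (hna : ha - la < n) (hnb : hb - lb < n)
    (hAC : verts A ⊆ verts C) (hBC : verts B ⊆ verts C) (hAB : Disjoint (verts A) (verts B))
    (hintg : ∀ v ∈ verts C, v ∉ verts A → v ∉ verts B → ∃ n : ℤ, y₁ v = (n : ℝ))
    (hrad : ∀ v ∈ verts C, Rad G x₁ 47 v) : Good G L k x y C := by
  obtain ⟨x₂, y₂, Da, f2, off2, cat2, pw2, int2, rad2⟩ := IH x₁ y₁ A la ha hna hf hA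
  have hB2 : CInv G L x₂ y₂ B lb hb :=
    hB.congr fun v hv => off2 v fun hv' => Set.disjoint_left.1 hAB hv' hv
  obtain ⟨x₃, y₃, Db, f3, off3, cat3, pw3, int3, rad3⟩ := IH x₂ y₂ B lb hb hnb f2 hB2
  refine ⟨x₃, y₃, Da ++ Db, f3, ?_, ?_, ?_, ?_, ?_⟩
  · intro v hv
    obtain ⟨a1, a2⟩ := off3 v fun h => hv (hBC h)
    obtain ⟨b1, b2⟩ := off2 v fun h => hv (hAC h)
    obtain ⟨c1, c2⟩ := hoff v hv
    exact ⟨by rw [a1, b1, c1], by rw [a2, b2, c2]⟩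
  · intro D hD
    rcases List.mem_append.1 hD with hD | hD
    · obtain ⟨a1, a2, a3⟩ := cat2 D hD
      have : ∀ v ∈ verts D, y₃ v = y₂ v := fun v hv =>
        (off3 v (Set.disjoint_left.1 hAB (a3 hv))).2
      exact ⟨a1.congr this, fun hs => a2 (hs.congr fun v hv => (this v hv).symm),
        a3.trans hAC⟩
    · obtain ⟨a1, a2, a3⟩ := cat3 D hD
      exact ⟨a1, a2, a3.trans hBC⟩
  · rw [List.pairwise_append]
    refine ⟨pw2, pw3, fun D hD E hE => ?_⟩
    exact Disjoint.mono (cat2 D hD).2.2 (cat3 E hE).2.2 hAB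
  · intro v hv hD
    by_cases hvB : v ∈ verts B
    · exact int3 v hvB fun D h => hD D (List.mem_append_right _ h)
    · rw [(off3 v hvB).2]
      by_cases hvA : v ∈ verts A
      · exact int2 v hvA fun D h => hD D (List.mem_append_left _ h)
      · rw [(off2 v hvA).2]; exact hintg v hv hvA hvB
  · intro v hv
    by_cases hvB : v ∈ verts B
    · exact rad3 v hvB
    · intro c; rw [(off3 v hvB).1]; revert c
      by_cases hvA : v ∈ verts A
      · exact rad2 v hvA
      · intro c; rw [(off2 v hvA).1]; exact hrad v hv c

/-- Reversal of a caterpillar. -/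
def crev {V : Type} (C : Caterpillar V) : Caterpillar V :=
  ⟨C.p, fun i => C.vtx (C.p + 1 - i), fun i => C.leaf (C.p + 1 - i)⟩

theorem crev_verts {V : Type} (C : Caterpillar V) : verts (crev C) = verts C := by
  ext v
  constructor
  · rintro (⟨i, h1, h2, rfl⟩ | ⟨i, h1, h2⟩)
    · simp only [crev] at h2
      exact vtx_mem (by omega) (by omega)
    · exact leaf_mem (by omega) h2
  · rintro (⟨i, h1, h2, rfl⟩ | ⟨i, h1, h2⟩)
    · exact Or.inl ⟨C.p + 1 - i, by omega, by simp only [crev]; omega, by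
        simp only [crev]; congr 1; omega⟩
    · exact Or.inr ⟨C.p + 1 - i, by simp only [crev]; omega, by
        simp only [crev]; rw [← h2]; congr 1; omega⟩

theorem crev_spine {V : Type} (C : Caterpillar V) : (crev C).spine = C.spine := by
  ext v
  constructor
  · rintro ⟨i, h1, h2, rfl⟩
    simp only [crev] at h2
    exact ⟨C.p + 1 - i, by omega, by omega, rfl⟩
  · rintro ⟨i, h1, h2, rfl⟩
    exact ⟨C.p + 1 - i, by omega, by simp only [crev]; omega, by
        simp only [crev]; congr 1; omega⟩

theorem crev_sum {V : Type} (C : Caterpillar V) (h : V → ℝ) (i : ℕ) (hi : i ≤ C.p + 1) :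
    ∑ j ∈ Finset.Icc (C.p + 1 - i + 1) (C.p + 1), ((crev C).leaf j).elim 0 h =
    ∑ j ∈ Finset.range i, (C.leaf j).elim 0 h := by
  refine Finset.sum_nbij' (fun j => C.p + 1 - j) (fun j => C.p + 1 - j) ?_ ?_ ?_ ?_ ?_
  · intro j hj; simp only [Finset.mem_Icc, Finset.mem_range] at *; omega
  · intro j hj; simp only [Finset.mem_Icc, Finset.mem_range] at *; omega
  · intro j hj; simp only [Finset.mem_Icc] at hj; omega
  · intro j hj; simp only [Finset.mem_range] at hj; omega
  · intro j hj; rfl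

theorem crev_cat {V : Type} {G : SimpleGraph V} {L : V → ℕ} {y : V → ℝ} {δ : ℕ}
    {C : Caterpillar V} (hC : IsCaterpillar G L y δ C) : IsCaterpillar G L y δ (crev C) := by
  obtain ⟨c1, c2, c3, c4, c5, c6, c7, c8, n, c9⟩ := hC
  refine ⟨?_, ?_, ?_, ?_, ?_, ?_, ?_, ?_, n, ?_⟩
  · intro i j h1 h2 h3
    simp only [crev] at *
    exact (c1 _ _ (by omega) (by omega) (by omega)).symm
  · intro i h1 h2; simp only [crev] at *; exact c2 _ (by omega) (by omega)
  · intro i h1 h2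
    simp only [crev] at *
    rw [SimpleGraph.dist_comm]
    have := c3 (C.p + 1 - (i + 1)) (by omega) (by omega)
    rwa [show C.p + 1 - (i + 1) + 1 = C.p + 1 - i by omega] at this
  · intro i h w hw; rw [crev_spine]; exact c4 _ (by omega) w hw
  · intro i h1 h2 w hw; simp only [crev] at *; exact c5 _ (by omega) (by omega) w hw
  · intro w hw; simp only [crev] at *
    rw [show C.p + 1 - 0 = C.p + 1 by omega] at hw
    simpa using c7 w hw
  · intro w hw; simp only [crev] at *
    rw [show C.p + 1 - (C.p + 1) = 0 by omega] at hw
    have := c6 w hw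
    rwa [show C.p + 1 - C.p = 1 by omega]
  · intro i j h1 h2 w w' hw hw'
    simp only [crev] at *
    exact (c8 _ _ (by omega) (by omega) _ _ hw' hw).symm
  · rw [← c9]
    have := Finset.sum_range_reflect (fun j => (C.leaf j).elim 0 y) (C.p + 2)
    rw [← this]
    rfl

theorem crev_gidx {V : Type} {L : V → ℕ} {C : Caterpillar V} {l : ℕ}
    (h : GIdx L (crev C) l) : GIdx L C (C.p + 1 - l) := by
  obtain ⟨h1, h2, i₀, i₁, h3, h4, h5, h6, h7⟩ := h
  simp only [crev] at *
  exact ⟨by omega, by omega, C.p + 1 - i₁, C.p + 1 - i₀, by omega, by omega, by omega, h7, h6⟩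

theorem crev_crev_gidx {V : Type} {L : V → ℕ} {C : Caterpillar V} {l : ℕ}
    (h : GIdx L C l) : GIdx L (crev C) (C.p + 1 - l) := by
  obtain ⟨h1, h2, i₀, i₁, h3, h4, h5, h6, h7⟩ := h
  refine ⟨by omega, by simp only [crev]; omega, C.p + 1 - i₁, C.p + 1 - i₀, by omega, by omega,
    by simp only [crev]; omega, ?_, ?_⟩
  · simp only [crev]
    rw [show C.p + 1 - (C.p + 1 - i₁) = i₁ by omega, show C.p + 1 - (C.p + 1 - l) = l by omega]
    exact h7
  · simp only [crev]
    rw [show C.p + 1 - (C.p + 1 - i₀) = i₀ by omega, show C.p + 1 - (C.p + 1 - l) = l by omega]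
    exact h6

theorem crev_inv {V : Type} {G : SimpleGraph V} {L : V → ℕ} {x : V → V → ℝ} {y : V → ℝ}
    {C : Caterpillar V} {lo hi : ℕ} (hC : CInv G L x y C lo hi) :
    CInv G L x y (crev C) (C.p + 1 - hi) (C.p + 1 - lo) where
  cat := crev_cat hC.cat
  hhi := by simp only [crev]; omega
  win l hl := by
    have := hC.win _ (crev_gidx hl)
    have h2 := hl.2.1
    simp only [crev] at h2
    have := hC.hhi
    omega
  out l hl j w hj hj' hw := by
    refine hC.out _ (crev_gidx hl) (C.p + 1 - j) w ?_ (by omega) hw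
    have := hC.win _ (crev_gidx hl)
    have := hC.hhi
    simp only [crev] at *
    omega
  freshv l h1 h2 h3 h4 := by
    have := hC.hhi
    simp only [crev] at *
    exact hC.freshv _ (by omega) (by omega) (by omega) (by omega)
  freshl l w h1 h2 h3 := by
    have := hC.hhi
    simp only [crev] at *
    exact hC.freshl _ w (by omega) (by omega) h3
  radv l h1 h2 := by
    simp only [crev] at *
    exact hC.radv _ (by omega) (by omega)
  radl l w h1 h2 := by
    exact hC.radl _ w (by omega) h2

theorem gamma_gidx {V : Type} {G : SimpleGraph V} {L : V → ℕ} {y : V → ℝ} {δ : ℕ}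
    {C : Caterpillar V} (hC : IsCaterpillar G L y δ C) {i : ℕ} (h1 : 1 ≤ i) (h2 : i ≤ C.p)
    (h : C.vtx i ∈ Gamma L C) : GIdx L C i := by
  obtain ⟨j, j1, j2, j3, h⟩ := h
  have : j = i := by
    rcases lt_trichotomy j i with h | h | h
    · exact absurd j3 (hC.1 _ _ j1 h h2)
    · exact h
    · exact absurd j3.symm (hC.1 _ _ h1 h j2)
  subst this
  exact ⟨h1, h2, h⟩

theorem gidx_gamma {V : Type} {L : V → ℕ}
    {C : Caterpillar V} {i : ℕ} (h : GIdx L C i) : C.vtx i ∈ Gamma L C :=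
  ⟨i, h.1, h.2.1, rfl, h.2.2⟩

theorem sum_ite_some {V : Type} [Fintype V] (P : Prop) [Decidable P] (o : Option V) (a : ℝ)
    [∀ w, Decidable (P ∧ o = some w)]
    (h : o = none → a = 0) : ∑ w, (if P ∧ o = some w then a else 0) = if P then a else 0 := by
  classical
  cases o with
  | none => simp [h rfl]
  | some w =>
    by_cases hP : P
    · rw [Finset.sum_eq_single w]
      · simp [hP]
      · intro b _ hb; rw [if_neg]; rintro ⟨-, h⟩; exact hb (Option.some.inj h).symm
      · simp
    · simp [hP]

theorem sum_ite_eq_and {V : Type} [Fintype V] (Q : Prop) [Decidable Q] (v : V) (a : ℝ)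
    [∀ w, Decidable (w = v ∧ Q)] :
    ∑ w, (if w = v ∧ Q then a else 0) = if Q then a else 0 := by
  classical
  rw [Finset.sum_eq_single v]
  · simp
  · intro b _ hb; rw [if_neg]; rintro ⟨h, -⟩; exact hb h
  · simp

theorem sum_ite_idx (S : Finset ℕ) (P : ℕ → Prop) [DecidablePred P] (f : ℕ → ℝ) (a : ℕ)
    (h : ∀ l ∈ S, P l ↔ l = a) :
    ∑ l ∈ S, (if P l then f l else 0) = if a ∈ S then f a else 0 := by
  rw [Finset.sum_congr rfl (g := fun l => if l = a then f l else 0)]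
  · simp
  · intro l hl; simp only [h l hl]

theorem sum_ite_none (S : Finset ℕ) (P : ℕ → Prop) [DecidablePred P] (f : ℕ → ℝ)
    (h : ∀ l ∈ S, ¬ P l) : ∑ l ∈ S, (if P l then f l else 0) = 0 :=
  Finset.sum_eq_zero fun l hl => if_neg (h l hl)

/-- The flow along a caterpillar. -/
theorem cat_flow {V : Type} [Fintype V] {G : SimpleGraph V} {L : V → ℕ} {k : ℕ}
    {x : V → V → ℝ} {y : V → ℝ} {δ : ℕ} {C : Caterpillar V} (hf : Feas L k x y)
    (hC : IsCaterpillar G L y δ C) {i : ℕ} (hi1 : 1 ≤ i) (hip : i ≤ C.p)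
    (f r : ℕ → ℝ) (m : ℝ) (f0 : ∀ l, 0 ≤ f l) (r0 : ∀ l, 0 ≤ r l)
    (hr : ∀ l, i ≤ l → r (l + 1) = f l - f (l + 1)) (hfp : f (C.p + 1) = 0) (hc1 : f i ≤ 1)
    (hrn : ∀ l, i < l → l ≤ C.p + 1 → C.leaf l = none → r l = 0)
    (hrL : ∀ l w, i < l → l ≤ C.p + 1 → C.leaf l = some w → 0 < r l → L (C.vtx i) < L w)
    (hry : ∀ l w, i < l → l ≤ C.p + 1 → C.leaf l = some w → r l ≤ 1 - y w)
    (hfL : ∀ l, i ≤ l → l + 1 ≤ C.p → 0 < f l → L (C.vtx i) ≤ L (C.vtx (l + 1)))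
    (m0 : 0 ≤ m) (mc : m ≤ f i) (mn : C.leaf i = none → m = 0)
    (my : ∀ w, C.leaf i = some w → m ≤ y w) :
    ∃ (x' : V → V → ℝ) (y' : V → ℝ), Feas L k x' y' ∧
      (∀ v, v ∉ verts C → x' v = x v ∧ y' v = y v) ∧
      (∀ a, 1 ≤ a → a ≤ C.p → a ≠ i → y' (C.vtx a) = 1) ∧
      y' (C.vtx i) = 1 - f i + m ∧
      (∀ b w, b < i → C.leaf b = some w → y' w = y w) ∧
      (∀ w, C.leaf i = some w → y' w = y w - m) ∧
      (∀ b w, i < b → b ≤ C.p + 1 → C.leaf b = some w → y' w = y w + r b) ∧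
      (∀ a c, 1 ≤ a → a ≤ C.p → 0 < x' (C.vtx a) c → 0 < x (C.vtx a) c ∨
        (i < a ∧ 0 < f (a - 1) ∧ 0 < x (C.vtx (a - 1)) c) ∨
        (a = i ∧ ∃ w, C.leaf i = some w ∧ 0 < x w c)) ∧
      (∀ b w c, b ≤ C.p + 1 → C.leaf b = some w → 0 < x' w c → 0 < x w c ∨
        (i < b ∧ 0 < r b ∧ 0 < x (C.vtx (min b C.p)) c)) := by
  classical
  obtain ⟨c1, c2, c3, c4, c5, c6, c7, c8, -⟩ := hC
  -- injectivity facts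
  have vinj : ∀ a b, 1 ≤ a → a ≤ C.p → 1 ≤ b → b ≤ C.p → (C.vtx a = C.vtx b ↔ a = b) := by
    intro a b h1 h2 h3 h4
    refine ⟨fun h => ?_, fun h => by rw [h]⟩
    rcases lt_trichotomy a b with h' | h' | h'
    · exact absurd h (c1 _ _ h1 h' h4)
    · exact h'
    · exact absurd h.symm (c1 _ _ h3 h' h2)
  have linj : ∀ a b w, a ≤ C.p + 1 → b ≤ C.p + 1 → C.leaf b = some w →
      (C.leaf a = some w ↔ a = b) := by
    intro a b w h1 h2 hw
    refine ⟨fun h => ?_, fun h => by rw [h, hw]⟩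
    rcases lt_trichotomy a b with h' | h' | h'
    · exact absurd rfl (c8 _ _ h' h2 w w h hw)
    · exact h'
    · exact absurd rfl (c8 _ _ h' h1 w w hw h)
  have vl : ∀ a b, 1 ≤ a → a ≤ C.p → b ≤ C.p + 1 → C.leaf b ≠ some (C.vtx a) := by
    intro a b h1 h2 h3 h
    exact c4 b h3 _ h ⟨a, h1, h2, rfl⟩
  have lv : ∀ a b w, 1 ≤ a → a ≤ C.p → b ≤ C.p + 1 → C.leaf b = some w → w ≠ C.vtx a := by
    intro a b w h1 h2 h3 h h4
    exact vl a b h1 h2 h3 (by rw [h, h4])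
  let nxt : ℕ → Option V := fun l => if l < C.p then some (C.vtx (l + 1)) else C.leaf (C.p + 1)
  have hrp : r (C.p + 1) = f C.p := by rw [hr _ hip, hfp]; ring
  have nxtn : ∀ l, i ≤ l → l ≤ C.p → nxt l = none → f l = 0 := by
    intro l h1 h2 h3
    simp only [nxt] at h3
    split_ifs at h3 with h4
    have : l = C.p := by omega
    rw [this, ← hrp]; exact hrn _ (by omega) le_rfl h3
  let F : V → V → ℝ := fun u v =>
    ∑ l ∈ Finset.Icc i C.p, (if u = C.vtx l ∧ nxt l = some v then f l else 0) +
    ∑ l ∈ Finset.Icc (i + 1) C.p, (if u = C.vtx l ∧ C.leaf l = some v then r l else 0) +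
    (if v = C.vtx i ∧ C.leaf i = some u then m else 0)
  have hF0 : ∀ u v, 0 ≤ F u v := by
    intro u v
    refine add_nonneg (add_nonneg ?_ ?_) ?_
    · refine Finset.sum_nonneg fun l _ => ?_
      split_ifs
      exacts [f0 l, le_rfl]
    · refine Finset.sum_nonneg fun l _ => ?_
      split_ifs
      exacts [r0 l, le_rfl]
    · split_ifs
      exacts [m0, le_rfl]
  have hout : ∀ u, ∑ v, F u v = ∑ l ∈ Finset.Icc i C.p, (if u = C.vtx l then f l else 0) +
      ∑ l ∈ Finset.Icc (i + 1) C.p, (if u = C.vtx l then r l else 0) +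
      (if C.leaf i = some u then m else 0) := by
    intro u
    simp only [F, Finset.sum_add_distrib]
    congr 1
    · congr 1
      · rw [Finset.sum_comm]
        refine Finset.sum_congr rfl fun l hl => ?_
        rw [Finset.mem_Icc] at hl
        exact sum_ite_some _ _ _ (nxtn l hl.1 hl.2)
      · rw [Finset.sum_comm]
        refine Finset.sum_congr rfl fun l hl => ?_
        rw [Finset.mem_Icc] at hl
        exact sum_ite_some _ _ _ (hrn l (by omega) (by omega))
    · exact sum_ite_eq_and _ _ _
  have hin : ∀ v, ∑ u, F u v = ∑ l ∈ Finset.Icc i C.p, (if nxt l = some v then f l else 0) +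
      ∑ l ∈ Finset.Icc (i + 1) C.p, (if C.leaf l = some v then r l else 0) +
      (if v = C.vtx i then m else 0) := by
    intro v
    simp only [F, Finset.sum_add_distrib]
    congr 1
    · congr 1
      · rw [Finset.sum_comm]
        exact Finset.sum_congr rfl fun l hl => sum_ite_eq_and _ _ _
      · rw [Finset.sum_comm]
        exact Finset.sum_congr rfl fun l hl => sum_ite_eq_and _ _ _
    · exact sum_ite_some _ _ _ mn
  -- evaluations
  have outv : ∀ a, 1 ≤ a → a ≤ C.p → ∑ v, F (C.vtx a) v =
      if i < a then f (a - 1) else if a = i then f i else 0 := by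
    intro a h1 h2
    rw [hout, sum_ite_idx _ _ _ a, sum_ite_idx _ _ _ a, if_neg (vl a i h1 h2 (by omega))]
    · simp only [Finset.mem_Icc]
      rcases lt_trichotomy i a with h | h | h
      · rw [if_pos ⟨h.le, h2⟩, if_pos ⟨h, h2⟩, if_pos h]
        have := hr (a - 1) (by omega)
        rw [show a - 1 + 1 = a by omega] at this
        rw [this]; ring
      · subst h
        rw [if_pos ⟨le_rfl, h2⟩, if_neg (by omega), if_neg (by omega), if_pos rfl]; ring
      · rw [if_neg (by omega), if_neg (by omega), if_neg (by omega), if_neg (by omega)]; ring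
    · intro l hl; rw [Finset.mem_Icc] at hl
      rw [vinj a l h1 h2 (by omega) hl.2, eq_comm]
    · intro l hl; rw [Finset.mem_Icc] at hl
      rw [vinj a l h1 h2 (by omega) hl.2, eq_comm]
  have outl : ∀ b w, b ≤ C.p + 1 → C.leaf b = some w → ∑ v, F w v = if b = i then m else 0 := by
    intro b w hb hw
    rw [hout, sum_ite_none, sum_ite_none]
    · simp only [linj i b w (by omega) hb hw, zero_add, eq_comm (a := i)]
    · intro l hl; rw [Finset.mem_Icc] at hl
      exact lv l b w (by omega) hl.2 hb hw
    · intro l hl; rw [Finset.mem_Icc] at hl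
      exact lv l b w (by omega) hl.2 hb hw
  have inv_ : ∀ a, 1 ≤ a → a ≤ C.p → ∑ u, F u (C.vtx a) =
      if i < a then f (a - 1) else if a = i then m else 0 := by
    intro a h1 h2
    rw [hin, sum_ite_idx _ _ _ (a - 1), sum_ite_none, vinj a i h1 h2 hi1 hip]
    · simp only [Finset.mem_Icc]
      rcases lt_trichotomy i a with h | h | h
      · rw [if_pos (by omega), if_neg (by omega), if_pos h]; ring
      · subst h
        rw [if_neg (by omega), if_pos rfl, if_neg (by omega), if_pos rfl]; ring
      · rw [if_neg (by omega), if_neg (by omega), if_neg (by omega), if_neg (by omega)]; ring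
    · intro l hl; rw [Finset.mem_Icc] at hl
      exact vl a l h1 h2 (by omega)
    · intro l hl; rw [Finset.mem_Icc] at hl
      simp only [nxt]
      split_ifs with h
      · rw [Option.some.injEq, vinj (l + 1) a (by omega) (by omega) h1 h2]; omega
      · constructor
        · intro h'; exact absurd h' (vl a _ h1 h2 le_rfl)
        · intro h'; omega
  have inl : ∀ b w, b ≤ C.p + 1 → C.leaf b = some w → ∑ u, F u w =
      if i < b then r b else 0 := by
    intro b w hb hw
    have e1 : ∑ l ∈ Finset.Icc i C.p, (if nxt l = some w then f l else 0) =
        if b = C.p + 1 then f C.p else 0 := by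
      by_cases hbp : b = C.p + 1
      · rw [sum_ite_idx _ _ _ C.p]
        · simp [hip, hbp]
        · intro l hl; rw [Finset.mem_Icc] at hl
          simp only [nxt]
          split_ifs with h
          · constructor
            · intro h'
              exact absurd (Option.some.inj h').symm (lv (l + 1) b w (by omega) (by omega) hb hw)
            · intro h'; omega
          · constructor
            · intro h'; omega
            · intro h'; rw [← hbp]; exact hw
      · rw [if_neg hbp, sum_ite_none]
        intro l hl; rw [Finset.mem_Icc] at hl
        simp only [nxt]
        split_ifs with h
        · intro h'
          exact absurd (Option.some.inj h').symm (lv (l + 1) b w (by omega) (by omega) hb hw)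
        · intro h'
          have := (linj (C.p + 1) b w le_rfl hb hw).1 h'
          omega
    rw [hin, e1, sum_ite_idx _ _ _ b, if_neg (lv i b w hi1 hip hb hw)]
    · simp only [Finset.mem_Icc]
      by_cases hbp : b = C.p + 1
      · rw [if_pos hbp, if_neg (by omega), if_pos (by omega), hbp, hrp]; ring
      · rw [if_neg hbp]
        by_cases h : i < b
        · rw [if_pos (by omega), if_pos h]; ring
        · rw [if_neg (by omega), if_neg h]; ring
    · intro l hl; rw [Finset.mem_Icc] at hl
      exact linj l b w (by omega) hb hw
  have hpos : ∀ u v, 0 < F u v →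
      (∃ l, i ≤ l ∧ l ≤ C.p ∧ u = C.vtx l ∧ nxt l = some v ∧ 0 < f l) ∨
      (∃ l, i < l ∧ l ≤ C.p ∧ u = C.vtx l ∧ C.leaf l = some v ∧ 0 < r l) ∨
      (v = C.vtx i ∧ C.leaf i = some u) := by
    intro u v h
    by_contra hcon
    push Not at hcon
    obtain ⟨g1, g2, g3⟩ := hcon
    have : F u v = 0 := by
      simp only [F]
      rw [Finset.sum_eq_zero, Finset.sum_eq_zero, if_neg]
      · simp
      · rintro ⟨h1, h2⟩; exact g3 h1 h2
      · intro l hl; rw [Finset.mem_Icc] at hl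
        split_ifs with h'
        · exact le_antisymm (g2 l (by omega) hl.2 h'.1 h'.2) (r0 l)
        · rfl
      · intro l hl; rw [Finset.mem_Icc] at hl
        split_ifs with h'
        · exact le_antisymm (g1 l (by omega) hl.2 h'.1 h'.2) (f0 l)
        · rfl
    linarith
  have hoffF : ∀ v, v ∉ verts C → (∀ u, F u v = 0) ∧ (∀ w, F v w = 0) := by
    intro v hv
    constructor
    · intro u
      refine le_antisymm (not_lt.1 fun h => ?_) (hF0 u v)
      rcases hpos u v h with ⟨l, h1, h2, h3, h4, -⟩ | ⟨l, h1, h2, h3, h4, -⟩ | ⟨h1, h2⟩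
      · simp only [nxt] at h4
        split_ifs at h4 with h5
        · exact hv (Option.some.inj h4 ▸ vtx_mem (by omega) (by omega))
        · exact hv (leaf_mem le_rfl h4)
      · exact hv (leaf_mem (by omega) h4)
      · exact hv (h1 ▸ vtx_mem hi1 hip)
    · intro w
      refine le_antisymm (not_lt.1 fun h => ?_) (hF0 v w)
      rcases hpos v w h with ⟨l, h1, h2, h3, h4, -⟩ | ⟨l, h1, h2, h3, h4, -⟩ | ⟨h1, h2⟩
      · exact hv (h3 ▸ vtx_mem (by omega) (by omega))
      · exact hv (h3 ▸ vtx_mem (by omega) (by omega))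
      · exact hv (leaf_mem (by omega) h2)
  have fanti : ∀ l, i ≤ l → f (l + 1) ≤ f l := by
    intro l hl; have := hr l hl; have := r0 (l + 1); linarith
  have fle : ∀ l, i ≤ l → f l ≤ f i := by
    intro l hl
    induction l, hl using Nat.le_induction with
    | base => exact le_rfl
    | succ n hn ih => exact (fanti n hn).trans ih
  let y' : V → ℝ := fun v => y v + ∑ u, F u v - ∑ w, F v w
  have yv : ∀ a, 1 ≤ a → a ≤ C.p → a ≠ i → y' (C.vtx a) = 1 := by
    intro a h1 h2 h3
    simp only [y']
    rw [inv_ a h1 h2, outv a h1 h2, c2 a h1 h2, if_neg h3, if_neg h3]; ring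
  have yi : y' (C.vtx i) = 1 - f i + m := by
    simp only [y']
    rw [inv_ i hi1 hip, outv i hi1 hip, c2 i hi1 hip]
    simp only [lt_irrefl, if_true, if_false]; ring
  have yl : ∀ b w, b < i → C.leaf b = some w → y' w = y w := by
    intro b w h1 h2
    simp only [y']
    rw [inl b w (by omega) h2, outl b w (by omega) h2, if_neg (by omega), if_neg (by omega)]; ring
  have yli : ∀ w, C.leaf i = some w → y' w = y w - m := by
    intro w h2
    simp only [y']
    rw [inl i w (by omega) h2, outl i w (by omega) h2, if_neg (by omega), if_pos rfl]; ring
  have ylr : ∀ b w, i < b → b ≤ C.p + 1 → C.leaf b = some w → y' w = y w + r b := by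
    intro b w h1 h2 h3
    simp only [y']
    rw [inl b w (by omega) h3, outl b w (by omega) h3, if_pos h1, if_neg (by omega)]; ring
  obtain ⟨x', hx1, hx2, hx3⟩ := flow_step hf F hF0 (L (C.vtx i)) y' (fun v => rfl) (by
    intro v
    by_cases hv : v ∈ verts C
    · rcases hv with ⟨a, h1, h2, rfl⟩ | ⟨b, h1, h2⟩
      · rw [outv a h1 h2, c2 a h1 h2]
        split_ifs with h h'
        · exact (fle _ (by omega)).trans hc1
        · exact hc1
        · exact zero_le_one
      · rw [outl b v h1 h2]
        split_ifs with h
        · subst h; exact my v h2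
        · exact hf.y0 v
    · simp only [(hoffF v hv).2, Finset.sum_const_zero]; exact hf.y0 v) (by
    intro v
    by_cases hv : v ∈ verts C
    · rcases hv with ⟨a, h1, h2, rfl⟩ | ⟨b, h1, h2⟩
      · rw [outv a h1 h2, inv_ a h1 h2]
        rcases lt_trichotomy i a with h | h | h
        · rw [if_pos h, if_pos h]
          rcases (f0 (a - 1)).eq_or_lt with h' | h'
          · rw [← h']
            rcases le_total (L (C.vtx a)) (L (C.vtx i)) with hLv | hLv
            · exact Or.inl ⟨hLv, Or.inl rfl⟩
            · exact Or.inr ⟨hLv, le_rfl, Or.inl rfl⟩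
          · right
            have := hfL (a - 1) (by omega) (by omega) h'
            rw [show a - 1 + 1 = a by omega] at this
            exact ⟨this, le_rfl, Or.inr (yv a h1 h2 (by omega))⟩
        · subst h; exact Or.inl ⟨le_rfl, Or.inr rfl⟩
        · rw [if_neg (by omega), if_neg (by omega), if_neg (by omega), if_neg (by omega)]
          rcases le_total (L (C.vtx a)) (L (C.vtx i)) with hLv | hLv
          · exact Or.inl ⟨hLv, Or.inl rfl⟩
          · exact Or.inr ⟨hLv, le_rfl, Or.inl rfl⟩
      · rw [outl b v h1 h2, inl b v h1 h2]
        rcases lt_trichotomy i b with h | h | h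
        · rw [if_pos h, if_neg (by omega)]
          rcases (r0 b).eq_or_lt with h' | h'
          · rw [← h']
            rcases le_total (L v) (L (C.vtx i)) with hLv | hLv
            · exact Or.inl ⟨hLv, Or.inl rfl⟩
            · exact Or.inr ⟨hLv, le_rfl, Or.inl rfl⟩
          · right
            exact ⟨(hrL b v h h1 h2 h').le, h'.le, Or.inl rfl⟩
        · subst h
          rw [if_neg (by omega)]
          exact Or.inl ⟨(c5 i hi1 hip v h2).1, Or.inl rfl⟩
        · rw [if_neg (by omega), if_neg (by omega)]
          rcases le_total (L v) (L (C.vtx i)) with hLv | hLv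
          · exact Or.inl ⟨hLv, Or.inl rfl⟩
          · exact Or.inr ⟨hLv, le_rfl, Or.inl rfl⟩
    · simp only [(hoffF v hv).2, (hoffF v hv).1, Finset.sum_const_zero]
      rcases le_total (L v) (L (C.vtx i)) with hLv | hLv
      · exact Or.inl ⟨hLv, Or.inl trivial⟩
      · exact Or.inr ⟨hLv, le_rfl, Or.inl trivial⟩) (by
    intro v
    by_cases hv : v ∈ verts C
    · rcases hv with ⟨a, h1, h2, rfl⟩ | ⟨b, h1, h2⟩
      · by_cases h : a = i
        · subst h; rw [yi]; linarith
        · rw [yv a h1 h2 h]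
      · rcases lt_trichotomy i b with h | h | h
        · rw [ylr b v h h1 h2]; linarith [hry b v h h1 h2]
        · subst h; rw [yli v h2]; linarith [hf.y1 v]
        · rw [yl b v h h2]; exact hf.y1 v
    · simp only [y', (hoffF v hv).2, (hoffF v hv).1, Finset.sum_const_zero]
      linarith [hf.y1 v])
  refine ⟨x', y', hx1, ?_, yv, yi, yl, yli, ylr, ?_, ?_⟩
  · intro v hv
    refine ⟨hx3 v (hoffF v hv).1 (hoffF v hv).2, ?_⟩
    simp only [y', (hoffF v hv).2, (hoffF v hv).1, Finset.sum_const_zero]; ring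
  · intro a c h1 h2 hx
    rcases hx2 _ c hx with h | ⟨u, hu, hxu⟩
    · exact Or.inl h
    · right
      rcases hpos u _ hu with ⟨l, g1, g2, g3, g4, g5⟩ | ⟨l, g1, g2, g3, g4, g5⟩ | ⟨g1, g2⟩
      · left
        simp only [nxt] at g4
        split_ifs at g4 with h5
        · have := (vinj (l + 1) a (by omega) (by omega) h1 h2).1 (Option.some.inj g4)
          have e : a - 1 = l := by omega
          rw [e, ← g3]; exact ⟨by omega, g5, hxu⟩
        · exact absurd g4 (vl a _ h1 h2 le_rfl)
      · exact absurd g4 (vl a l h1 h2 (by omega))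
      · right
        exact ⟨(vinj a i h1 h2 hi1 hip).1 g1, u, g2, hxu⟩
  · intro b w c h1 h2 hx
    rcases hx2 _ c hx with h | ⟨u, hu, hxu⟩
    · exact Or.inl h
    · right
      rcases hpos u _ hu with ⟨l, g1, g2, g3, g4, g5⟩ | ⟨l, g1, g2, g3, g4, g5⟩ | ⟨g1, g2⟩
      · simp only [nxt] at g4
        split_ifs at g4 with h5
        · exact absurd (Option.some.inj g4).symm (lv (l + 1) b w (by omega) (by omega) h1 h2)
        · have hb := (linj _ b w le_rfl h1 h2).1 g4
          have hl : l = C.p := by omega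
          subst hb; subst hl
          rw [min_eq_right (by omega), ← g3, hrp]
          exact ⟨by omega, g5, hxu⟩
      · have hb := (linj l b w (by omega) h1 h2).1 g4
        subst hb
        rw [min_eq_left g2, ← g3]
        exact ⟨g1, g5, hxu⟩
      · exact absurd g1 (lv i b w hi1 hip h1 h2)

theorem sum_split (e : ℕ → ℝ) {i p : ℕ} (h : i ≤ p) :
    ∑ l ∈ Finset.range (p + 2), e l =
      ∑ l ∈ Finset.range i, e l + e i + ∑ l ∈ Finset.Icc (i + 1) (p + 1), e l := by
  rw [← Finset.sum_range_succ, ← Finset.Ico_add_one_right_eq_Icc,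
    Finset.sum_range_add_sum_Ico _ (by omega : i + 1 ≤ p + 1 + 1)]


theorem telescope (f r : ℕ → ℝ) (i : ℕ) (hr : ∀ l, i ≤ l → r (l + 1) = f l - f (l + 1)) :
    ∀ n, i ≤ n → ∑ l ∈ Finset.Icc (i + 1) n, r l = f i - f n := by
  intro n hn
  induction n, hn using Nat.le_induction with
  | base => simp
  | succ n hn ih => rw [Finset.sum_Icc_succ_top (by omega), ih, hr n hn]; ring

theorem step_right {V : Type} [Fintype V] {G : SimpleGraph V} (hG : G.Connected)
    {L : V → ℕ} {k : ℕ} {x : V → V → ℝ} {y : V → ℝ} {C : Caterpillar V} {lo hi i : ℕ}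
    (IH : ∀ (x : V → V → ℝ) (y : V → ℝ) (C : Caterpillar V) (lo' hi' : ℕ), hi' - lo' < hi - lo →
      Feas L k x y → CInv G L x y C lo' hi' → Good G L k x y C)
    (hf : Feas L k x y) (hI : CInv G L x y C lo hi) (hi : GIdx L C i)
    (hmin : ∀ l, GIdx L C l → L (C.vtx i) ≤ L (C.vtx l))
    (hsep : (⌈∑ j ∈ Finset.Icc (i + 1) (C.p + 1), (C.leaf j).elim 0 y⌉ : ℝ) -
        ∑ j ∈ Finset.Icc (i + 1) (C.p + 1), (C.leaf j).elim 0 y ≤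
        ∑ j ∈ Finset.Icc (i + 1) (C.p + 1),
          (C.leaf j).elim 0 (fun w => if L (C.vtx i) < L w then 1 - y w else 0)) :
    Good G L k x y C := by
  classical
  rename_i hi_
  set hb := hi_ with hhb
  set S2 := ∑ j ∈ Finset.Icc (i + 1) (C.p + 1), (C.leaf j).elim 0 y with hS2
  set c : ℝ := (⌈S2⌉ : ℝ) - S2 with hc
  have hc0 : 0 ≤ c := sub_nonneg.2 (Int.le_ceil _)
  have hc1 : c < 1 := by have := Int.ceil_lt_add_one S2; rw [hc]; linarith
  obtain ⟨hlo, hhi⟩ := hI.win i hi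
  obtain ⟨hi1, hip, i₀, i₁, hi0, hi1', hi1p, ⟨w₀, hw₀, hLw₀⟩, ⟨w₁, hw₁, hLw₁⟩⟩ := id hi
  have hC := hI.cat
  obtain ⟨c1, c2, c3, c4, c5, c6, c7, c8, N, c9⟩ := id hI.cat
  have hhbp := hI.hhi
  -- the flow
  let d : ℕ → ℝ := fun j =>
    (C.leaf j).elim 0 (fun w => if L (C.vtx i) < L w then 1 - y w else 0)
  have d0 : ∀ j, 0 ≤ d j := by
    intro j
    simp only [d]
    cases C.leaf j with
    | none => exact le_rfl
    | some w =>
      simp only [Option.elim]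
      split_ifs
      · linarith [hf.y1 w]
      · exact le_rfl
  have dpos : ∀ j, 0 < d j → ∃ w, C.leaf j = some w ∧ L (C.vtx i) < L w := by
    intro j
    simp only [d]
    cases C.leaf j with
    | none => intro h; simp at h
    | some w =>
      simp only [Option.elim]
      split_ifs with h
      · intro _; exact ⟨w, rfl, h⟩
      · intro h; simp at h
  have dle : ∀ j w, C.leaf j = some w → d j ≤ 1 - y w := by
    intro j w hw
    simp only [d, hw, Option.elim]
    split_ifs
    · exact le_rfl
    · linarith [hf.y1 w]
  have deq : ∀ j w, C.leaf j = some w → L (C.vtx i) < L w → d j = 1 - y w := by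
    intro j w hw hL
    simp only [d, hw, Option.elim, if_pos hL]
  let cp : ℕ → ℝ := fun l => ∑ j ∈ Finset.Icc (i + 1) l, d j
  have cpi : ∀ l, l ≤ i → cp l = 0 := by
    intro l hl; simp only [cp]; rw [Finset.Icc_eq_empty (by omega)]; rfl
  have cps : ∀ l, i ≤ l → cp (l + 1) = cp l + d (l + 1) := by
    intro l hl; simp only [cp]; rw [Finset.sum_Icc_succ_top (by omega)]
  let f : ℕ → ℝ := fun l => max 0 (c - cp l)
  let r : ℕ → ℝ := fun l => f (l - 1) - f l
  have f0 : ∀ l, 0 ≤ f l := fun l => le_max_left _ _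
  have fi : f i = c := by simp only [f, cpi i le_rfl, sub_zero]; exact max_eq_right hc0
  have hr : ∀ l, i ≤ l → r (l + 1) = f l - f (l + 1) := fun l _ => rfl
  have rstep : ∀ l, i ≤ l → 0 ≤ r (l + 1) ∧ r (l + 1) ≤ d (l + 1) := by
    intro l hl
    rw [hr l hl]
    simp only [f, cps l hl]
    have := d0 (l + 1)
    constructor
    · rcases max_cases 0 (c - cp l) with h | h <;>
      rcases max_cases 0 (c - (cp l + d (l + 1))) with h' | h' <;> linarith
    · rcases max_cases 0 (c - cp l) with h | h <;>
      rcases max_cases 0 (c - (cp l + d (l + 1))) with h' | h' <;> linarith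
  have r0 : ∀ l, 0 ≤ r l := by
    intro l
    by_cases h : l ≤ i
    · simp only [r, f, cpi l h, cpi (l - 1) (by omega), sub_self, le_refl]
    · have := (rstep (l - 1) (by omega)).1
      rwa [show l - 1 + 1 = l by omega] at this
  have rd : ∀ l, i < l → r l ≤ d l := by
    intro l h
    have := (rstep (l - 1) (by omega)).2
    rwa [show l - 1 + 1 = l by omega] at this
  have hfp : f (C.p + 1) = 0 := by
    simp only [f, cp]
    exact max_eq_left (by linarith)
  have fanti : ∀ a b, i ≤ a → a ≤ b → f b ≤ f a := by
    intro a b ha hab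
    induction b, hab using Nat.le_induction with
    | base => exact le_rfl
    | succ n hn ih => have := (rstep n (by omega)).1; rw [hr n (by omega)] at this; linarith
  have cptail : ∀ l, i ≤ l → l ≤ C.p + 1 → (∀ j, l < j → j ≤ C.p + 1 → d j = 0) → f l = 0 := by
    intro l h1 h2 h3
    have : cp (C.p + 1) = cp l := by
      simp only [cp]
      symm
      refine Finset.sum_subset (fun j hj => ?_) (fun j hj hj' => ?_)
      · rw [Finset.mem_Icc] at *; omega
      · rw [Finset.mem_Icc] at *; exact h3 j (by omega) (by omega)
    rw [← hfp]; simp only [f, this]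
  have flarge : ∀ l, i ≤ l → l ≤ C.p + 1 → 0 < f l →
      ∃ j w, l < j ∧ j ≤ C.p + 1 ∧ C.leaf j = some w ∧ L (C.vtx i) < L w := by
    intro l h1 h2 h3
    by_contra hcon
    push Not at hcon
    have := cptail l h1 h2 fun j h4 h5 => by
      refine le_antisymm (not_lt.1 fun h => ?_) (d0 j)
      obtain ⟨w, hw, hL⟩ := dpos j h
      have := hcon j w h4 h5 hw
      omega
    linarith
  have hfL : ∀ l, i ≤ l → l + 1 ≤ C.p → 0 < f l → L (C.vtx i) ≤ L (C.vtx (l + 1)) := by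
    intro l h1 h2 h3
    obtain ⟨j, w, h4, h5, h6, h7⟩ := flarge l h1 (by omega) h3
    by_contra hcon
    push Not at hcon
    by_cases h : j = l + 1
    · subst h
      have := (c5 _ (by omega) h2 w h6).1
      omega
    · have : GIdx L C (l + 1) := ⟨by omega, h2, i₀, j, by omega, by omega, h5,
        ⟨w₀, hw₀, by omega⟩, ⟨w, h6, by omega⟩⟩
      have := hmin _ this
      omega
  let m : ℝ := (C.leaf i).elim 0 (fun w => min c (y w))
  have m0 : 0 ≤ m := by
    simp only [m]
    cases C.leaf i with
    | none => exact le_rfl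
    | some w => exact le_min hc0 (hf.y0 w)
  have mc : m ≤ c := by
    simp only [m]
    cases C.leaf i with
    | none => exact hc0
    | some w => exact min_le_left _ _
  have mn : C.leaf i = none → m = 0 := by intro h; simp only [m, h, Option.elim]
  have my : ∀ w, C.leaf i = some w → m = min c (y w) := by
    intro w h; simp only [m, h, Option.elim]
  obtain ⟨x', y', hf', off, yv, yi, yl, yli, ylr, sv, sl⟩ :=
    cat_flow hf hC hi1 hip f r m f0 r0 hr hfp (by rw [fi]; exact hc1.le)
      (fun l h1 h2 h3 => le_antisymm ((rd l h1).trans (by simp only [d, h3, Option.elim, le_refl]))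
        (r0 l))
      (fun l w h1 h2 h3 h4 => by
        obtain ⟨w', hw', hL⟩ := dpos l (lt_of_lt_of_le h4 (rd l h1))
        rw [h3] at hw'; rwa [Option.some.inj hw'])
      (fun l w h1 h2 h3 => (rd l h1).trans (dle l w h3)) hfL m0 (by rw [fi]; exact mc) mn
      (fun w h => by rw [my w h]; exact min_le_right _ _)
  rw [fi] at yi
  -- the last index of the flow
  have hex : ∃ j, i ≤ j ∧ f j = 0 := ⟨C.p + 1, by omega, hfp⟩
  obtain ⟨js, ⟨hijs, fjs⟩, jmin⟩ : ∃ js, (i ≤ js ∧ f js = 0) ∧ ∀ l, i ≤ l → l < js → 0 < f l := by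
    refine ⟨Nat.find hex, Nat.find_spec hex, fun l h1 h2 => ?_⟩
    have := Nat.find_min hex h2
    exact lt_of_le_of_ne (f0 l) fun h => this ⟨h1, h.symm⟩
  have fhi : f hb = 0 := by
    refine cptail hb hhi.le hhbp fun j h1 h2 => ?_
    refine le_antisymm (not_lt.1 fun h => ?_) (d0 j)
    obtain ⟨w, hw, hL⟩ := dpos j h
    have := hI.out i hi j w (Or.inr h1) h2 hw
    omega
  have hjshi : js ≤ hb := by
    by_contra h
    have := jmin hb hhi.le (by omega)
    linarith
  have ffar : ∀ l, js ≤ l → f l = 0 := fun l h =>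
    le_antisymm (by rw [← fjs]; exact fanti js l hijs h) (f0 l)
  have ffresh : ∀ l, i ≤ l → 0 < f l → l < hb := by
    intro l h1 h2
    by_contra h
    have := ffar l (by omega)
    linarith
  have filled : ∀ l w, i < l → l < js → l ≤ C.p + 1 → C.leaf l = some w →
      L (C.vtx i) < L w → y' w = 1 := by
    intro l w h1 h2 h3 h4 h5
    rw [ylr l w h1 h3 h4]
    have e1 := jmin l (by omega) h2
    have e2 := cps (l - 1) (by omega)
    have e3 := fanti (l - 1) l (by omega) (by omega)
    rw [show l - 1 + 1 = l by omega] at e2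
    rw [deq l w h4 h5] at e2
    have e4 : f l = c - cp l := by
      simp only [f] at e1 ⊢
      rcases max_cases 0 (c - cp l) with h | h <;> linarith
    have e5 : f (l - 1) = c - cp (l - 1) := by
      have : 0 < f (l - 1) := by linarith
      simp only [f] at this ⊢
      rcases max_cases 0 (c - cp (l - 1)) with h | h <;> linarith
    simp only [r]
    linarith
  -- radii
  have radv' : ∀ a, 1 ≤ a → a ≤ C.p → Rad G x' 26 (C.vtx a) := by
    intro a h1 h2 z hz
    rcases sv a z h1 h2 hz with h | ⟨h3, h4, h5⟩ | ⟨h3, w, h4, h5⟩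
    · exact hI.radv a h1 h2 z h
    · have g1 := hI.freshv (a - 1) (by omega) (by omega) (by omega)
        (ffresh _ (by omega) h4) z h5
      have g2 := c3 (a - 1) (by omega) (by omega)
      rw [show a - 1 + 1 = a by omega, SimpleGraph.dist_comm] at g2
      have := hG.dist_triangle (u := C.vtx a) (v := C.vtx (a - 1)) (w := z)
      omega
    · subst h3
      have g1 := hI.freshl a w hlo hhi h4 z h5
      have g2 := (c5 a h1 h2 w h4).2.2.2
      have := hG.dist_triangle (u := C.vtx a) (v := w) (w := z)
      omega
  have radl' : ∀ b w, b ≤ C.p + 1 → C.leaf b = some w → Rad G x' 47 w := by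
    intro b w h1 h2 z hz
    rcases sl b w z h1 h2 hz with h | ⟨h3, h4, h5⟩
    · exact hI.radl b w h1 h2 z h
    · have g1 := hI.radv (min b C.p) (by omega) (by omega) z h5
      have g2 : G.dist w (C.vtx (min b C.p)) ≤ 21 := by
        by_cases hb : b ≤ C.p
        · rw [min_eq_left hb, SimpleGraph.dist_comm]; exact (c5 b (by omega) hb w h2).2.2.2
        · rw [min_eq_right (by omega)]
          have : b = C.p + 1 := by omega
          subst this
          exact (c7 w h2).1
      have := hG.dist_triangle (u := w) (v := C.vtx (min b C.p)) (w := z)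
      omega
  have ypos : ∀ b w, b ≤ C.p + 1 → C.leaf b = some w → 0 < y w ∧ y w < 1 := by
    intro b w h1 h2
    by_cases hb : b = 0
    · subst hb; exact (c6 w h2).2
    · by_cases hb' : b = C.p + 1
      · subst hb'; exact (c7 w h2).2
      · have := c5 b (by omega) (by omega) w h2
        exact ⟨this.2.1, this.2.2.1⟩
  -- the right piece
  have hBex : ∃ B, CInv G L x' y' B (js - i) (hb - i) ∧
      (∀ v ∈ verts B, (∃ a, i < a ∧ a ≤ C.p ∧ C.vtx a = v) ∨
        (∃ b, i < b ∧ b ≤ C.p + 1 ∧ C.leaf b = some v)) ∧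
      (∀ a, i < a → a ≤ C.p → C.vtx a ∈ verts B) ∧
      (∀ b w, i < b → b ≤ C.p + 1 → C.leaf b = some w → w ∉ verts B → y' w = 1) := by
    let B : Caterpillar V := ⟨C.p - i, fun l => C.vtx (l + i), fun l => if l = 0 then none else
      (C.leaf (l + i)).filter (fun w => decide (y' w < 1))⟩
    have Bleaf : ∀ l w, B.leaf l = some w ↔ 1 ≤ l ∧ C.leaf (l + i) = some w ∧ y' w < 1 := by
      intro l w
      simp only [B]
      by_cases h : l = 0
      · simp [h]
      · rw [if_neg h, Option.filter_eq_some_iff, decide_eq_true_iff]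
        have : 1 ≤ l := by omega
        tauto
    have Bp : B.p = C.p - i := rfl
    have Bv : ∀ l, B.vtx l = C.vtx (l + i) := fun l => rfl
    have Bg : ∀ l, GIdx L B l → GIdx L C (l + i) ∧ js < l + i := by
      rintro l ⟨h1, h2, j₀, j₁, h3, h4, h5, ⟨u₀, hu₀, hL₀⟩, ⟨u₁, hu₁, hL₁⟩⟩
      rw [Bp] at h2 h5
      rw [Bleaf] at hu₀ hu₁
      rw [Bv] at hL₀ hL₁
      have hg : GIdx L C (l + i) := ⟨by omega, by omega, j₀ + i, j₁ + i, by omega, by omega,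
        by omega, ⟨u₀, hu₀.2.1, hL₀⟩, ⟨u₁, hu₁.2.1, hL₁⟩⟩
      refine ⟨hg, ?_⟩
      by_contra hcon
      have h6 := hmin _ hg
      have := filled (j₀ + i) u₀ (by omega) (by omega) (by omega) hu₀.2.1 (by omega)
      linarith [hu₀.2.2]
    refine ⟨B, ⟨⟨?_, ?_, ?_, ?_, ?_, ?_, ?_, ?_, ?_⟩, ?_, ?_, ?_, ?_, ?_, ?_, ?_⟩, ?_, ?_, ?_⟩
    · intro a b h1 h2 h3
      rw [Bp] at h3
      exact c1 _ _ (by omega) (by omega) (by omega)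
    · intro a h1 h2
      rw [Bp] at h2
      exact yv _ (by omega) (by omega) (by omega)
    · intro a h1 h2
      rw [Bp] at h2
      rw [Bv a, Bv (a + 1), show a + 1 + i = a + i + 1 by omega]
      exact c3 _ (by omega) (by omega)
    · intro a h1 w hw
      rw [Bp] at h1
      rw [Bleaf] at hw
      rintro ⟨b, h2, h3, h4⟩
      rw [Bp] at h3
      exact c4 _ (by omega) w hw.2.1 ⟨b + i, by omega, by omega, h4⟩
    · intro a h1 h2 w hw
      rw [Bp] at h2
      rw [Bleaf] at hw
      have := c5 (a + i) (by omega) (by omega) w hw.2.1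
      refine ⟨this.1, ?_, hw.2.2, this.2.2.2⟩
      rw [ylr (a + i) w (by omega) (by omega) hw.2.1]
      linarith [r0 (a + i)]
    · intro w hw
      rw [Bleaf] at hw
      omega
    · intro w hw
      rw [Bleaf, Bp, show C.p - i + 1 + i = C.p + 1 by omega] at hw
      rw [Bp, Bv, show C.p - i + i = C.p by omega]
      refine ⟨(c7 w hw.2.1).1, ?_, hw.2.2⟩
      rw [ylr (C.p + 1) w (by omega) (by omega) hw.2.1]
      linarith [r0 (C.p + 1), (c7 w hw.2.1).2.1]
    · intro a b h1 h2 w w' hw hw'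
      rw [Bp] at h2
      rw [Bleaf] at hw hw'
      exact c8 (a + i) (b + i) (by omega) (by omega) w w' hw.2.1 hw'.2.1
    · have hterm : ∀ l, i < l → l ≤ C.p + 1 → ∃ n : ℤ,
          ((C.leaf l).filter (fun w => decide (y' w < 1))).elim 0 y' =
            (C.leaf l).elim 0 y + r l - n := by
        intro l h1 h2
        cases hl : C.leaf l with
        | none =>
          refine ⟨0, ?_⟩
          have := rd l h1
          have h3 := r0 l
          simp only [d, hl, Option.elim] at this
          simp only [Option.filter, Option.elim]
          simp; linarith
        | some w =>
          have e := ylr l w h1 h2 hl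
          have e2 := (rd l h1).trans (dle l w hl)
          by_cases h : y' w < 1
          · refine ⟨0, ?_⟩
            rw [Option.filter_some, if_pos (by simpa using h), Option.elim_some, Option.elim_some, e]
            simp
          · refine ⟨1, ?_⟩
            simp only [Option.filter, h, decide_false, Option.elim]
            simp only [Bool.false_eq_true, if_false]
            simp; linarith
      choose! n hn using hterm
      refine ⟨⌈S2⌉ - ∑ l ∈ Finset.Icc (i + 1) (C.p + 1), n l, ?_⟩
      have e1 : ∑ l ∈ Finset.range (B.p + 2), (B.leaf l).elim 0 y' =
          ∑ l ∈ Finset.Icc (i + 1) (C.p + 1),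
            ((C.leaf l).filter (fun w => decide (y' w < 1))).elim 0 y' := by
        rw [Finset.sum_range_succ', ← Finset.Ico_add_one_right_eq_Icc,
          Finset.sum_Ico_eq_sum_range, Bp, show C.p + 1 + 1 - (i + 1) = C.p - i + 1 by omega]
        simp only [B, if_true, Option.elim, add_zero]
        refine Finset.sum_congr rfl fun l _ => ?_
        rw [if_neg (by omega), show l + 1 + i = i + 1 + l by omega]
      rw [e1, Finset.sum_congr rfl (fun l hl => hn l (by rw [Finset.mem_Icc] at hl; omega)
        (by rw [Finset.mem_Icc] at hl; omega)), Finset.sum_sub_distrib, Finset.sum_add_distrib,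
        telescope f r i hr _ (by omega), fi, hfp]
      push_cast
      rw [← hS2, hc]; ring
    · rw [Bp]; omega
    · intro l hl
      obtain ⟨h1, h2⟩ := Bg l hl
      have := hI.win _ h1
      omega
    · intro l hl j w hj hj' hw
      obtain ⟨h1, h2⟩ := Bg l hl
      rw [Bp] at hj'
      rw [Bleaf] at hw
      rw [Bv]
      have h3 := hmin _ h1
      rcases hj with hj | hj
      · by_contra hcon
        have := filled (j + i) w (by omega) (by omega) (by omega) hw.2.1 (by omega)
        linarith [hw.2.2]
      · exact hI.out _ h1 (j + i) w (Or.inr (by omega)) (by omega) hw.2.1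
    · intro l h1 h2 h3 h4 z hz
      rw [Bp] at h2
      rcases sv (l + i) z (by omega) (by omega) hz with h | ⟨h5, h6, h7⟩ | ⟨h5, -⟩
      · exact hI.freshv (l + i) (by omega) (by omega) (by omega) (by omega) z h
      · have := ffar (l + i - 1) (by omega)
        linarith
      · omega
    · intro l w h3 h4 hw z hz
      rw [Bleaf] at hw
      rcases sl (l + i) w z (by omega) hw.2.1 hz with h | ⟨h5, h6, h7⟩
      · exact hI.freshl (l + i) w (by omega) (by omega) hw.2.1 z h
      · have e1 := ffar (l + i - 1) (by omega)
        have e2 := ffar (l + i) (by omega)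
        simp only [r, e1, e2] at h6
        linarith
    · intro l h1 h2
      rw [Bp] at h2
      exact radv' (l + i) (by omega) (by omega)
    · intro l w h1 hw
      rw [Bp] at h1
      rw [Bleaf] at hw
      exact radl' (l + i) w (by omega) hw.2.1
    · rintro v (⟨a, h1, h2, h3⟩ | ⟨b, h1, h2⟩)
      · rw [Bp] at h2
        exact Or.inl ⟨a + i, by omega, by omega, h3⟩
      · rw [Bp] at h1
        rw [Bleaf] at h2
        exact Or.inr ⟨b + i, by omega, by omega, h2.2.1⟩
    · intro a h1 h2
      refine Or.inl ⟨a - i, by omega, by rw [Bp]; omega, ?_⟩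
      rw [Bv]; congr 1; omega
    · intro b w h1 h2 h3 h4
      by_contra hcon
      refine h4 (Or.inr ⟨b - i, by rw [Bp]; omega, ?_⟩)
      rw [Bleaf, show b - i + i = b by omega]
      exact ⟨by omega, h3, lt_of_le_of_ne (hf'.y1 w) hcon⟩
  -- the left piece
  have hspl := sum_split (fun l => (C.leaf l).elim 0 y) hip
  rw [c9, ← hS2] at hspl
  have hsumleft : ∑ l ∈ Finset.range i, (C.leaf l).elim 0 y' =
      ∑ l ∈ Finset.range i, (C.leaf l).elim 0 y := by
    refine Finset.sum_congr rfl fun l hl => ?_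
    rw [Finset.mem_range] at hl
    cases h : C.leaf l with
    | none => rfl
    | some w => exact yl l w hl h
  have hAex : ∃ A, CInv G L x' y' A lo i ∧
      (∀ v ∈ verts A, (∃ a, 1 ≤ a ∧ a ≤ i ∧ C.vtx a = v) ∨
        (∃ b, b ≤ i ∧ C.leaf b = some v)) ∧
      (∀ a, 1 ≤ a → a ≤ i → C.vtx a ∈ verts A) ∧
      (∀ b w, b ≤ i → C.leaf b = some w → w ∉ verts A → y' w = 0) := by
    by_cases hmc : m = c
    · let A : Caterpillar V := ⟨i, C.vtx, fun l => if l < i then C.leaf l else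
        if l = i then (C.leaf i).filter (fun w => decide (0 < y' w)) else none⟩
      have Aleaf : ∀ l w, A.leaf l = some w → l ≤ i ∧ C.leaf l = some w ∧ 0 < y' w := by
        intro l w hw
        simp only [A] at hw
        split_ifs at hw with h h'
        · refine ⟨h.le, hw, ?_⟩
          rw [yl l w h hw]; exact (ypos l w (by omega) hw).1
        · subst h'
          rw [Option.filter_eq_some_iff, decide_eq_true_iff] at hw
          exact ⟨le_rfl, hw⟩
      have Aleaf' : ∀ l w, l ≤ i → C.leaf l = some w → 0 < y' w → A.leaf l = some w := by
        intro l w h1 h2 h3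
        simp only [A]
        split_ifs with h h'
        · exact h2
        · subst h'
          rw [Option.filter_eq_some_iff, decide_eq_true_iff]
          exact ⟨h2, h3⟩
        · omega
      have yle : ∀ l w, l ≤ i → C.leaf l = some w → y' w < 1 := by
        intro l w h1 h2
        have := (ypos l w (by omega) h2).2
        rcases h1.lt_or_eq with h | h
        · rw [yl l w h h2]; exact this
        · subst h; rw [yli w h2]; linarith
      have Ap : A.p = i := rfl
      have Av : ∀ l, A.vtx l = C.vtx l := fun l => rfl
      have Ag : ∀ l, GIdx L A l → GIdx L C l ∧ l < i := by
        rintro l ⟨h1, h2, j₀, j₁, h3, h4, h5, ⟨u₀, hu₀, hL₀⟩, ⟨u₁, hu₁, hL₁⟩⟩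
        have e0 := Aleaf _ _ hu₀
        have e1 := Aleaf _ _ hu₁
        exact ⟨⟨h1, by omega, j₀, j₁, h3, h4, by omega, ⟨u₀, e0.2.1, hL₀⟩, ⟨u₁, e1.2.1, hL₁⟩⟩,
          by omega⟩
      refine ⟨A, ⟨⟨?_, ?_, ?_, ?_, ?_, ?_, ?_, ?_, ?_⟩, ?_, ?_, ?_, ?_, ?_, ?_, ?_⟩, ?_, ?_, ?_⟩
      · intro a b h1 h2 h3
        exact c1 a b h1 h2 (by omega)
      · intro a h1 h2
        by_cases h : a = i
        · rw [Av, h, yi, hmc]; ring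
        · exact yv a h1 (by omega) h
      · intro a h1 h2
        exact c3 a h1 (by omega)
      · intro a h1 w hw
        have e := Aleaf _ _ hw
        rintro ⟨b, h2, h3, h4⟩
        exact c4 a (by omega) w e.2.1 ⟨b, h2, by omega, h4⟩
      · intro a h1 h2 w hw
        have e := Aleaf _ _ hw
        have := c5 a h1 (by omega) w e.2.1
        exact ⟨this.1, e.2.2, yle a w e.1 e.2.1, this.2.2.2⟩
      · intro w hw
        have e := Aleaf _ _ hw
        exact ⟨(c6 w e.2.1).1, e.2.2, yle 0 w e.1 e.2.1⟩
      · intro w hw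
        have e := Aleaf _ _ hw
        have := e.1
        omega
      · intro a b h1 h2 w w' hw hw'
        exact c8 a b h1 (by omega) w w' (Aleaf _ _ hw).2.1 (Aleaf _ _ hw').2.1
      · refine ⟨N - ⌈S2⌉, ?_⟩
        rw [Ap, Finset.sum_range_succ, Finset.sum_range_succ]
        have e1 : ∑ l ∈ Finset.range i, (A.leaf l).elim 0 y' =
            ∑ l ∈ Finset.range i, (C.leaf l).elim 0 y := by
          rw [← hsumleft]
          refine Finset.sum_congr rfl fun l hl => ?_
          rw [Finset.mem_range] at hl
          simp only [A, if_pos hl]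
        have e2 : (A.leaf i).elim 0 y' = (C.leaf i).elim 0 y - m := by
          simp only [A, lt_irrefl, if_false, if_true]
          cases h : C.leaf i with
          | none => simp [mn h]
          | some w =>
            have := yli w h
            by_cases h' : 0 < y' w
            · rw [Option.filter_some, if_pos (by simpa using h'), Option.elim_some, Option.elim_some, this]
            · have h0 : y' w = 0 := le_antisymm (not_lt.1 h') (hf'.y0 w)
              simp only [Option.filter, h', decide_false, Option.elim]
              simp only [Bool.false_eq_true, if_false]
              linarith
        have e3 : (A.leaf (i + 1)).elim 0 y' = 0 := by
          simp only [A]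
          rw [if_neg (by omega), if_neg (by omega)]; rfl
        rw [e1, e2, e3, hmc, hc]
        push_cast
        linarith
      · rw [Ap]; omega
      · intro l hl
        obtain ⟨h1, h2⟩ := Ag l hl
        exact ⟨(hI.win l h1).1, h2⟩
      · intro l hl j w hj hj' hw
        obtain ⟨h1, h2⟩ := Ag l hl
        have e := Aleaf _ _ hw
        exact hI.out l h1 j w (Or.inl (by omega)) (by omega) e.2.1
      · intro l h1 h2 h3 h4 z hz
        rcases sv l z (by omega) (by omega) hz with h | ⟨h5, h6, h7⟩ | ⟨h5, -⟩
        · exact hI.freshv l (by omega) (by omega) (by omega) (by omega) z h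
        · omega
        · omega
      · intro l w h3 h4 hw z hz
        have e := Aleaf _ _ hw
        rcases sl l w z (by omega) e.2.1 hz with h | ⟨h5, h6, h7⟩
        · exact hI.freshl l w (by omega) (by omega) e.2.1 z h
        · omega
      · intro l h1 h2
        exact radv' l (by omega) (by omega)
      · intro l w h1 hw
        have e := Aleaf _ _ hw
        exact radl' l w (by omega) e.2.1
      · rintro v (⟨a, h1, h2, h3⟩ | ⟨b, h1, h2⟩)
        · exact Or.inl ⟨a, h1, h2, h3⟩
        · have e := Aleaf _ _ h2
          exact Or.inr ⟨b, e.1, e.2.1⟩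
      · intro a h1 h2
        exact Or.inl ⟨a, h1, h2, rfl⟩
      · intro b w h1 h3 h4
        by_contra hcon
        refine h4 (Or.inr ⟨b, by omega, ?_⟩)
        exact Aleaf' b w h1 h3 (lt_of_le_of_ne (hf'.y0 w) (Ne.symm hcon))
    · have hmlt : m < c := lt_of_le_of_ne mc hmc
      have hmy : m = (C.leaf i).elim 0 y := by
        cases h : C.leaf i with
        | none => exact mn h
        | some w =>
          have := my w h
          simp only [Option.elim]
          rcases min_choice c (y w) with h' | h'
          · rw [h'] at this; exact absurd this hmc
          · rw [this, h']
      let A : Caterpillar V := ⟨i - 1, fun l => C.vtx (max l 1), fun l => if l < i then C.leaf l else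
        if l = i then some (C.vtx i) else none⟩
      have Aleaf : ∀ l w, A.leaf l = some w →
          (l < i ∧ C.leaf l = some w) ∨ (l = i ∧ w = C.vtx i) := by
        intro l w hw
        simp only [A] at hw
        split_ifs at hw with h h'
        · exact Or.inl ⟨h, hw⟩
        · exact Or.inr ⟨h', (Option.some.inj hw).symm⟩
      have Aleafl : ∀ l, l < i → A.leaf l = C.leaf l := by
        intro l h; simp only [A, if_pos h]
      have Aleafi : A.leaf i = some (C.vtx i) := by
        simp only [A, lt_irrefl, if_false, if_true]
      have Ap : A.p = i - 1 := rfl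
      have Av : ∀ l, 1 ≤ l → A.vtx l = C.vtx l := by
        intro l h; simp only [A]; rw [max_eq_left h]
      have Ag : ∀ l, GIdx L A l → GIdx L C l ∧ l < i := by
        rintro l ⟨h1, h2, j₀, j₁, h3, h4, h5, ⟨u₀, hu₀, hL₀⟩, ⟨u₁, hu₁, hL₁⟩⟩
        rw [Ap] at h2 h5
        rw [Av l h1] at hL₀ hL₁
        rw [Aleafl j₀ (by omega)] at hu₀
        refine ⟨?_, by omega⟩
        rcases Aleaf _ _ hu₁ with ⟨e1, e2⟩ | ⟨e1, e2⟩
        · exact ⟨h1, by omega, j₀, j₁, h3, h4, by omega, ⟨u₀, hu₀, hL₀⟩, ⟨u₁, e2, hL₁⟩⟩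
        · subst e2
          exact ⟨h1, by omega, j₀, i₁, h3, by omega, by omega, ⟨u₀, hu₀, hL₀⟩,
            ⟨w₁, hw₁, by omega⟩⟩
      have yipos : 0 < y' (C.vtx i) ∧ y' (C.vtx i) < 1 := by
        rw [yi]; constructor <;> linarith
      have yll : ∀ l w, l < i → C.leaf l = some w → 0 < y' w ∧ y' w < 1 := by
        intro l w h1 h2
        rw [yl l w h1 h2]; exact ypos l w (by omega) h2
      refine ⟨A, ⟨⟨?_, ?_, ?_, ?_, ?_, ?_, ?_, ?_, ?_⟩, ?_, ?_, ?_, ?_, ?_, ?_, ?_⟩, ?_, ?_, ?_⟩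
      · intro a b h1 h2 h3
        rw [Ap] at h3
        rw [Av a h1, Av b (by omega)]
        exact c1 a b h1 h2 (by omega)
      · intro a h1 h2
        rw [Ap] at h2
        rw [Av a h1]
        exact yv a h1 (by omega) (by omega)
      · intro a h1 h2
        rw [Ap] at h2
        rw [Av a h1, Av (a + 1) (by omega)]
        exact c3 a h1 (by omega)
      · intro a h1 w hw
        rintro ⟨b, h2, h3, h4⟩
        rw [Ap] at h3
        rw [Av b h2] at h4
        rcases Aleaf _ _ hw with ⟨e1, e2⟩ | ⟨e1, e2⟩
        · exact c4 a (by omega) w e2 ⟨b, h2, by omega, h4⟩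
        · rw [e2] at h4
          exact c1 b i h2 (by omega) hip h4
      · intro a h1 h2 w hw
        rw [Ap] at h2
        rw [Aleafl a (by omega)] at hw
        rw [Av a h1]
        have := c5 a h1 (by omega) w hw
        exact ⟨this.1, (yll a w (by omega) hw).1, (yll a w (by omega) hw).2, this.2.2.2⟩
      · intro w hw
        rw [Aleafl 0 (by omega)] at hw
        rw [Av 1 le_rfl]
        exact ⟨(c6 w hw).1, yll 0 w (by omega) hw⟩
      · intro w hw
        rw [Ap, show i - 1 + 1 = i by omega, Aleafi] at hw
        have := Option.some.inj hw
        subst this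
        refine ⟨?_, yipos⟩
        rw [Ap]
        simp only [A]
        by_cases h : i = 1
        · rw [h]; simp
        · rw [max_eq_left (by omega), SimpleGraph.dist_comm]
          have := c3 (i - 1) (by omega) (by omega)
          rwa [show i - 1 + 1 = i by omega] at this
      · intro a b h1 h2 w w' hw hw'
        rw [Ap] at h2
        rw [Aleafl a (by omega)] at hw
        rcases Aleaf _ _ hw' with ⟨e1, e2⟩ | ⟨e1, e2⟩
        · exact c8 a b h1 (by omega) w w' hw e2
        · intro h
          exact c4 a (by omega) w hw ⟨i, hi1, hip, by rw [h, e2]⟩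
      · refine ⟨N - ⌈S2⌉ + 1, ?_⟩
        rw [Ap, show i - 1 + 2 = i + 1 by omega, Finset.sum_range_succ]
        have e1 : ∑ l ∈ Finset.range i, (A.leaf l).elim 0 y' =
            ∑ l ∈ Finset.range i, (C.leaf l).elim 0 y := by
          rw [← hsumleft]
          refine Finset.sum_congr rfl fun l hl => ?_
          rw [Finset.mem_range] at hl
          rw [Aleafl l hl]
        rw [e1, Aleafi]
        rw [Option.elim_some]
        rw [yi, hmy, hc]
        push_cast
        linarith
      · rw [Ap]; omega
      · intro l hl
        obtain ⟨h1, h2⟩ := Ag l hl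
        exact ⟨(hI.win l h1).1, h2⟩
      · intro l hl j w hj hj' hw
        obtain ⟨h1, h2⟩ := Ag l hl
        rw [Ap] at hj'
        rw [Aleafl j (by omega)] at hw
        rw [Av l hl.1]
        exact hI.out l h1 j w (Or.inl (by omega)) (by omega) hw
      · intro l h1 h2 h3 h4 z hz
        rw [Av l h1] at hz ⊢
        rcases sv l z (by omega) (by omega) hz with h | ⟨h5, h6, h7⟩ | ⟨h5, -⟩
        · exact hI.freshv l (by omega) (by omega) (by omega) (by omega) z h
        · omega
        · omega
      · intro l w h3 h4 hw z hz
        rw [Aleafl l h4] at hw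
        rcases sl l w z (by omega) hw hz with h | ⟨h5, h6, h7⟩
        · exact hI.freshl l w (by omega) (by omega) hw z h
        · omega
      · intro l h1 h2
        rw [Ap] at h2
        rw [Av l h1]
        exact radv' l (by omega) (by omega)
      · intro l w h1 hw
        rcases Aleaf _ _ hw with ⟨e1, e2⟩ | ⟨e1, e2⟩
        · exact radl' l w (by omega) e2
        · intro z hz
          rw [e2] at hz ⊢
          have := radv' i hi1 hip z hz
          omega
      · rintro v (⟨a, h1, h2, h3⟩ | ⟨b, h1, h2⟩)
        · rw [Ap] at h2
          rw [Av a h1] at h3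
          exact Or.inl ⟨a, h1, by omega, h3⟩
        · rcases Aleaf _ _ h2 with ⟨e1, e2⟩ | ⟨e1, e2⟩
          · exact Or.inr ⟨b, e1.le, e2⟩
          · exact Or.inl ⟨i, hi1, le_rfl, e2.symm⟩
      · intro a h1 h2
        by_cases h : a = i
        · rw [h]; exact Or.inr ⟨i, by rw [Ap]; omega, Aleafi⟩
        · exact Or.inl ⟨a, h1, by rw [Ap]; omega, Av a h1⟩
      · intro b w h1 h3 h4
        rcases h1.lt_or_eq with h | h
        · exact absurd (Or.inr ⟨b, by rw [Ap]; omega, by rw [Aleafl b h]; exact h3⟩) h4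
        · subst h
          rw [yli w h3, hmy, h3]
          simp
  obtain ⟨A, hA, A1, A2, A3⟩ := hAex
  obtain ⟨B, hB, B1, B2, B3⟩ := hBex
  refine good_combine IH hf' off hA hB (by omega) (by omega) ?_ ?_ ?_ ?_ ?_
  · intro v hv
    rcases A1 v hv with ⟨a, h1, h2, rfl⟩ | ⟨b, h1, h2⟩
    · exact vtx_mem h1 (by omega)
    · exact leaf_mem (by omega) h2
  · intro v hv
    rcases B1 v hv with ⟨a, h1, h2, rfl⟩ | ⟨b, h1, h2, h3⟩
    · exact vtx_mem (by omega) (by omega)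
    · exact leaf_mem (by omega) h3
  · rw [Set.disjoint_left]
    intro v hv hv'
    rcases A1 v hv with ⟨a, h1, h2, rfl⟩ | ⟨b, h1, h2⟩
    · rcases B1 _ hv' with ⟨a', h3, h4, h5⟩ | ⟨b, h3, h4, h5⟩
      · exact c1 a a' h1 (by omega) h4 h5.symm
      · exact c4 b h4 _ h5 ⟨a, h1, by omega, rfl⟩
    · rcases B1 _ hv' with ⟨a', h3, h4, h5⟩ | ⟨b', h3, h4, h5⟩
      · exact c4 b (by omega) _ h2 ⟨a', by omega, h4, h5⟩
      · exact c8 b b' (by omega) h4 v v h2 h5 rfl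
  · rintro v (⟨a, h1, h2, rfl⟩ | ⟨b, h1, h2⟩) hvA hvB
    · by_cases h : a ≤ i
      · exact absurd (A2 a h1 h) hvA
      · exact absurd (B2 a (by omega) h2) hvB
    · by_cases h : b ≤ i
      · exact ⟨0, by rw [A3 b v h h2 hvA]; simp⟩
      · exact ⟨1, by rw [B3 b v (by omega) h1 h2 hvB]; simp⟩
  · rintro v (⟨a, h1, h2, rfl⟩ | ⟨b, h1, h2⟩)
    · intro z hz
      have := radv' a h1 h2 z hz
      omega
    · exact radl' b v h1 h2

/-- The recursive decomposition. -/
theorem decompose {V : Type} [Fintype V] {G : SimpleGraph V} (hG : G.Connected)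
    {L : V → ℕ} {k : ℕ} (n : ℕ) : ∀ (x : V → V → ℝ) (y : V → ℝ) (C : Caterpillar V) (lo hi : ℕ),
      hi - lo = n → Feas L k x y → CInv G L x y C lo hi → Good G L k x y C := by
  induction n using Nat.strong_induction_on with
  | _ n ih =>
  intro x y C lo hi hn hf hI
  by_cases hs : Separable L y C
  · obtain ⟨i, h1, h2, h3, h4, h5⟩ := hs
    have hg := gamma_gidx hI.cat h1 h2 h3
    rcases h5 with h5 | h5
    · exact step_right hG (fun x y C lo' hi' h hf hI => ih _ (by omega) x y C lo' hi' rfl hf hI)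
        hf hI hg (fun l hl => h4 _ (gidx_gamma hl)) h5
    · have hg' := crev_crev_gidx hg
      have hw := hI.win i hg
      have hhi := hI.hhi
      have e : (crev C).vtx (C.p + 1 - i) = C.vtx i := by
        simp only [crev]; congr 1; omega
      have key : Good G L k x y (crev C) := by
        refine step_right hG (fun x y C lo' hi' h hf hI => ih _ (by omega) x y C lo' hi' rfl hf hI)
          hf (crev_inv hI) hg' (fun l hl => ?_) ?_
        · rw [e]
          exact h4 _ (gidx_gamma (crev_gidx hl))
        · rw [e]
          have hp : (crev C).p = C.p := rfl
          rw [hp, crev_sum C _ i (by omega), crev_sum C _ i (by omega)]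
          exact h5
      simpa only [Good, crev_verts] using key
  · refine ⟨x, y, [C], hf, fun v _ => ⟨rfl, rfl⟩, ?_, ?_, ?_, hI.rad⟩
    · intro D hD
      rw [List.mem_singleton] at hD
      subst hD
      exact ⟨hI.cat, hs, le_rfl⟩
    · simp
    · intro v hv h
      exact absurd hv (h C (by simp))

/-- Monarchs and their clusters. -/
theorem exists_monarchs {V : Type} [Fintype V] {G : SimpleGraph V} (hG : G.Connected) :
    ∃ (M : Finset V) (center : V → V), (∀ v, center v ∈ M) ∧
      (∀ v, G.dist v (center v) ≤ 2) ∧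
      (∀ m ∈ M, ∀ v, G.dist v m ≤ 1 → center v = m) := by
  classical
  obtain ⟨M, hM, hmax⟩ := Finset.exists_max_image
    (Finset.univ.filter fun M : Finset V => ∀ a ∈ M, ∀ b ∈ M, a ≠ b → 3 ≤ G.dist a b)
    Finset.card ⟨∅, by simp⟩
  rw [Finset.mem_filter] at hM
  have hM := hM.2
  have hcov : ∀ v, ∃ m ∈ M, G.dist v m ≤ 2 := by
    intro v
    by_contra hcon
    push Not at hcon
    have hv : v ∉ M := by
      intro hv
      have := hcon v hv
      simp at this
    have := hmax (insert v M) (by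
      rw [Finset.mem_filter]
      refine ⟨Finset.mem_univ _, ?_⟩
      intro a ha b hb hab
      rw [Finset.mem_insert] at ha hb
      rcases ha with rfl | ha <;> rcases hb with rfl | hb
      · exact absurd rfl hab
      · exact hcon b hb
      · rw [SimpleGraph.dist_comm]; exact hcon a ha
      · exact hM a ha b hb hab)
    rw [Finset.card_insert_of_notMem hv] at this
    omega
  have hch : ∀ v, ∃ m ∈ M, G.dist v m ≤ 2 ∧ ∀ m' ∈ M, G.dist v m' ≤ 1 → m = m' := by
    intro v
    by_cases h : ∃ m ∈ M, G.dist v m ≤ 1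
    · obtain ⟨m, hm, hd⟩ := h
      refine ⟨m, hm, by omega, fun m' hm' hd' => ?_⟩
      by_contra hne
      have h1 := hM m hm m' hm' hne
      have h2 := hG.dist_triangle (u := m) (v := v) (w := m')
      rw [SimpleGraph.dist_comm] at hd
      omega
    · obtain ⟨m, hm, hd⟩ := hcov v
      exact ⟨m, hm, hd, fun m' hm' hd' => absurd ⟨m', hm', hd'⟩ h⟩
  choose center h1 h2 h3 using hch
  exact ⟨M, center, h1, h2, fun m hm v hd => h3 v m hm hd⟩

/-- Distance allowance between consecutive monarchs with given colours. -/
def colBound : Bool → Bool → ℕ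
  | true, false => 1
  | true, true => 2
  | false, false => 2
  | false, true => 3

/-- A linear order of the monarchs with consecutive ones at distance at most 15. -/
theorem exists_order {V : Type} [Fintype V] {G : SimpleGraph V} (hG : G.Connected)
    (M : Finset V) (center : V → V) (hc1 : ∀ v, center v ∈ M)
    (hc2 : ∀ v, G.dist v (center v) ≤ 2)
    (hc3 : ∀ m ∈ M, ∀ v, G.dist v m ≤ 1 → center v = m) :
    ∃ l : List V, l.Nodup ∧ (∀ m, m ∈ l ↔ m ∈ M) ∧
      l.IsChain (fun a b => G.dist a b ≤ 15) := by
  classical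
  have hcm : ∀ m ∈ M, center m = m := fun m hm => hc3 m hm m (by simp)
  obtain ⟨v0⟩ := hG.nonempty
  have main : ∀ n, 1 ≤ n → n ≤ M.card → ∃ l : List (V × Bool), l.length = n ∧
      (l.map Prod.fst).Nodup ∧ (∀ a ∈ l, a.1 ∈ M) ∧
      l.IsChain (fun a b => G.dist a.1 b.1 ≤ 5 * colBound a.2 b.2) := by
    intro n
    induction n with
    | zero => intro h; omega
    | succ n ih =>
      intro _ hn
      rcases Nat.eq_zero_or_pos n with rfl | hpos
      · refine ⟨[(center v0, true)], by simp, by simp, ?_, by simp⟩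
        intro a ha
        rw [List.mem_singleton] at ha
        subst ha
        exact hc1 v0
      · obtain ⟨l, hlen, hnd, hlM, hch⟩ := ih hpos (by omega)
        have hsub : (l.map Prod.fst).toFinset ⊆ M := by
          intro a ha
          rw [List.mem_toFinset, List.mem_map] at ha
          obtain ⟨b, hb, rfl⟩ := ha
          exact hlM b hb
        have hcard : (l.map Prod.fst).toFinset.card = n := by
          rw [List.toFinset_card_of_nodup hnd, List.length_map, hlen]
        obtain ⟨z, hzM, hz⟩ : ∃ z ∈ M, z ∉ l.map Prod.fst := by
          by_contra hcon
          push Not at hcon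
          have : M ⊆ (l.map Prod.fst).toFinset := fun a ha => List.mem_toFinset.2 (hcon a ha)
          have := Finset.card_le_card this
          omega
        obtain ⟨c, hcl⟩ := List.exists_mem_of_length_pos (by omega : 0 < l.length)
        have hcl' : c.1 ∈ l.map Prod.fst := List.mem_map.2 ⟨c, hcl, rfl⟩
        obtain ⟨w⟩ := hG.preconnected c.1 z
        obtain ⟨d, -, hd1, hd2⟩ := w.exists_boundary_dart
          {v | center v ∈ l.map Prod.fst}
          (by rw [Set.mem_ofPred_eq, hcm _ (hlM c hcl)]; exact hcl')
          (by rw [Set.mem_ofPred_eq, hcm _ hzM]; exact hz)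
        rw [Set.mem_ofPred_eq] at hd1 hd2
        have hadj : G.dist d.fst d.snd ≤ 1 := (SimpleGraph.dist_eq_one_iff_adj.2 d.adj).le
        have hdist : G.dist (center d.fst) (center d.snd) ≤ 5 := by
          have h1 := hG.dist_triangle (u := center d.fst) (v := d.fst) (w := center d.snd)
          have h2 := hG.dist_triangle (u := d.fst) (v := d.snd) (w := center d.snd)
          have h3 := hc2 d.fst
          have h4 := hc2 d.snd
          rw [SimpleGraph.dist_comm] at h3
          omega
        have hqM : center d.snd ∈ M := hc1 _
        generalize center d.snd = q at hd2 hdist hqM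
        obtain ⟨⟨u, col⟩, hul, hu⟩ := List.mem_map.1 hd1
        simp only at hu
        rw [← hu] at hdist
        clear hu hd1 hadj
        obtain ⟨s, t, rfl⟩ := List.append_of_mem hul
        rw [List.isChain_split] at hch
        obtain ⟨ch1, ch2⟩ := hch
        have hqu : q ≠ u ∧ q ∉ s.map Prod.fst ∧ q ∉ t.map Prod.fst := by
          rw [List.map_append, List.map_cons, List.mem_append, List.mem_cons] at hd2
          tauto
        cases col with
        | true =>
          refine ⟨s ++ (u, true) :: (q, false) :: t, ?_, ?_, ?_, ?_⟩
          · simp only [List.length_append, List.length_cons] at hlen ⊢; omega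
          · have hp : ((s ++ (u, true) :: (q, false) :: t).map Prod.fst).Perm
                (q :: (s ++ (u, true) :: t).map Prod.fst) := by
              simp only [List.map_append, List.map_cons]
              have : (u :: q :: t.map Prod.fst).Perm (q :: u :: t.map Prod.fst) :=
                List.Perm.swap _ _ _
              exact (this.append_left _).trans List.perm_middle
            rw [hp.nodup_iff, List.nodup_cons]
            exact ⟨hd2, hnd⟩
          · intro a ha
            simp only [List.mem_append, List.mem_cons] at ha
            rcases ha with ha | ha | ha | ha
            · exact hlM a (by simp [ha])
            · exact hlM a (by simp [ha])
            · rw [ha]; exact hqM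
            · exact hlM a (by simp [ha])
          · rw [List.isChain_split]
            refine ⟨ch1, ?_⟩
            rw [List.isChain_cons_cons]
            refine ⟨by simpa [colBound] using hdist, ?_⟩
            cases t with
            | nil => simp
            | cons b t =>
              rw [List.isChain_cons_cons] at ch2 ⊢
              refine ⟨?_, ch2.2⟩
              have h1 := ch2.1
              have h2 := hG.dist_triangle (u := q) (v := u) (w := b.1)
              rw [SimpleGraph.dist_comm] at hdist
              obtain ⟨b, cb⟩ := b
              cases cb <;> simp only [colBound] at h1 h2 ⊢ <;> omega
        | false =>
          refine ⟨s ++ (q, true) :: (u, false) :: t, ?_, ?_, ?_, ?_⟩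
          · simp only [List.length_append, List.length_cons] at hlen ⊢; omega
          · have hp : ((s ++ (q, true) :: (u, false) :: t).map Prod.fst).Perm
                (q :: (s ++ (u, true) :: t).map Prod.fst) := by
              simp only [List.map_append, List.map_cons]
              exact List.perm_middle
            rw [hp.nodup_iff, List.nodup_cons]
            refine ⟨?_, ?_⟩
            · simpa using hd2
            · simpa using hnd
          · intro a ha
            simp only [List.mem_append, List.mem_cons] at ha
            rcases ha with ha | ha | ha | ha
            · exact hlM a (by simp [ha])
            · rw [ha]; exact hqM
            · exact hlM a (by simp [ha])
            · exact hlM a (by simp [ha])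
          · rw [List.isChain_split]
            rw [List.isChain_append] at ch1 ⊢
            refine ⟨⟨ch1.1, by simp, ?_⟩, ?_⟩
            · intro a ha b hb
              simp only [List.head?_cons, Option.mem_some_iff] at hb
              subst hb
              have h1 := ch1.2.2 a ha (u, false) (by simp)
              have h2 := hG.dist_triangle (u := a.1) (v := u) (w := q)
              obtain ⟨a, ca⟩ := a
              cases ca <;> simp only [colBound] at h1 h2 ⊢ <;> omega
            · rw [List.isChain_cons_cons]
              refine ⟨?_, ch2⟩
              rw [SimpleGraph.dist_comm] at hdist
              simpa [colBound] using hdist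
  have hMpos : 1 ≤ M.card := Finset.card_pos.2 ⟨center v0, hc1 v0⟩
  obtain ⟨l, hlen, hnd, hlM, hch⟩ := main M.card hMpos le_rfl
  refine ⟨l.map Prod.fst, hnd, ?_, ?_⟩
  · have hsub : (l.map Prod.fst).toFinset ⊆ M := by
      intro a ha
      rw [List.mem_toFinset, List.mem_map] at ha
      obtain ⟨b, hb, rfl⟩ := ha
      exact hlM b hb
    have heq := Finset.eq_of_subset_of_card_le hsub (by
      rw [List.toFinset_card_of_nodup hnd, List.length_map, hlen])
    intro m
    rw [← heq, List.mem_toFinset]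
  · rw [List.isChain_map]
    refine hch.imp ?_
    rintro ⟨a, ca⟩ ⟨b, cb⟩ h
    cases ca <;> cases cb <;> simp only [colBound] at h ⊢ <;> omega

/-- Shifting `t` from `a` to `b`. -/
theorem shift_one {V : Type} [Fintype V] [DecidableEq V] {L : V → ℕ} {k : ℕ} {x : V → V → ℝ}
    {y : V → ℝ} (hf : Feas L k x y) {a b : V} (hab : a ≠ b) (hL : L a ≤ L b) {t : ℝ}
    (ht : 0 ≤ t) (hta : t ≤ y a) (htb : y b + t ≤ 1) :
    ∃ x' : V → V → ℝ,
      Feas L k x' (fun v => y v + (if v = b then t else 0) - (if v = a then t else 0)) ∧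
      ∀ v c, 0 < x' v c → 0 < x v c ∨ (v = b ∧ 0 < x a c) := by
  have hin : ∀ v, ∑ u, (if u = a ∧ v = b then t else 0) = if v = b then t else 0 := by
    intro v
    by_cases h : v = b <;> simp [h]
  have hout : ∀ v, ∑ w, (if v = a ∧ w = b then t else 0) = if v = a then t else 0 := by
    intro v
    by_cases h : v = a <;> simp [h]
  obtain ⟨x', h1, h2, -⟩ := flow_step hf (fun u v => if u = a ∧ v = b then t else 0)
    (fun u v => by split_ifs <;> simp [ht]) (L a)
    (fun v => y v + (if v = b then t else 0) - (if v = a then t else 0))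
    (fun v => by rw [hin, hout])
    (fun v => by
      rw [hout]; split_ifs with h
      · rw [h]; exact hta
      · exact hf.y0 v)
    (fun v => by
      rw [hin, hout]
      by_cases hb : v = b
      · right
        have : v ≠ a := by rw [hb]; exact hab.symm
        simp only [hb, if_true, hab.symm, if_false]
        exact ⟨hL, ht, by simp⟩
      · rcases le_total (L v) (L a) with h | h
        · left; exact ⟨h, by simp [hb]⟩
        · by_cases ha : v = a
          · left; rw [ha]; simp
          · right; simp [ha, hb, h])
    (fun v => by
      have := hf.y1 v
      split_ifs with h1 h2 h2
      · linarith
      · rw [h1]; linarith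
      · linarith
      · linarith)
  refine ⟨x', h1, fun v c hc => ?_⟩
  rcases h2 v c hc with h | ⟨u, hu, hxu⟩
  · exact Or.inl h
  · split_ifs at hu with h
    · right; rw [← h.1]; exact ⟨h.2, hxu⟩
    · exact absurd hu (lt_irrefl _)

theorem sum_lt_two {V : Type} [Fintype V] [DecidableEq V] (f g : V → ℕ) {a b : V} (hab : a ≠ b)
    (h : ∀ v, v ≠ a → v ≠ b → f v = g v) (hlt : f a + f b < g a + g b) :
    ∑ v, f v < ∑ v, g v := by
  have hb : b ∈ Finset.univ.erase a := by simp [hab.symm]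
  have e : ∀ f : V → ℕ, ∑ v, f v = f a + (f b + ∑ v ∈ (Finset.univ.erase a).erase b, f v) := by
    intro f
    rw [Finset.add_sum_erase _ f hb, Finset.add_sum_erase _ f (Finset.mem_univ a)]
  have e3 : ∑ v ∈ (Finset.univ.erase a).erase b, f v =
      ∑ v ∈ (Finset.univ.erase a).erase b, g v := by
    refine Finset.sum_congr rfl fun v hv => ?_
    simp only [Finset.mem_erase] at hv
    exact h v hv.2.1 hv.1
  rw [e f, e g, e3]
  omega

/-- Concentrating the opening inside the clusters. -/
theorem base_state {V : Type} [Fintype V] [DecidableEq V] {G : SimpleGraph V}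
    {L : V → ℕ} {k : ℕ} {x : V → V → ℝ} {y : V → ℝ} (hf : Feas L k x y)
    (hx : ∀ u c, 0 < x u c → G.dist u c ≤ 1) (M : Finset V) (center : V → V)
    (hc3 : ∀ m ∈ M, ∀ v, G.dist v m ≤ 1 → center v = m) :
    ∃ (x' : V → V → ℝ) (y' : V → ℝ), Feas L k x' y' ∧
      (∀ u c, 0 < x' u c → ∃ u', center u' = center u ∧ G.dist u' c ≤ 1) ∧
      (∀ a b, center a = center b → 0 < y' a → y' a < 1 → 0 < y' b → y' b < 1 → a = b) ∧
      (∀ m ∈ M, ∃ t, center t = m ∧ y' t = 1 ∧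
        ∀ w, center w = m → 0 < y' w → y' w < 1 → L w ≤ L t) := by
  classical
  let phi : (V → ℝ) → V → ℕ := fun y u => if 0 < y u ∧ y u < 1 then L u + 1 else 0
  let Q : (V → V → ℝ) → (V → ℝ) → Prop := fun x y => Feas L k x y ∧
    (∀ u c, 0 < x u c → ∃ u', center u' = center u ∧ G.dist u' c ≤ 1) ∧
    (∀ m ∈ M, 1 ≤ ∑ u with center u = m, y u)
  have hQ : ∃ n, ∃ x y, Q x y ∧ ∑ u, phi y u = n := by
    refine ⟨_, x, y, ⟨hf, fun u c h => ⟨u, rfl, hx u c h⟩, ?_⟩, rfl⟩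
    intro m hm
    rw [← hf.col m, Finset.sum_filter]
    refine Finset.sum_le_sum fun u _ => ?_
    split_ifs with h
    · exact hf.xy u m
    · by_contra hcon
      exact h (hc3 m hm u (hx u m (not_le.1 hcon)))
  obtain ⟨x₁, y₁, ⟨hf₁, hx₁, hm₁⟩, hphi⟩ := Nat.find_spec hQ
  have hmin : ∀ x' y', Q x' y' → ∑ u, phi y₁ u ≤ ∑ u, phi y' u := by
    intro x' y' h
    rw [hphi]
    exact Nat.find_min' hQ ⟨x', y', h, rfl⟩
  -- shifting inside a cluster
  have hshift : ∀ a b, a ≠ b → center a = center b → L a ≤ L b → ∀ t, 0 ≤ t → t ≤ y₁ a →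
      y₁ b + t ≤ 1 →
      phi y₁ a + phi y₁ b ≤ (if 0 < y₁ a - t ∧ y₁ a - t < 1 then L a + 1 else 0) +
        (if 0 < y₁ b + t ∧ y₁ b + t < 1 then L b + 1 else 0) := by
    intro a b hab hcab hL t ht hta htb
    obtain ⟨x₂, hf₂, hx₂⟩ := shift_one hf₁ hab hL ht hta htb
    set y₂ : V → ℝ := fun v => y₁ v + (if v = b then t else 0) - (if v = a then t else 0) with hy₂
    have hQ2 : Q x₂ y₂ := by
      refine ⟨hf₂, ?_, ?_⟩
      · intro u c h
        rcases hx₂ u c h with h | ⟨rfl, h⟩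
        · exact hx₁ u c h
        · obtain ⟨u', h1, h2⟩ := hx₁ a c h
          exact ⟨u', h1.trans hcab, h2⟩
      · intro m hm
        have : ∑ u with center u = m, y₂ u = ∑ u with center u = m, y₁ u := by
          simp only [hy₂, Finset.sum_sub_distrib, Finset.sum_add_distrib, Finset.sum_ite_eq',
            Finset.mem_filter, Finset.mem_univ, true_and, hcab]
          ring
        rw [this]
        exact hm₁ m hm
    have h := hmin x₂ y₂ hQ2
    have ea : y₂ a = y₁ a - t := by simp [hy₂, hab]
    have eb : y₂ b = y₁ b + t := by simp [hy₂, hab.symm]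
    by_contra hcon
    rw [not_le] at hcon
    refine absurd h (not_le.2 (sum_lt_two _ _ hab ?_ ?_))
    · intro v hva hvb
      have : y₂ v = y₁ v := by simp [hy₂, hva, hvb]
      simp only [phi, this]
    · simp only [phi, ea, eb] at hcon ⊢
      exact hcon
  have huniq0 : ∀ a b, center a = center b → L a ≤ L b → 0 < y₁ a → y₁ a < 1 → 0 < y₁ b →
      y₁ b < 1 → a = b := by
    intro a b hc hL a0 a1 b0 b1
    by_contra hab
    have h := hshift a b hab hc hL (min (y₁ a) (1 - y₁ b)) (le_min a0.le (by linarith))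
      (min_le_left _ _) (by have := min_le_right (y₁ a) (1 - y₁ b); linarith)
    simp only [phi, a0, a1, b0, b1, and_self, if_true] at h
    rcases le_total (y₁ a) (1 - y₁ b) with h' | h'
    · rw [min_eq_left h', sub_self] at h
      simp only [lt_irrefl, false_and, if_false] at h
      split_ifs at h <;> omega
    · rw [min_eq_right h', show y₁ b + (1 - y₁ b) = 1 by ring] at h
      simp only [lt_irrefl, and_false, if_false] at h
      split_ifs at h <;> omega
  have huniq : ∀ a b, center a = center b → 0 < y₁ a → y₁ a < 1 → 0 < y₁ b →
      y₁ b < 1 → a = b := by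
    intro a b hc a0 a1 b0 b1
    rcases le_total (L a) (L b) with h | h
    · exact huniq0 a b hc h a0 a1 b0 b1
    · exact (huniq0 b a hc.symm h b0 b1 a0 a1).symm
  refine ⟨x₁, y₁, hf₁, hx₁, huniq, ?_⟩
  intro m hm
  obtain ⟨t, ht, hyt⟩ : ∃ t, center t = m ∧ y₁ t = 1 := by
    by_contra hcon
    push Not at hcon
    have hlt : ∀ u, center u = m → y₁ u < 1 := fun u hu => lt_of_le_of_ne (hf₁.y1 u) (hcon u hu)
    have h1 := hm₁ m hm
    by_cases hw : ∃ w, center w = m ∧ 0 < y₁ w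
    · obtain ⟨w, hw, hw0⟩ := hw
      rw [Finset.sum_eq_single w] at h1
      · have := hlt w hw; linarith
      · intro b hb hbw
        rw [Finset.mem_filter] at hb
        by_contra hb0
        have hb0 := lt_of_le_of_ne (hf₁.y0 b) (Ne.symm hb0)
        exact hbw (huniq b w (hb.2.trans hw.symm) hb0 (hlt b hb.2) hw0 (hlt w hw))
      · intro h; exact absurd (by simpa using hw) h
    · push Not at hw
      have : ∑ u with center u = m, y₁ u ≤ 0 :=
        Finset.sum_nonpos fun u hu => hw u (Finset.mem_filter.1 hu).2
      linarith
  refine ⟨t, ht, hyt, fun w hw w0 w1 => ?_⟩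
  by_contra hcon
  rw [not_le] at hcon
  have htw : t ≠ w := by rintro rfl; linarith
  have h := hshift t w htw (ht.trans hw.symm) hcon.le (1 - y₁ w) (by linarith)
    (by rw [hyt]; linarith) (by linarith)
  rw [show y₁ w + (1 - y₁ w) = 1 by ring, hyt] at h
  simp only [phi, w0, w1, hyt, lt_irrefl, and_false, and_self, if_true, if_false] at h
  split_ifs at h <;> omega

/-- The base caterpillar. -/
theorem base_caterpillar {V : Type} [Fintype V] [DecidableEq V] {G : SimpleGraph V}
    (hG : G.Connected) {L : V → ℕ} {k : ℕ} {x : V → V → ℝ} {y : V → ℝ} (hf : Feas L k x y)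
    (hx : ∀ u c, 0 < x u c → G.dist u c ≤ 1) :
    ∃ (x' : V → V → ℝ) (y' : V → ℝ) (C : Caterpillar V), Feas L k x' y' ∧
      CInv G L x' y' C 0 (C.p + 1) ∧ (∀ v, Rad G x' 5 v) ∧
      (∀ v, v ∉ verts C → ∃ n : ℤ, y' v = (n : ℝ)) := by
  classical
  obtain ⟨M, center, hc1, hc2, hc3⟩ := exists_monarchs hG
  obtain ⟨l, lnd, lM, lch⟩ := exists_order hG M center hc1 hc2 hc3
  obtain ⟨x', y', hf', hx', huniq, htop⟩ := base_state hf hx M center hc3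
  have hclus : ∀ a b, center a = center b → G.dist a b ≤ 4 := by
    intro a b h
    have h1 := hG.dist_triangle (u := a) (v := center a) (w := b)
    have h2 := hc2 a
    have h3 := hc2 b
    rw [← h, SimpleGraph.dist_comm] at h3
    omega
  have hrad : ∀ v, Rad G x' 5 v := by
    intro v c hc
    obtain ⟨u', h1, h2⟩ := hx' v c hc
    have h3 := hclus v u' h1.symm
    have h4 := hG.dist_triangle (u := v) (v := u') (w := c)
    omega
  have hnf : ∀ v, ¬ (0 < y' v ∧ y' v < 1) → y' v = ((⌊y' v⌋ : ℤ) : ℝ) := by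
    intro v hv
    have h0 := hf'.y0 v
    have h1 := hf'.y1 v
    rcases h0.eq_or_lt with h | h
    · rw [← h]; simp
    · have : y' v = 1 := le_antisymm h1 (not_lt.1 fun h' => hv ⟨h, h'⟩)
      rw [this]; simp
  obtain ⟨v0⟩ := hG.nonempty
  have htop' : ∀ m, ∃ t, m ∈ M → center t = m ∧ y' t = 1 ∧
      ∀ w, center w = m → 0 < y' w → y' w < 1 → L w ≤ L t := by
    intro m
    by_cases h : m ∈ M
    · obtain ⟨t, ht⟩ := htop m h
      exact ⟨t, fun _ => ht⟩
    · exact ⟨v0, fun h' => absurd h' h⟩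
  choose top htop using htop'
  have hlf : ∀ m, ∃ o : Option V, ∀ w, o = some w ↔ center w = m ∧ 0 < y' w ∧ y' w < 1 := by
    intro m
    by_cases h : ∃ w, center w = m ∧ 0 < y' w ∧ y' w < 1
    · obtain ⟨w, h1, h2, h3⟩ := h
      refine ⟨some w, fun w' => ⟨?_, ?_⟩⟩
      · intro h; rw [Option.some.injEq] at h; subst h; exact ⟨h1, h2, h3⟩
      · rintro ⟨h1', h2', h3'⟩
        rw [huniq w w' (h1.trans h1'.symm) h2 h3 h2' h3']
    · refine ⟨none, fun w' => ⟨fun h => by simp at h, fun h' => absurd ⟨w', h'⟩ h⟩⟩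
  choose lf hlf using hlf
  let ms : ℕ → V := fun i => l.getD (i - 1) v0
  have msget : ∀ i (h1 : 1 ≤ i) (h2 : i ≤ l.length), ms i = l[i - 1]'(by omega) := by
    intro i h1 h2
    exact List.getD_eq_getElem l v0 (by omega)
  have msM : ∀ i, 1 ≤ i → i ≤ l.length → ms i ∈ M := by
    intro i h1 h2
    rw [msget i h1 h2, ← lM]
    exact List.getElem_mem _
  have msinj : ∀ i j, 1 ≤ i → i ≤ l.length → 1 ≤ j → j ≤ l.length → ms i = ms j → i = j := by
    intro i j h1 h2 h3 h4 h
    rw [msget i h1 h2, msget j h3 h4, lnd.getElem_inj_iff] at h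
    omega
  have mssurj : ∀ m ∈ M, ∃ i, 1 ≤ i ∧ i ≤ l.length ∧ ms i = m := by
    intro m hm
    obtain ⟨i, hi, h⟩ := List.getElem_of_mem ((lM m).2 hm)
    refine ⟨i + 1, by omega, by omega, ?_⟩
    rw [msget _ (by omega) (by omega)]
    simpa using h
  have msdist : ∀ i, 1 ≤ i → i + 1 ≤ l.length → G.dist (ms i) (ms (i + 1)) ≤ 15 := by
    intro i h1 h2
    rw [msget i h1 (by omega), msget (i + 1) (by omega) h2]
    have := List.isChain_iff_getElem.1 lch (i - 1) (by omega)
    simpa only [Nat.sub_add_cancel h1, Nat.add_sub_cancel] using this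
  clear_value ms
  let C : Caterpillar V := ⟨l.length, fun i => top (ms i),
    fun i => if 1 ≤ i ∧ i ≤ l.length then lf (ms i) else none⟩
  have Cp : C.p = l.length := rfl
  have Cv : ∀ i, C.vtx i = top (ms i) := fun i => rfl
  have Cl : ∀ i w, C.leaf i = some w → 1 ≤ i ∧ i ≤ l.length ∧ center w = ms i ∧ 0 < y' w ∧
      y' w < 1 := by
    intro i w h
    simp only [C] at h
    split_ifs at h with h'
    exact ⟨h'.1, h'.2, (hlf _ _).1 h⟩
  have hsum : ∃ n : ℤ, ∑ i ∈ Finset.range (C.p + 2), (C.leaf i).elim 0 y' = (n : ℝ) := by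
    refine ⟨(k : ℤ) - ∑ v, (if 0 < y' v ∧ y' v < 1 then 0 else ⌊y' v⌋), ?_⟩
    have e1 : ∑ i ∈ Finset.range (C.p + 2), (C.leaf i).elim 0 y' =
        ∑ m ∈ M, (lf m).elim 0 y' := by
      have : ∑ i ∈ Finset.range (C.p + 2), (C.leaf i).elim 0 y' =
          ∑ i ∈ Finset.Icc 1 l.length, (lf (ms i)).elim 0 y' := by
        symm
        have hss : Finset.Icc 1 l.length ⊆ Finset.range (C.p + 2) := by
          intro i hi
          rw [Finset.mem_Icc] at hi
          rw [Finset.mem_range, Cp]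
          omega
        rw [← Finset.sum_subset hss]
        · refine Finset.sum_congr rfl fun i hi => ?_
          rw [Finset.mem_Icc] at hi
          simp only [C, hi, and_self, if_true]
        · intro i _ hi
          rw [Finset.mem_Icc] at hi
          simp only [C, hi, if_false, Option.elim_none]
      rw [this]
      refine Finset.sum_bij (fun i _ => ms i) ?_ ?_ ?_ ?_
      · intro i hi
        rw [Finset.mem_Icc] at hi
        exact msM i hi.1 hi.2
      · intro i hi j hj h
        rw [Finset.mem_Icc] at hi hj
        exact msinj i j hi.1 hi.2 hj.1 hj.2 h
      · intro m hm
        obtain ⟨i, h1, h2, h3⟩ := mssurj m hm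
        exact ⟨i, Finset.mem_Icc.2 ⟨h1, h2⟩, h3⟩
      · intro i _; rfl
    have e2 : ∑ m ∈ M, (lf m).elim 0 y' =
        ∑ v, (if 0 < y' v ∧ y' v < 1 then y' v else 0) := by
      rw [← Finset.sum_fiberwise_of_maps_to (s := Finset.univ) (t := M) (g := center)
        (fun v _ => hc1 v)]
      refine Finset.sum_congr rfl fun m _ => ?_
      cases h : lf m with
      | none =>
        rw [Option.elim_none]
        symm
        refine Finset.sum_eq_zero fun v hv => ?_
        rw [Finset.mem_filter] at hv
        rw [if_neg]
        intro hfr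
        have := (hlf m v).2 ⟨hv.2, hfr⟩
        rw [h] at this
        simp at this
      | some w =>
        rw [Option.elim_some]
        have hw := (hlf m w).1 h
        rw [Finset.sum_eq_single w]
        · rw [if_pos hw.2]
        · intro b hb hbw
          rw [Finset.mem_filter] at hb
          rw [if_neg]
          intro hfr
          exact hbw (huniq b w (hb.2.trans hw.1.symm) hfr.1 hfr.2 hw.2.1 hw.2.2)
        · intro h'
          exact absurd (by simpa using hw.1) h'
    have e3 : (k : ℝ) = ∑ v, (if 0 < y' v ∧ y' v < 1 then y' v else 0) +
        ∑ v, (((if 0 < y' v ∧ y' v < 1 then 0 else ⌊y' v⌋) : ℤ) : ℝ) := by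
      rw [← hf'.ysum, ← Finset.sum_add_distrib]
      refine Finset.sum_congr rfl fun v _ => ?_
      split_ifs with h
      · simp
      · rw [zero_add]; exact hnf v h
    rw [e1, e2]
    push_cast [-Int.cast_ite]
    linarith
  have hcat : IsCaterpillar G L y' 21 C := by
    refine ⟨?_, ?_, ?_, ?_, ?_, ?_, ?_, ?_, hsum⟩
    · intro i j h1 h2 h3 h
      rw [Cp] at h3
      rw [Cv, Cv] at h
      have h4 := (htop _ (msM i h1 (by omega))).1
      rw [h, (htop _ (msM j (by omega) h3)).1] at h4
      have := msinj j i (by omega) h3 h1 (by omega) h4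
      omega
    · intro i h1 h2
      exact (htop _ (msM i h1 h2)).2.1
    · intro i h1 h2
      rw [Cp] at h2
      have d1 := hc2 (top (ms i))
      have d2 := hc2 (top (ms (i + 1)))
      rw [(htop _ (msM i h1 (by omega))).1] at d1
      rw [(htop _ (msM (i + 1) (by omega) h2)).1] at d2
      have d3 := msdist i h1 h2
      rw [Cv, Cv]
      have d4 := hG.dist_triangle (u := top (ms i)) (v := ms i) (w := top (ms (i + 1)))
      have d5 := hG.dist_triangle (u := ms i) (v := ms (i + 1)) (w := top (ms (i + 1)))
      rw [SimpleGraph.dist_comm] at d2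
      omega
    · rintro i _ w hw ⟨j, h1, h2, rfl⟩
      have h3 := Cl i _ hw
      have h4 := (htop _ (msM j h1 h2)).2.1
      rw [Cv, h4] at h3
      exact absurd h3.2.2.2.2 (lt_irrefl _)
    · intro i h1 h2 w hw
      obtain ⟨-, -, h3, h4, h5⟩ := Cl i w hw
      obtain ⟨t1, t2, t3⟩ := htop _ (msM i h1 h2)
      refine ⟨t3 w h3 h4 h5, h4, h5, ?_⟩
      have := hclus (top (ms i)) w (t1.trans h3.symm)
      rw [Cv]; omega
    · intro w hw
      have := (Cl 0 w hw).1
      omega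
    · intro w hw
      have := (Cl _ w hw).2.1
      rw [Cp] at this
      omega
    · intro i j hij hj w w' hw hw' h
      obtain ⟨a1, a2, a3, -⟩ := Cl i w hw
      obtain ⟨b1, b2, b3, -⟩ := Cl j w' hw'
      rw [h] at a3
      have := msinj i j a1 a2 b1 b2 (a3.symm.trans b3)
      omega
  refine ⟨x', y', C, hf', ⟨hcat, le_rfl, ?_, ?_, ?_, ?_, ?_, ?_⟩, hrad, ?_⟩
  · intro a ha
    obtain ⟨h1, h2, -⟩ := ha
    omega
  · intro a _ j w hj hj' _
    omega
  · intro a _ _ _ _; exact hrad _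
  · intro a w _ _ _; exact hrad _
  · intro a _ _ c hc
    have := hrad _ c hc
    omega
  · intro a w _ _ c hc
    have := hrad _ c hc
    omega
  · intro v hv
    refine ⟨_, hnf v fun hfr => hv ?_⟩
    obtain ⟨i, h1, h2, h3⟩ := mssurj (center v) (hc1 v)
    refine leaf_mem (i := i) (by rw [Cp]; omega) ?_
    simp only [C, h1, h2, and_self, if_true]
    rw [hlf]
    exact ⟨h3.symm, hfr⟩

/-- **Lemma 8.** For every finite connected graph `G`, capacity function
`L`, positive integer `k` and feasible LP1 solution `(x, y)`, there are a `68`-feasible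
assignment `(x', y')` and a family of pairwise vertex-disjoint non-separable
`21`-caterpillar structures for `(x', y')` such that every vertex outside all of them has
an integral `y'`-value and every vertex belonging to one of them has
`radius_{(x',y')} ≤ 47`. -/
theorem nonseparable_caterpillar_decomposition {V : Type} [Fintype V] [DecidableEq V]
    (G : SimpleGraph V) (hG : G.Connected) (L : V → ℕ) (k : ℕ) (hk : 0 < k)
    (x : V → V → ℝ) (y : V → ℝ) (hfeas : LPFeasible G L k 1 x y) :
    ∃ (x' : V → V → ℝ) (y' : V → ℝ) (m : ℕ) (Cs : Fin m → Caterpillar V),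
      LPFeasible G L k 68 x' y' ∧
      (∀ i, IsCaterpillar G L y' 21 (Cs i) ∧ ¬ Separable L y' (Cs i)) ∧
      (∀ i j, i ≠ j →
        Disjoint ((Cs i).spine ∪ (Cs i).leaves) ((Cs j).spine ∪ (Cs j).leaves)) ∧
      (∀ v : V, (∀ i, v ∉ (Cs i).spine ∪ (Cs i).leaves) → ∃ n : ℤ, y' v = (n : ℝ)) ∧
      (∀ v : V, (∃ i, v ∈ (Cs i).spine ∪ (Cs i).leaves) → lpRadius G x' v ≤ 47) := by
  classical
  obtain ⟨f1, f2, f3, f4, f5, f6, f7, f8⟩ := hfeas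
  have hf : Feas L k x y := ⟨f1, f2, f3, f4, f5, f6, f7⟩
  have hx : ∀ u c, 0 < x u c → G.dist u c ≤ 1 := by
    intro u c h
    by_contra hcon
    have := f8 u c fun h' => hcon h'.2
    linarith
  obtain ⟨x₁, y₁, C, hf₁, hI, hrad, hintg⟩ := base_caterpillar hG hf hx
  obtain ⟨x', y', Ds, hf', hoff, hcat, hpw, hin, hrad'⟩ :=
    decompose hG _ x₁ y₁ C 0 (C.p + 1) rfl hf₁ hI
  refine ⟨x', y', Ds.length, Ds.get, ?_, ?_, ?_, ?_, ?_⟩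
  · refine ⟨hf'.x0, hf'.y0, hf'.ysum, hf'.xy, hf'.cap, hf'.col, hf'.y1, ?_⟩
    intro u v h
    by_contra hne
    have hpos : 0 < x' u v := lt_of_le_of_ne (hf'.x0 u v) (Ne.symm hne)
    refine h ⟨hG.preconnected u v, ?_⟩
    by_cases hu : u ∈ verts C
    · have := hrad' u hu v hpos
      omega
    · rw [(hoff u hu).1] at hpos
      have := hrad u v hpos
      omega
  · intro i
    have := hcat _ (List.get_mem Ds i)
    exact ⟨this.1, this.2.1⟩
  · intro i j hij
    rcases lt_or_gt_of_ne hij with h | h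
    · exact List.pairwise_iff_get.1 hpw i j h
    · exact (List.pairwise_iff_get.1 hpw j i h).symm
  · intro v hv
    by_cases hvC : v ∈ verts C
    · refine hin v hvC fun D hD hvD => ?_
      obtain ⟨i, rfl⟩ := List.get_of_mem hD
      exact hv i hvD
    · rw [(hoff v hvC).2]
      exact hintg v hvC
  · rintro v ⟨i, hi⟩
    have hvC : v ∈ verts C := (hcat _ (List.get_mem Ds i)).2.2 hi
    have hr := hrad' v hvC
    unfold lpRadius
    rcases Set.eq_empty_or_nonempty {i : ℕ | ∃ c, G.dist v c = i ∧ 0 < x' v c} with h | h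
    · rw [h]; simp
    · refine csSup_le h ?_
      rintro n ⟨c, rfl, hc⟩
      exact hr c hc
end

section
/- There exist positive integer constants c and δ such that the following holds: for every finite simple connected undirected graph G = (V, E), capacity function L : V → ℕ and positive integer k, if LP1 has a feasible solution (x, y), then there exist a c-feasible assignment (x', y') and a set S of pairwise vertex-disjoint safe δ-caterpillar structures for (x', y') such that every vertex v not belonging to any caterpillar structure of S has an integral y'-value. -/
open Classical in
/-- A flow on the finite set `A` with demands `d`, capacities `k`, moving along `R`. -/
def SCFlow {V : Type} (R : V → V → Prop) (A : Finset V) (d k : V → ℝ) : Prop :=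
  ∃ t : V → V → ℝ, (∀ w u, 0 ≤ t w u) ∧ (∀ w ∈ A, ∑ u ∈ A, t w u = d w) ∧
    (∀ u ∈ A, ∑ w ∈ A, t w u ≤ k u) ∧ (∀ w ∈ A, ∀ u ∈ A, t w u ≠ 0 → R w u)

theorem sc_prop {V : Type} (K : Finset V) (D C : V → ℝ) (hD : ∀ w ∈ K, 0 ≤ D w)
    (hC : ∀ w ∈ K, 0 ≤ C w) (h : ∑ w ∈ K, D w ≤ ∑ w ∈ K, C w) :
    ∃ p : V → V → ℝ, (∀ w ∈ K, ∀ u ∈ K, 0 ≤ p w u) ∧ (∀ w ∈ K, ∑ u ∈ K, p w u = D w) ∧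
      (∀ u ∈ K, ∑ w ∈ K, p w u ≤ C u) := by
  have hS : 0 ≤ ∑ w ∈ K, C w := Finset.sum_nonneg hC
  have hSD : 0 ≤ ∑ w ∈ K, D w := Finset.sum_nonneg hD
  refine ⟨fun w u => D w * C u / ∑ w ∈ K, C w, ?_, ?_, ?_⟩
  · intro w hw u hu
    have := hD w hw
    have := hC u hu
    positivity
  · intro w hw
    rw [← Finset.sum_div, ← Finset.mul_sum]
    rcases hS.eq_or_lt with h0 | h0
    · rw [← h0]
      have h1 : ∑ w ∈ K, D w = 0 := by linarith
      rw [Finset.sum_eq_zero_iff_of_nonneg hD] at h1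
      simp [h1 w hw]
    · field_simp
  · intro u hu
    rw [← Finset.sum_div, ← Finset.sum_mul]
    rcases hS.eq_or_lt with h0 | h0
    · rw [← h0]
      simpa using hC u hu
    · rw [div_le_iff₀ h0, mul_comm]
      exact mul_le_mul_of_nonneg_left h (hC u hu)

open Classical in
theorem sc_glue {V : Type} (R : V → V → Prop) (B ch : Finset V) (s : V) (hs : s ∈ B)
    (hdis : Disjoint B ch) (d k d' k' : V → ℝ)
    (hd : ∀ w ∈ B, w ≠ s → d w = d' w) (hk : ∀ w ∈ B, w ≠ s → k w = k' w)
    (hd0 : ∀ w ∈ ch, 0 ≤ d w) (hk0 : ∀ w ∈ ch, 0 ≤ k w)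
    (hR : ∀ w ∈ insert s ch, ∀ u ∈ insert s ch, R w u)
    (hE : ∀ Eo Ei z : ℝ, 0 ≤ Eo → 0 ≤ Ei → 0 ≤ z → Eo + z = d' s → Ei + z ≤ k' s →
      Eo ≤ d s ∧ Ei ≤ k s ∧ (d s - Eo) + ∑ w ∈ ch, d w ≤ (k s - Ei) + ∑ w ∈ ch, k w)
    (hF : SCFlow R B d' k') : SCFlow R (B ∪ ch) d k := by
  obtain ⟨t, ht0, htd, htk, htR⟩ := hF
  have hsch : s ∉ ch := fun h => Finset.disjoint_left.mp hdis hs h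
  set Eo := ∑ u ∈ B.erase s, t s u with hEo
  set Ei := ∑ u ∈ B.erase s, t u s with hEi
  have e1 : Eo + t s s = d' s := by
    rw [← htd s hs, hEo, Finset.sum_erase_add _ _ hs]
  have e2 : Ei + t s s ≤ k' s := by
    rw [hEi, Finset.sum_erase_add _ (fun u => t u s) hs]
    exact htk s hs
  obtain ⟨h1, h2, h3⟩ := hE Eo Ei (t s s) (Finset.sum_nonneg fun _ _ => ht0 _ _)
    (Finset.sum_nonneg fun _ _ => ht0 _ _) (ht0 _ _) e1 e2
  set D : V → ℝ := fun w => if w = s then d s - Eo else d w with hDdef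
  set C : V → ℝ := fun w => if w = s then k s - Ei else k w with hCdef
  have sumD : ∑ w ∈ ch, D w = ∑ w ∈ ch, d w := by
    refine Finset.sum_congr rfl fun w hw => ?_
    have : w ≠ s := fun h => hsch (h ▸ hw)
    simp [hDdef, this]
  have sumC : ∑ w ∈ ch, C w = ∑ w ∈ ch, k w := by
    refine Finset.sum_congr rfl fun w hw => ?_
    have : w ≠ s := fun h => hsch (h ▸ hw)
    simp [hCdef, this]
  have hDs : D s = d s - Eo := by simp [hDdef]
  have hCs : C s = k s - Ei := by simp [hCdef]
  obtain ⟨p, hp0, hpD, hpC⟩ := sc_prop (insert s ch) D C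
    (by
      intro w hw
      by_cases h : w = s
      · subst h; rw [hDs]; linarith
      · have := hd0 w (Finset.mem_of_mem_insert_of_ne hw h)
        simpa [hDdef, h] using this)
    (by
      intro w hw
      by_cases h : w = s
      · subst h; rw [hCs]; linarith
      · have := hk0 w (Finset.mem_of_mem_insert_of_ne hw h)
        simpa [hCdef, h] using this)
    (by
      rw [Finset.sum_insert hsch, Finset.sum_insert hsch, sumD, sumC, hDs, hCs]
      exact h3)
  have hKA : insert s ch ⊆ B ∪ ch := by
    intro w hw
    rcases Finset.mem_insert.mp hw with rfl | h
    · exact Finset.mem_union_left _ hs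
    · exact Finset.mem_union_right _ h
  set q : V → V → ℝ := fun w u => if w ∈ B ∧ u ∈ B ∧ ¬ (w = s ∧ u = s) then t w u else 0 with hq
  set P : V → V → ℝ := fun w u => if w ∈ insert s ch ∧ u ∈ insert s ch then p w u else 0 with hP
  have sumP1 : ∀ w ∈ insert s ch, ∑ u ∈ B ∪ ch, P w u = D w := by
    intro w hw
    rw [← hpD w hw, ← Finset.sum_subset hKA]
    · exact Finset.sum_congr rfl fun u hu => by simp only [hP, hw, hu, and_self, if_true]
    · intro u _ hu
      simp only [hP, hu, and_false, if_false]
  have sumP2 : ∀ u ∈ insert s ch, ∑ w ∈ B ∪ ch, P w u ≤ C u := by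
    intro w hw
    refine le_trans (le_of_eq ?_) (hpC w hw)
    rw [← Finset.sum_subset hKA]
    · exact Finset.sum_congr rfl fun u hu => by simp only [hP, hw, hu, and_self, if_true]
    · intro u _ hu
      simp only [hP, hu, false_and, if_false]
  have sumP3 : ∀ w, w ∉ insert s ch → ∑ u ∈ B ∪ ch, P w u = 0 := by
    intro w hw
    refine Finset.sum_eq_zero fun u _ => ?_
    simp only [hP, hw, false_and, if_false]
  have sumP4 : ∀ w, w ∉ insert s ch → ∑ u ∈ B ∪ ch, P u w = 0 := by
    intro w hw
    refine Finset.sum_eq_zero fun u _ => ?_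
    simp only [hP, hw, and_false, if_false]
  have hEB : B.erase s ⊆ B ∪ ch :=
    (Finset.erase_subset _ _).trans Finset.subset_union_left
  have sumq1 : ∑ u ∈ B ∪ ch, q s u = Eo := by
    rw [hEo, ← Finset.sum_subset hEB]
    · refine Finset.sum_congr rfl fun u hu => ?_
      rw [Finset.mem_erase] at hu
      simp [hq, hs, hu.1, hu.2]
    · intro u _ hu
      rw [Finset.mem_erase] at hu
      simp only [hq]
      rw [if_neg]
      tauto
  have sumq2 : ∑ u ∈ B ∪ ch, q u s = Ei := by
    rw [hEi, ← Finset.sum_subset hEB]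
    · refine Finset.sum_congr rfl fun u hu => ?_
      rw [Finset.mem_erase] at hu
      simp [hq, hs, hu.1, hu.2]
    · intro u _ hu
      rw [Finset.mem_erase] at hu
      simp only [hq]
      rw [if_neg]
      tauto
  have sumq3 : ∀ w ∈ B, w ≠ s → ∑ u ∈ B ∪ ch, q w u = d' w := by
    intro w hw hws
    rw [← htd w hw, ← Finset.sum_subset Finset.subset_union_left]
    · refine Finset.sum_congr rfl fun u hu => ?_
      simp [hq, hw, hu, hws]
    · intro u _ hu
      simp [hq, hu]
  have sumq4 : ∀ w ∈ B, w ≠ s → ∑ u ∈ B ∪ ch, q u w ≤ k' w := by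
    intro w hw hws
    refine le_trans (le_of_eq ?_) (htk w hw)
    rw [← Finset.sum_subset Finset.subset_union_left]
    · refine Finset.sum_congr rfl fun u hu => ?_
      simp [hq, hw, hu, hws]
    · intro u _ hu
      simp [hq, hu]
  have sumq5 : ∀ w, w ∉ B → ∑ u ∈ B ∪ ch, q w u = 0 := by
    intro w hw
    exact Finset.sum_eq_zero fun u _ => by simp [hq, hw]
  have sumq6 : ∀ w, w ∉ B → ∑ u ∈ B ∪ ch, q u w = 0 := by
    intro w hw
    exact Finset.sum_eq_zero fun u _ => by simp [hq, hw]
  refine ⟨fun w u => q w u + P w u, ?_, ?_, ?_, ?_⟩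
  · intro w u
    have a1 : 0 ≤ q w u := by
      simp only [hq]; split_ifs
      · exact ht0 _ _
      · exact le_rfl
    have a2 : 0 ≤ P w u := by
      simp only [hP]; split_ifs with h
      · exact hp0 _ h.1 _ h.2
      · exact le_rfl
    linarith
  · intro w hw
    rw [Finset.sum_add_distrib]
    by_cases hws : w = s
    · subst hws
      rw [sumq1, sumP1 _ (Finset.mem_insert_self _ _), hDs]; ring
    · by_cases hwB : w ∈ B
      · have : w ∉ insert s ch := by
          intro h
          exact Finset.disjoint_left.mp hdis hwB (Finset.mem_of_mem_insert_of_ne h hws)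
        rw [sumq3 w hwB hws, sumP3 w this, hd w hwB hws, add_zero]
      · have hwc : w ∈ ch := (Finset.mem_union.mp hw).resolve_left hwB
        rw [sumq5 w hwB, sumP1 w (Finset.mem_insert_of_mem hwc)]
        simp [hDdef, hws]
  · intro w hw
    rw [Finset.sum_add_distrib]
    by_cases hws : w = s
    · subst hws
      have := sumP2 _ (Finset.mem_insert_self w ch)
      rw [hCs] at this
      rw [sumq2]; linarith
    · by_cases hwB : w ∈ B
      · have : w ∉ insert s ch := by
          intro h
          exact Finset.disjoint_left.mp hdis hwB (Finset.mem_of_mem_insert_of_ne h hws)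
        rw [sumP4 w this, hk w hwB hws, add_zero]
        exact sumq4 w hwB hws
      · have hwc : w ∈ ch := (Finset.mem_union.mp hw).resolve_left hwB
        have := sumP2 w (Finset.mem_insert_of_mem hwc)
        rw [sumq6 w hwB, zero_add]
        simpa [hCdef, hws] using this
  · intro w hw u hu hne
    by_cases h1 : w ∈ insert s ch ∧ u ∈ insert s ch
    · exact hR _ h1.1 _ h1.2
    · have : q w u ≠ 0 := by
        intro h
        apply hne
        simp only [h, hP, if_neg h1, add_zero]
      simp only [hq] at this
      split_ifs at this with h
      · exact htR _ h.1 _ h.2.1 this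
      · exact absurd rfl this

open Classical in
theorem sc_top {V : Type} (ch : Finset V) (c : V → ℝ) (n : ℕ) (hn : n < ch.card) :
    ∃ (T : Finset V) (r : V), T ⊆ ch ∧ T.card = n ∧ r ∈ ch ∧ r ∉ T ∧
      (∀ j ∈ ch, j ∉ T → c j ≤ c r) ∧ (∀ j ∈ T, c r ≤ c j) := by
  induction n with
  | zero =>
    obtain ⟨r, hr, h⟩ := Finset.exists_max_image ch c (Finset.card_pos.mp hn)
    exact ⟨∅, r, by simp, by simp, hr, by simp, fun j hj _ => h j hj, by simp⟩
  | succ n ih =>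
    obtain ⟨T, r, hT, hTn, hr, hrT, h1, h2⟩ := ih (by omega)
    have hsub : insert r T ⊆ ch := Finset.insert_subset hr hT
    have hcard : (insert r T).card = n + 1 := by rw [Finset.card_insert_of_notMem hrT, hTn]
    have hne : (ch \ insert r T).Nonempty := by
      rw [← Finset.card_pos, Finset.card_sdiff_of_subset hsub]; omega
    obtain ⟨r', hr', h⟩ := Finset.exists_max_image (ch \ insert r T) c hne
    rw [Finset.mem_sdiff] at hr'
    have hr'T : r' ∉ T := fun h => hr'.2 (Finset.mem_insert_of_mem h)
    refine ⟨insert r T, r', hsub, hcard, hr'.1, hr'.2, ?_, ?_⟩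
    · intro j hj hjT
      exact h j (Finset.mem_sdiff.mpr ⟨hj, hjT⟩)
    · intro j hj
      rcases Finset.mem_insert.mp hj with rfl | hj
      · exact h1 r' hr'.1 hr'T
      · exact (h1 r' hr'.1 hr'T).trans (h2 j hj)

open Classical in
theorem sc_sel {V : Type} (ch : Finset V) (c y : V → ℝ)
    (hy0 : ∀ v ∈ ch, 0 ≤ y v) (hy1 : ∀ v ∈ ch, y v ≤ 1) (hY : 0 < ∑ v ∈ ch, y v) :
    ∃ (T : Finset V) (r : V) (f : ℝ), T ⊆ ch ∧ r ∈ ch ∧ r ∉ T ∧ 0 ≤ f ∧ f ≤ 1 ∧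
      ∑ v ∈ ch, y v = T.card + f ∧ ∑ v ∈ ch, c v * y v ≤ ∑ v ∈ T, c v + f * c r := by
  set Y := ∑ v ∈ ch, y v with hYdef
  have hYle : Y ≤ ch.card := by
    have := Finset.sum_le_sum hy1
    simpa using this
  have hceil : ⌈Y⌉₊ ≤ ch.card := Nat.ceil_le.mpr hYle
  have hpos : 0 < ⌈Y⌉₊ := Nat.ceil_pos.mpr hY
  obtain ⟨T, r, hT, hTn, hr, hrT, h1, h2⟩ := sc_top ch c (⌈Y⌉₊ - 1) (by omega)
  have hcast : (T.card : ℝ) = ⌈Y⌉₊ - 1 := by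
    rw [hTn, Nat.cast_sub (by omega)]; simp
  have hle := Nat.le_ceil Y
  have hlt := Nat.ceil_lt_add_one hY.le
  refine ⟨T, r, Y - T.card, hT, hr, hrT, by linarith, by linarith, by ring, ?_⟩
  have s1 : ∑ v ∈ ch \ T, c v * y v + ∑ v ∈ T, c v * y v = ∑ v ∈ ch, c v * y v :=
    Finset.sum_sdiff hT
  have s2 : ∑ v ∈ ch \ T, y v + ∑ v ∈ T, y v = Y := Finset.sum_sdiff hT
  have s3 : ∑ v ∈ ch \ T, c v * y v ≤ ∑ v ∈ ch \ T, c r * y v := by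
    refine Finset.sum_le_sum fun v hv => ?_
    rw [Finset.mem_sdiff] at hv
    exact mul_le_mul_of_nonneg_right (h1 v hv.1 hv.2) (hy0 v hv.1)
  have s4 : ∑ v ∈ T, c r * (1 - y v) ≤ ∑ v ∈ T, c v * (1 - y v) := by
    refine Finset.sum_le_sum fun v hv => ?_
    exact mul_le_mul_of_nonneg_right (h2 v hv) (by linarith [hy1 v (hT hv)])
  rw [← Finset.mul_sum] at s3 s4
  have s5 : ∑ v ∈ T, c v * (1 - y v) = ∑ v ∈ T, c v - ∑ v ∈ T, c v * y v := by
    rw [← Finset.sum_sub_distrib]; exact Finset.sum_congr rfl fun _ _ => by ring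
  have s6 : ∑ v ∈ T, (1 - y v) = T.card - ∑ v ∈ T, y v := by
    rw [Finset.sum_sub_distrib]; simp
  rw [s5, s6] at s4
  have s7 : ∑ v ∈ ch \ T, y v = Y - ∑ v ∈ T, y v := by linarith
  rw [s7] at s3
  nlinarith

open Classical in
theorem sc_tree {V : Type} (R : V → V → Prop) (par : V → V) (root : V) (rank : V → ℕ) :
    ∀ (n : ℕ) (A : Finset V) (c y : V → ℝ), A.card = n → root ∈ A →
      (∀ v ∈ A, v ≠ root → par v ∈ A ∧ rank (par v) < rank v ∧ y (par v) = 1) →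
      (∀ v ∈ A, 0 ≤ c v ∧ 0 ≤ y v ∧ y v ≤ 1) →
      (∀ s ∈ A, ∀ w ∈ A, ∀ u ∈ A, (w = s ∨ w ≠ root ∧ par w = s) →
        (u = s ∨ u ≠ root ∧ par u = s) → R w u) →
      (∃ k : ℕ, ∑ v ∈ A, y v = k) →
      ∃ O : Finset V, O ⊆ A ∧ (O.card : ℝ) = ∑ v ∈ A, y v ∧
        SCFlow R A (fun v => c v * y v) (fun v => if v ∈ O then c v else 0) := by
  intro n
  induction n using Nat.strong_induction_on with
  | _ n ih =>
  intro A c y hn hroot hpar hcy hR hk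
  by_cases hA : A.erase root = ∅
  · -- base case
    have hA' : A = {root} := by
      rw [Finset.erase_eq_empty_iff] at hA
      rcases hA with h | h
      · simp [h] at hroot
      · exact h
    subst hA'
    obtain ⟨k, hk⟩ := hk
    simp only [Finset.sum_singleton] at hk ⊢
    obtain ⟨h1, h2, h3⟩ := hcy root hroot
    have hRr := hR root hroot root hroot root hroot (Or.inl rfl) (Or.inl rfl)
    have hk1 : k = 0 ∨ k = 1 := by
      rw [hk] at h3
      have : k ≤ 1 := by exact_mod_cast h3
      omega
    rcases hk1 with rfl | rfl
    · refine ⟨∅, by simp, by simp [hk], fun _ _ => 0, by simp, by simp [hk], by simp, by simp⟩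
    · refine ⟨{root}, by simp, by simp [hk], fun _ _ => c root, by simp [h1], by simp [hk], by simp, ?_⟩
      intro w hw u hu _
      rw [Finset.mem_singleton] at hw hu
      subst hw; subst hu; exact hRr
  obtain ⟨v₀, hv₀, hmax⟩ := Finset.exists_max_image (A.erase root) (fun v => rank (par v))
    (Finset.nonempty_iff_ne_empty.mpr hA)
  set s := par v₀ with hsdef
  have hv₀A := Finset.mem_of_mem_erase hv₀
  have hv₀r := Finset.ne_of_mem_erase hv₀
  set ch := A.filter (fun v => v ≠ root ∧ par v = s) with hch
  have hchA : ch ⊆ A := Finset.filter_subset _ _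
  set B := A \ ch with hB
  have hBA : B ⊆ A := Finset.sdiff_subset
  have hsA : s ∈ A := (hpar v₀ hv₀A hv₀r).1
  have hys : y s = 1 := (hpar v₀ hv₀A hv₀r).2.2
  have hmemch : ∀ v, v ∈ ch ↔ v ∈ A ∧ v ≠ root ∧ par v = s := by
    intro v; rw [hch, Finset.mem_filter]
  have hsch : s ∉ ch := by
    intro h
    obtain ⟨h1, h2, h3⟩ := (hmemch s).mp h
    have := (hpar s h1 h2).2.1
    rw [h3] at this; omega
  have hsB : s ∈ B := Finset.mem_sdiff.mpr ⟨hsA, hsch⟩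
  have hdis : Disjoint B ch := Finset.sdiff_disjoint
  have hun : B ∪ ch = A := Finset.sdiff_union_of_subset hchA
  have hrootB : root ∈ B := Finset.mem_sdiff.mpr ⟨hroot, fun h => ((hmemch _).mp h).2.1 rfl⟩
  have hBcard : B.card < n := by
    rw [← hn]
    apply Finset.card_lt_card
    refine ⟨hBA, fun h => ?_⟩
    exact (Finset.mem_sdiff.mp (h hv₀A)).2 ((hmemch _).mpr ⟨hv₀A, hv₀r, rfl⟩)
  have hparB : ∀ v ∈ B, v ≠ root → par v ∈ B ∧ rank (par v) < rank v ∧ y (par v) = 1 ∧ par v ≠ s := by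
    intro v hv hvr
    obtain ⟨hvA, hvc⟩ := Finset.mem_sdiff.mp hv
    obtain ⟨h1, h2, h3⟩ := hpar v hvA hvr
    refine ⟨Finset.mem_sdiff.mpr ⟨h1, ?_⟩, h2, h3, ?_⟩
    · intro h
      obtain ⟨g1, g2, g3⟩ := (hmemch _).mp h
      have := (hpar _ g1 g2).2.1
      have h5 := hmax v (Finset.mem_erase.mpr ⟨hvr, hvA⟩)
      rw [g3] at this
      omega
    · intro h
      exact hvc ((hmemch _).mpr ⟨hvA, hvr, h⟩)
  have hRstar : ∀ w ∈ insert s ch, ∀ u ∈ insert s ch, R w u := by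
    have aux : ∀ w ∈ insert s ch, w ∈ A ∧ (w = s ∨ w ≠ root ∧ par w = s) := by
      intro w hw
      rcases Finset.mem_insert.mp hw with rfl | h
      · exact ⟨hsA, Or.inl rfl⟩
      · obtain ⟨g1, g2⟩ := (hmemch _).mp h
        exact ⟨g1, Or.inr g2⟩
    intro w hw u hu
    exact hR s hsA w (aux w hw).1 u (aux u hu).1 (aux w hw).2 (aux u hu).2
  have hsumA : ∀ g : V → ℝ, ∑ v ∈ A, g v = ∑ v ∈ B, g v + ∑ v ∈ ch, g v := by
    intro g; rw [← hun, Finset.sum_union hdis]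
  have hsumB : ∀ g : V → ℝ, ∑ v ∈ B, g v = ∑ v ∈ B.erase s, g v + g s := by
    intro g; rw [Finset.sum_erase_add _ _ hsB]
  -- the inductive step packaged
  have key : ∀ (c₀ f : ℝ) (j : ℕ), 0 ≤ c₀ → 0 ≤ f → f ≤ 1 → ∑ v ∈ ch, y v + 1 = j + f →
      ∃ O : Finset V, O ⊆ B ∧ (O.card : ℝ) + j = ∑ v ∈ A, y v ∧
        SCFlow R B (fun v => if v = s then c₀ * f else c v * y v)
          (fun v => if v ∈ O then (if v = s then c₀ else c v) else 0) := by
    intro c₀ f j hc₀ hf0 hf1 hj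
    have hsum : ∑ v ∈ B, (if v = s then f else y v) + j = ∑ v ∈ A, y v := by
      rw [hsumA, hsumB, hsumB, hys]
      have : ∑ v ∈ B.erase s, (if v = s then f else y v) = ∑ v ∈ B.erase s, y v := by
        refine Finset.sum_congr rfl fun v hv => ?_
        rw [if_neg (Finset.ne_of_mem_erase hv)]
      rw [this]; simp only [if_true]; linarith
    obtain ⟨O, hO, hOc, hOf⟩ := ih B.card hBcard B (fun v => if v = s then c₀ else c v)
      (fun v => if v = s then f else y v) rfl hrootB
      (by
        intro v hv hvr
        obtain ⟨h1, h2, h3, h4⟩ := hparB v hv hvr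
        exact ⟨h1, h2, by rw [if_neg h4]; exact h3⟩)
      (by
        intro v hv
        have := hcy v (hBA hv)
        by_cases h : v = s
        · simp [h, hc₀, hf0, hf1]
        · simpa [h] using this)
      (by
        intro a ha w hw u hu
        exact hR a (hBA ha) w (hBA hw) u (hBA hu))
      (by
        obtain ⟨k, hk⟩ := hk
        rw [hk] at hsum
        have hnn : 0 ≤ ∑ v ∈ B, (if v = s then f else y v) := by
          refine Finset.sum_nonneg fun v hv => ?_
          split_ifs
          · exact hf0
          · exact (hcy v (hBA hv)).2.1
        have hjk : j ≤ k := by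
          have : (j : ℝ) ≤ k := by linarith
          exact_mod_cast this
        refine ⟨k - j, ?_⟩
        rw [Nat.cast_sub hjk]; linarith)
    refine ⟨O, hO, by rw [hOc]; exact hsum, ?_⟩
    convert hOf using 2 with v
    by_cases h : v = s <;> simp [h]
  have hcs : 0 ≤ c s := (hcy s hsA).1
  have hdch0 : ∀ w ∈ ch, 0 ≤ c w * y w := fun w hw =>
    mul_nonneg (hcy w (hchA hw)).1 (hcy w (hchA hw)).2.1
  have hkch0 : ∀ O : Finset V, ∀ w ∈ ch, 0 ≤ (if w ∈ O then c w else 0) := by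
    intro O w hw
    split_ifs
    · exact (hcy w (hchA hw)).1
    · exact le_rfl
  have hYnn : 0 ≤ ∑ v ∈ ch, y v := Finset.sum_nonneg fun v hv => (hcy v (hchA hv)).2.1
  have hksum : ∀ O T : Finset V, T ⊆ ch → (∀ v ∈ ch, v ∈ O ↔ v ∈ T) →
      ∑ v ∈ ch, (if v ∈ O then c v else 0) = ∑ v ∈ T, c v := by
    intro O T hT h
    rw [← Finset.sum_subset hT]
    · exact Finset.sum_congr rfl fun v hv => by rw [if_pos ((h v (hT hv)).mpr hv)]
    · intro v hv hvT
      rw [if_neg]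
      rw [h v hv]; exact hvT
  rcases hYnn.eq_or_lt with hY0 | hYpos
  · -- all children have value zero
    obtain ⟨O, hO, hOc, hOf⟩ := key (c s) 1 0 hcs zero_le_one le_rfl (by simp [← hY0])
    refine ⟨O, hO.trans hBA, by simpa using hOc, ?_⟩
    rw [← hun]
    have hch0 : ∀ v ∈ ch, y v = 0 := by
      rw [eq_comm, Finset.sum_eq_zero_iff_of_nonneg (fun v hv => (hcy v (hchA hv)).2.1)] at hY0
      exact hY0
    refine sc_glue R B ch s hsB hdis _ _ _ _ ?_ ?_ hdch0 (hkch0 O) hRstar ?_ hOf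
    · intro w hw hws; simp [hws]
    · intro w hw hws; simp [hws]
    · intro Eo Ei z hEo hEi hz h1 h2
      have e1 : ∑ w ∈ ch, c w * y w = 0 := Finset.sum_eq_zero fun v hv => by simp [hch0 v hv]
      have e2 : 0 ≤ ∑ w ∈ ch, (if w ∈ O then c w else 0) := Finset.sum_nonneg (hkch0 O)
      simp only [if_true] at h1 h2
      simp only [hys, e1]
      refine ⟨by linarith, by linarith, by linarith⟩
  · obtain ⟨T, r, f, hT, hr, hrT, hf0, hf1, hYf, hdom⟩ := sc_sel ch c y
      (fun v hv => (hcy v (hchA hv)).2.1)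
      (fun v hv => (hcy v (hchA hv)).2.2) hYpos
    have hcr : 0 ≤ c r := (hcy r (hchA hr)).1
    have hrs : r ≠ s := fun h => hsch (h ▸ hr)
    have hrB : r ∉ B := fun h => Finset.disjoint_left.mp hdis h hr
    have hTB : ∀ v ∈ T, v ∉ B := fun v hv h => Finset.disjoint_left.mp hdis h (hT hv)
    have hTr : insert r T ⊆ ch := Finset.insert_subset hr hT
    have hsT : s ∉ insert r T := fun h => hsch (hTr h)
    have hsumTr : ∑ v ∈ insert r T, c v = c r + ∑ v ∈ T, c v := Finset.sum_insert hrT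
    obtain ⟨O', hO', hOc, hOf⟩ := key (min (c s) (c r)) f (T.card + 1) (le_min hcs hcr) hf0 hf1
      (by rw [hYf]; push_cast; ring)
    have hchO' : ∀ v ∈ ch, v ∉ O' := fun v hv h => Finset.disjoint_left.mp hdis (hO' h) hv
    have hcard1 : (O' ∪ insert r T).card = O'.card + (T.card + 1) := by
      rw [Finset.card_union_of_disjoint, Finset.card_insert_of_notMem hrT]
      rw [Finset.disjoint_left]
      intro v hv hv'
      exact hchO' v (hTr hv') hv
    rcases le_total (c s) (c r) with hle | hle
    · -- `s` is the leftover node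
      rw [min_eq_left hle] at hOf
      refine ⟨O' ∪ insert r T, Finset.union_subset (hO'.trans hBA) (hTr.trans hchA),
        by rw [hcard1, ← hOc]; push_cast; ring, ?_⟩
      rw [← hun]
      have hsO : s ∈ O' ∪ insert r T ↔ s ∈ O' := by
        rw [Finset.mem_union]; tauto
      refine sc_glue R B ch s hsB hdis _ _ _ _ ?_ ?_ hdch0 (hkch0 _) hRstar ?_ hOf
      · intro w hw hws; simp [hws]
      · intro w hw hws
        have : w ∈ O' ∪ insert r T ↔ w ∈ O' := by
          rw [Finset.mem_union, Finset.mem_insert]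
          constructor
          · rintro (h | h | h)
            · exact h
            · exact absurd (h ▸ hw) hrB
            · exact absurd hw (hTB _ h)
          · exact Or.inl
        simp only [this, if_neg hws]
      · intro Eo Ei z hEo hEi hz h1 h2
        rw [hksum _ (insert r T) hTr (by
          intro v hv
          have := hchO' v hv
          rw [Finset.mem_union]; tauto), hsumTr]
        simp only [if_true] at h1 h2
        simp only [hys, hsO]
        have : c s * f ≤ c s := mul_le_of_le_one_right hcs hf1
        by_cases hsO' : s ∈ O'
        · simp only [hsO', if_true] at h2 ⊢
          refine ⟨by linarith, by linarith, ?_⟩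
          nlinarith
        · simp only [hsO', if_false] at h2 ⊢
          refine ⟨by linarith, by linarith, ?_⟩
          nlinarith
    · -- `r` is the leftover node
      rw [min_eq_right hle] at hOf
      have hfr : c r * f ≤ c r := mul_le_of_le_one_right hcr hf1
      by_cases hsO' : s ∈ O'
      · refine ⟨O' ∪ insert r T, Finset.union_subset (hO'.trans hBA) (hTr.trans hchA),
          by rw [hcard1, ← hOc]; push_cast; ring, ?_⟩
        rw [← hun]
        refine sc_glue R B ch s hsB hdis _ _ _ _ ?_ ?_ hdch0 (hkch0 _) hRstar ?_ hOf
        · intro w hw hws; simp [hws]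
        · intro w hw hws
          have : w ∈ O' ∪ insert r T ↔ w ∈ O' := by
            rw [Finset.mem_union, Finset.mem_insert]
            constructor
            · rintro (h | h | h)
              · exact h
              · exact absurd (h ▸ hw) hrB
              · exact absurd hw (hTB _ h)
            · exact Or.inl
          simp only [this, if_neg hws]
        · intro Eo Ei z hEo hEi hz h1 h2
          rw [hksum _ (insert r T) hTr (by
            intro v hv
            have := hchO' v hv
            rw [Finset.mem_union]; tauto), hsumTr]
          simp only [if_true, hsO'] at h1 h2
          simp only [hys, Finset.mem_union, hsO', true_or, if_true]
          refine ⟨by linarith, by linarith, ?_⟩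
          nlinarith
      · have hcard2 : (insert s O' ∪ T).card = O'.card + (T.card + 1) := by
          rw [Finset.card_union_of_disjoint, Finset.card_insert_of_notMem hsO']
          · ring
          rw [Finset.disjoint_left]
          intro v hv hv'
          rcases Finset.mem_insert.mp hv with rfl | h
          · exact hsch (hT hv')
          · exact hchO' v (hT hv') h
        refine ⟨insert s O' ∪ T, Finset.union_subset
          (Finset.insert_subset hsA (hO'.trans hBA)) (hT.trans hchA),
          by rw [hcard2, ← hOc]; push_cast; ring, ?_⟩
        rw [← hun]
        refine sc_glue R B ch s hsB hdis _ _ _ _ ?_ ?_ hdch0 (hkch0 _) hRstar ?_ hOf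
        · intro w hw hws; simp [hws]
        · intro w hw hws
          have : w ∈ insert s O' ∪ T ↔ w ∈ O' := by
            rw [Finset.mem_union, Finset.mem_insert]
            constructor
            · rintro ((h | h) | h)
              · exact absurd h hws
              · exact h
              · exact absurd hw (hTB _ h)
            · exact fun h => Or.inl (Or.inr h)
          simp only [this, if_neg hws]
        · intro Eo Ei z hEo hEi hz h1 h2
          rw [hksum _ T hT (by
            intro v hv
            have := hchO' v hv
            have h3 : v ≠ s := fun h => hsch (h ▸ hv)
            rw [Finset.mem_union, Finset.mem_insert]; tauto)]
          simp only [if_true, hsO', if_false] at h1 h2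
          simp only [hys, Finset.mem_union, Finset.mem_insert, true_or, if_true]
          refine ⟨by linarith, by linarith, ?_⟩
          nlinarith

theorem sc_compose {V : Type} [Fintype V] (G : SimpleGraph V) (hG : G.Connected) (a b : ℕ)
    (x K : V → V → ℝ) (hx0 : ∀ u v, 0 ≤ x u v) (hK0 : ∀ u v, 0 ≤ K u v)
    (hx1 : ∀ v, ∑ u, x u v = 1) (hxd : ∀ u v, x u v ≠ 0 → G.dist u v ≤ a)
    (hK1 : ∀ w, (∀ v, x w v = 0) ∨ ∑ u, K w u = 1) (hKd : ∀ w u, K w u ≠ 0 → G.dist w u ≤ b) :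
    ∃ x' : V → V → ℝ, (∀ u v, 0 ≤ x' u v) ∧ (∀ v, ∑ u, x' u v = 1) ∧
      (∀ u v, x' u v ≠ 0 → G.dist u v ≤ a + b) ∧
      (∀ u, ∑ v, x' u v = ∑ w, (∑ v, x w v) * K w u) := by
  refine ⟨fun u v => ∑ w, x w v * K w u, ?_, ?_, ?_, ?_⟩
  · intro u v
    exact Finset.sum_nonneg fun w _ => mul_nonneg (hx0 _ _) (hK0 _ _)
  · intro v
    rw [Finset.sum_comm, ← hx1 v]
    refine Finset.sum_congr rfl fun w _ => ?_
    rw [← Finset.mul_sum]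
    rcases hK1 w with h | h
    · simp [h v]
    · rw [h, mul_one]
  · intro u v h
    obtain ⟨w, _, hw⟩ := Finset.exists_ne_zero_of_sum_ne_zero h
    have h1 := hxd w v (left_ne_zero_of_mul hw)
    have h2 := hKd w u (right_ne_zero_of_mul hw)
    have h3 := hG.dist_triangle (u := u) (v := w) (w := v)
    rw [G.dist_comm (u := u) (v := w)] at h3
    omega
  · intro u
    rw [Finset.sum_comm]
    refine Finset.sum_congr rfl fun w _ => ?_
    rw [Finset.sum_mul]

open Classical in
theorem sc_cluster {V : Type} [Fintype V] (Γ : Finset V) (N : V → Finset V) (m : V → V)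
    (y : V → ℝ) (hm : ∀ g ∈ Γ, m g ∈ N g)
    (hN : ∀ g ∈ Γ, ∀ g' ∈ Γ, ∀ w, w ∈ N g → w ∈ N g' → g = g')
    (hy0 : ∀ v, 0 ≤ y v) (hy1 : ∀ v, y v ≤ 1) (hY : ∀ g ∈ Γ, 1 ≤ ∑ w ∈ N g, y w) :
    ∃ K : V → V → ℝ, (∀ w u, 0 ≤ K w u) ∧ (∀ w, ∑ u, K w u = 1) ∧
      (∀ w u, K w u ≠ 0 → w = u ∨ ∃ g ∈ Γ, w ∈ N g ∧ u = m g) ∧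
      (∀ g ∈ Γ, ∑ w, y w * K w (m g) = 1) ∧ (∀ u, ∑ w, y w * K w u ≤ 1) := by
  have hex : ∀ w, ∃ g, (g ∈ Γ ∧ w ∈ N g) ∨ ∀ g ∈ Γ, w ∉ N g := by
    intro w
    by_cases h : ∃ g ∈ Γ, w ∈ N g
    · obtain ⟨g, h⟩ := h
      exact ⟨g, Or.inl h⟩
    · push Not at h
      exact ⟨w, Or.inr h⟩
  choose cg hcg using hex
  have hcgu : ∀ g ∈ Γ, ∀ w ∈ N g, cg w = g := by
    intro g hg w hw
    rcases hcg w with h | h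
    · exact hN _ h.1 _ hg w h.2 hw
    · exact absurd hw (h g hg)
  set lam : V → ℝ := fun g => (∑ w ∈ N g, y w - 1) / (∑ w ∈ N g, y w - y (m g)) with hlam
  have hl0 : ∀ g ∈ Γ, 0 ≤ lam g := by
    intro g hg
    have := hY g hg
    have := hy1 (m g)
    exact div_nonneg (by linarith) (by linarith)
  have hl1 : ∀ g ∈ Γ, lam g ≤ 1 := by
    intro g hg
    have := hY g hg
    have := hy1 (m g)
    exact div_le_one_of_le₀ (by linarith) (by linarith)
  have hlY : ∀ g ∈ Γ, lam g * (∑ w ∈ N g, y w - y (m g)) = ∑ w ∈ N g, y w - 1 := by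
    intro g hg
    have h1 := hY g hg
    have h2 := hy1 (m g)
    by_cases h : ∑ w ∈ N g, y w - y (m g) = 0
    · rw [h, mul_zero]; linarith
    · exact div_mul_cancel₀ _ h
  set K : V → V → ℝ := fun w u => if ∃ g ∈ Γ, w ∈ N g then
    lam (cg w) * (if w = u then 1 else 0) + (1 - lam (cg w)) * (if m (cg w) = u then 1 else 0)
    else (if w = u then 1 else 0) with hK
  have hK1 : ∀ g ∈ Γ, ∀ w ∈ N g, ∀ u, K w u = lam g * (if w = u then 1 else 0) +
      (1 - lam g) * (if m g = u then 1 else 0) := by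
    intro g hg w hw u
    simp only [hK]
    rw [if_pos ⟨g, hg, hw⟩, hcgu g hg w hw]
  have hK2 : ∀ w, (¬ ∃ g ∈ Γ, w ∈ N g) → ∀ u, K w u = if w = u then 1 else 0 := by
    intro w hw u
    simp only [hK]
    rw [if_neg hw]
  have hKnn : ∀ w u, 0 ≤ K w u := by
    intro w u
    by_cases h : ∃ g ∈ Γ, w ∈ N g
    · obtain ⟨g, hg, hw⟩ := h
      rw [hK1 g hg w hw]
      have := hl0 g hg
      have := hl1 g hg
      split_ifs <;> linarith
    · rw [hK2 w h]
      split_ifs <;> norm_num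
  have hKs : ∀ w, ∑ u, K w u = 1 := by
    intro w
    by_cases h : ∃ g ∈ Γ, w ∈ N g
    · obtain ⟨g, hg, hw⟩ := h
      simp only [hK1 g hg w hw, Finset.sum_add_distrib, ← Finset.mul_sum]
      simp
    · simp [hK2 w h]
  have hKsupp : ∀ w u, K w u ≠ 0 → w = u ∨ ∃ g ∈ Γ, w ∈ N g ∧ u = m g := by
    intro w u hne
    by_cases h : ∃ g ∈ Γ, w ∈ N g
    · obtain ⟨g, hg, hw⟩ := h
      rw [hK1 g hg w hw] at hne
      by_cases h1 : w = u
      · exact Or.inl h1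
      · by_cases h2 : m g = u
        · exact Or.inr ⟨g, hg, hw, h2.symm⟩
        · simp [h1, h2] at hne
    · rw [hK2 w h] at hne
      left
      by_contra h1
      simp [h1] at hne
  have hKm : ∀ g ∈ Γ, ∑ w, y w * K w (m g) = 1 := by
    intro g hg
    rw [← Finset.sum_subset (Finset.subset_univ (N g))]
    · have : ∑ w ∈ N g, y w * K w (m g) =
          ∑ w ∈ N g, ((lam g * if w = m g then y w else 0) + (1 - lam g) * y w) := by
        refine Finset.sum_congr rfl fun w hw => ?_
        rw [hK1 g hg w hw]
        simp only [if_true]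
        split_ifs <;> ring
      rw [this, Finset.sum_add_distrib, ← Finset.mul_sum, ← Finset.mul_sum,
        Finset.sum_ite_eq' (N g) (m g), if_pos (hm g hg)]
      linarith [hlY g hg]
    · intro w _ hw
      by_contra hne
      rcases hKsupp w (m g) (right_ne_zero_of_mul hne) with h | ⟨g', hg', hw', he⟩
      · exact hw (h ▸ hm g hg)
      · have : g = g' := hN g hg g' hg' (m g) (hm g hg) (he ▸ hm g' hg')
        exact hw (this ▸ hw')
  refine ⟨K, hKnn, hKs, hKsupp, hKm, ?_⟩
  intro u
  by_cases h : ∃ g ∈ Γ, u = m g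
  · obtain ⟨g, hg, rfl⟩ := h
    exact (hKm g hg).le
  · rw [Finset.sum_eq_single u]
    · have h1 : K u u ≤ 1 := by
        rw [← hKs u]
        exact Finset.single_le_sum (f := fun v => K u v) (fun v _ => hKnn u v) (Finset.mem_univ u)
      exact mul_le_one₀ (hy1 u) (hKnn u u) h1
    · intro w _ hwu
      by_contra hne
      rcases hKsupp w u (right_ne_zero_of_mul hne) with h1 | ⟨g', hg', _, he⟩
      · exact hwu h1
      · exact h ⟨g', hg', he⟩
    · intro h; exact absurd (Finset.mem_univ u) h

open Classical in
theorem sc_net {V : Type} [Fintype V] (G : SimpleGraph V) (hG : G.Connected) :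
    ∃ Γ : Finset V, (∀ g ∈ Γ, ∀ g' ∈ Γ, g ≠ g' → 3 ≤ G.dist g g') ∧
      ∀ v, ∃ g ∈ Γ, G.dist v g ≤ 2 := by
  obtain ⟨Γ, hΓ, hmax⟩ := Finset.exists_max_image
    ((Finset.univ : Finset (Finset V)).filter
      (fun Γ => ∀ g ∈ Γ, ∀ g' ∈ Γ, g ≠ g' → 3 ≤ G.dist g g')) Finset.card ⟨∅, by simp⟩
  rw [Finset.mem_filter] at hΓ
  refine ⟨Γ, hΓ.2, fun v => ?_⟩
  by_contra! hcon
  have hv : v ∉ Γ := by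
    intro h
    have := hcon v h
    simp at this
  have := hmax (insert v Γ) (by
    rw [Finset.mem_filter]
    refine ⟨Finset.mem_univ _, ?_⟩
    intro g hg g' hg' hne
    rcases Finset.mem_insert.mp hg with rfl | hg
    · rcases Finset.mem_insert.mp hg' with rfl | hg'
      · exact absurd rfl hne
      · exact hcon g' hg'
    · rcases Finset.mem_insert.mp hg' with h | hg'
      · rw [h, G.dist_comm]; exact hcon g hg
      · exact hΓ.2 g hg g' hg' hne)
  rw [Finset.card_insert_of_notMem hv] at this
  omega

theorem sc_step {V : Type} (G : SimpleGraph V) (hG : G.Connected) (r g : V)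
    (h : 3 ≤ G.dist r g) : ∃ z, G.dist g z ≤ 3 ∧ G.dist r z + 3 ≤ G.dist r g := by
  obtain ⟨p, hp⟩ := hG.exists_walk_length_eq_dist g r
  refine ⟨p.getVert 3, ?_, ?_⟩
  · refine (SimpleGraph.dist_le (p.take 3)).trans ?_
    rw [SimpleGraph.Walk.take_length]; omega
  · have := SimpleGraph.dist_le (p.drop 3)
    rw [SimpleGraph.Walk.drop_length, hp, G.dist_comm, G.dist_comm (u := g)] at this
    omega

/-- **Lemma 9.** There are positive integer constants `c` and `δ` such
that for every finite connected graph `G`, capacity function `L`, positive integer `k` and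
feasible LP1 solution `(x, y)`, there are a `c`-feasible assignment `(x', y')` and a
family of pairwise vertex-disjoint safe `δ`-caterpillar structures for `(x', y')` such
that every vertex outside all of them has an integral `y'`-value. -/
theorem safe_caterpillar_decomposition :
    ∃ c δ : ℕ, 0 < c ∧ 0 < δ ∧
      ∀ (V : Type) [Fintype V] (G : SimpleGraph V) (L : V → ℕ) (k : ℕ)
        (x : V → V → ℝ) (y : V → ℝ),
        G.Connected → 0 < k → LPFeasible G L k 1 x y →
        ∃ (x' : V → V → ℝ) (y' : V → ℝ) (m : ℕ) (Cs : Fin m → Caterpillar V),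
          LPFeasible G L k c x' y' ∧
          (∀ i, IsCaterpillar G L y' δ (Cs i) ∧ Gamma L (Cs i) = ∅) ∧
          (∀ i j, i ≠ j →
            Disjoint ((Cs i).spine ∪ (Cs i).leaves) ((Cs j).spine ∪ (Cs j).leaves)) ∧
          (∀ v : V, (∀ i, v ∉ (Cs i).spine ∪ (Cs i).leaves) → ∃ n : ℤ, y' v = (n : ℝ)) := by
  classical
  refine ⟨17, 1, by norm_num, by norm_num, ?_⟩
  intro V _ G L k x y hG hk hF
  obtain ⟨hx0, hy0, hyk, hxy, hxL, hx1, hy1, hxd⟩ := hF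
  have hxd' : ∀ u v, x u v ≠ 0 → G.dist u v ≤ 1 := by
    intro u v h
    by_contra hcon
    exact h (hxd u v fun h' => hcon h'.2)
  have tri : ∀ a b c : V, G.dist a c ≤ G.dist a b + G.dist b c := fun a b c => hG.dist_triangle
  have comm : ∀ a b : V, G.dist a b = G.dist b a := fun a b => G.dist_comm
  obtain ⟨Γ, hΓ, hcov⟩ := sc_net G hG
  choose f hfΓ hfd using hcov
  set N : V → Finset V := fun g => Finset.univ.filter (fun w => G.dist g w ≤ 1) with hNdef
  have hNmem : ∀ g w, w ∈ N g ↔ G.dist g w ≤ 1 := by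
    intro g w; simp [hNdef]
  have hmex : ∀ g, ∃ w ∈ N g, ∀ w' ∈ N g, L w' ≤ L w := fun g =>
    Finset.exists_max_image (N g) L ⟨g, by simp [hNdef]⟩
  choose m hmN hmL using hmex
  have hmd : ∀ g, G.dist g (m g) ≤ 1 := fun g => (hNmem g _).mp (hmN g)
  have hNdis : ∀ g ∈ Γ, ∀ g' ∈ Γ, ∀ w, w ∈ N g → w ∈ N g' → g = g' := by
    intro g hg g' hg' w h1 h2
    by_contra hne
    have h3 := hΓ g hg g' hg' hne
    rw [hNmem] at h1 h2
    have := tri g w g'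
    have := comm w g'
    omega
  have hminj : ∀ g ∈ Γ, ∀ g' ∈ Γ, m g = m g' → g = g' := by
    intro g hg g' hg' h
    exact hNdis g hg g' hg' (m g) (hmN g) (h ▸ hmN g')
  have hY : ∀ g ∈ Γ, 1 ≤ ∑ w ∈ N g, y w := by
    intro g _
    rw [← hx1 g, ← Finset.sum_subset (Finset.subset_univ (N g))]
    · exact Finset.sum_le_sum fun w _ => hxy w g
    · intro w _ hw
      by_contra hne
      apply hw
      rw [hNmem, comm]
      exact hxd' _ _ hne
  -- consolidation step
  obtain ⟨K, hK0, hK1, hKs, hKm, hKle⟩ := sc_cluster Γ N m y (fun g _ => hmN g) hNdis hy0 hy1 hY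
  have hKd : ∀ w u, K w u ≠ 0 → G.dist w u ≤ 2 := by
    intro w u h
    rcases hKs w u h with rfl | ⟨g, _, hw, rfl⟩
    · simp
    · rw [hNmem] at hw
      have := tri w g (m g)
      have := hmd g
      have := comm w g
      omega
  have hKL : ∀ w u, K w u ≠ 0 → L w ≤ L u := by
    intro w u h
    rcases hKs w u h with rfl | ⟨g, _, hw, rfl⟩
    · exact le_rfl
    · exact hmL g w hw
  obtain ⟨x₁, hx₁0, hx₁1, hx₁d, hx₁r⟩ := sc_compose G hG 1 2 x K hx0 hK0 hx1 hxd'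
    (fun w => Or.inr (hK1 w)) hKd
  set y₁ : V → ℝ := fun u => ∑ w, y w * K w u with hy₁
  have hy₁0 : ∀ u, 0 ≤ y₁ u := fun u =>
    Finset.sum_nonneg fun w _ => mul_nonneg (hy0 w) (hK0 w u)
  have hy₁k : ∑ u, y₁ u = k := by
    rw [← hyk]
    simp only [hy₁]
    rw [Finset.sum_comm]
    refine Finset.sum_congr rfl fun w _ => ?_
    rw [← Finset.mul_sum, hK1, mul_one]
  have hx₁L : ∀ u, ∑ v, x₁ u v ≤ (L u : ℝ) * y₁ u := by
    intro u
    rw [hx₁r, hy₁, Finset.mul_sum]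
    refine Finset.sum_le_sum fun w _ => ?_
    by_cases h : K w u = 0
    · simp [h]
    · have h1 : (L w : ℝ) ≤ L u := by exact_mod_cast hKL w u h
      have h2 : ∑ v, x w v ≤ L u * y w :=
        (hxL w).trans (mul_le_mul_of_nonneg_right h1 (hy0 w))
      rw [← mul_assoc]
      exact mul_le_mul_of_nonneg_right h2 (hK0 w u)
  -- the tree
  obtain ⟨v₀⟩ := hG.nonempty
  set ρ := f v₀ with hρ
  have hρΓ : ρ ∈ Γ := hfΓ v₀
  have hpg : ∀ g, ∃ g', g ∈ Γ → g ≠ ρ → g' ∈ Γ ∧ G.dist ρ g' < G.dist ρ g ∧ G.dist g g' ≤ 5 := by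
    intro g
    by_cases h : g ∈ Γ ∧ g ≠ ρ
    · obtain ⟨z, hz1, hz2⟩ := sc_step G hG ρ g (hΓ ρ hρΓ g h.1 (Ne.symm h.2))
      refine ⟨f z, fun _ _ => ⟨hfΓ z, ?_, ?_⟩⟩
      · have := tri ρ z (f z)
        have := hfd z
        omega
      · have := tri g z (f z)
        have := hfd z
        omega
    · exact ⟨g, fun h1 h2 => absurd ⟨h1, h2⟩ h⟩
  choose pg hpg using hpg
  have hpr : ∀ v, ∃ pr : V × ℕ, (∀ g ∈ Γ, v = m g → pr = (m (pg g), G.dist ρ g)) ∧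
      ((¬ ∃ g ∈ Γ, v = m g) → pr = (m (f v), 1 + ∑ w, G.dist ρ w)) := by
    intro v
    by_cases h : ∃ g ∈ Γ, v = m g
    · obtain ⟨g, hg, hv⟩ := h
      refine ⟨(m (pg g), G.dist ρ g), ?_, fun h => absurd ⟨g, hg, hv⟩ h⟩
      intro g' hg' hv'
      rw [hminj g hg g' hg' (hv.symm.trans hv')]
    · exact ⟨_, fun g hg hv => absurd ⟨g, hg, hv⟩ h, fun _ => rfl⟩
  choose pr hpr1 hpr2 using hpr
  have htree : ∀ v, v ≠ m ρ → ((pr (pr v).1).2 < (pr v).2 ∧ y₁ (pr v).1 = 1) ∧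
      G.dist v (pr v).1 ≤ 7 := by
    intro v hv
    by_cases h : ∃ g ∈ Γ, v = m g
    · obtain ⟨g, hg, rfl⟩ := h
      have hgρ : g ≠ ρ := fun h => hv (by rw [h])
      obtain ⟨h1, h2, h3⟩ := hpg g hg hgρ
      rw [hpr1 _ g hg rfl]
      simp only
      rw [hpr1 _ (pg g) h1 rfl]
      refine ⟨⟨h2, hKm _ h1⟩, ?_⟩
      have := tri (m g) g (m (pg g))
      have := tri g (pg g) (m (pg g))
      have := hmd g
      have := hmd (pg g)
      have := comm (m g) g
      omega
    · rw [hpr2 v h]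
      simp only
      rw [hpr1 _ (f v) (hfΓ v) rfl]
      refine ⟨⟨?_, hKm _ (hfΓ v)⟩, ?_⟩
      · have : G.dist ρ (f v) ≤ ∑ w, G.dist ρ w :=
          Finset.single_le_sum (f := fun w => G.dist ρ w) (fun _ _ => Nat.zero_le _)
            (Finset.mem_univ (f v))
        simp only
        omega
      · have := tri v (f v) (m (f v))
        have := hmd (f v)
        have := hfd v
        omega
  obtain ⟨O, -, hOc, t, ht0, htd, htk, htR⟩ := sc_tree (fun w u => G.dist w u ≤ 14)
    (fun v => (pr v).1) (m ρ) (fun v => (pr v).2) _ Finset.univ (fun v => (L v : ℝ)) y₁ rfl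
    (Finset.mem_univ _)
    (fun v _ hv => ⟨Finset.mem_univ _, (htree v hv).1⟩)
    (fun v _ => ⟨Nat.cast_nonneg _, hy₁0 v, hKle v⟩)
    (by
      intro s _ w _ u _ hw hu
      have aux : ∀ w, (w = s ∨ w ≠ m ρ ∧ (pr w).1 = s) → G.dist w s ≤ 7 := by
        rintro w (rfl | ⟨h1, h2⟩)
        · simp
        · rw [← h2]; exact (htree w h1).2
      have := aux w hw
      have := aux u hu
      have := tri w s u
      have := comm u s
      show G.dist w u ≤ 14
      omega)
    ⟨k, hy₁k⟩
  -- the final assignment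
  have hzero : ∀ w, (L w : ℝ) * y₁ w = 0 → ∀ v, x₁ w v = 0 := by
    intro w hw
    have h1 := hx₁L w
    rw [hw] at h1
    have h2 : ∑ v, x₁ w v = 0 := le_antisymm h1 (Finset.sum_nonneg fun v _ => hx₁0 w v)
    rw [Finset.sum_eq_zero_iff_of_nonneg (fun v _ => hx₁0 w v)] at h2
    exact fun v => h2 v (Finset.mem_univ v)
  have hLy0 : ∀ w, 0 ≤ (L w : ℝ) * y₁ w := fun w => mul_nonneg (Nat.cast_nonneg _) (hy₁0 w)
  obtain ⟨x₂, hx₂0, hx₂1, hx₂d, hx₂r⟩ := sc_compose G hG 3 14 x₁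
    (fun w u => t w u / ((L w : ℝ) * y₁ w)) hx₁0
    (fun w u => div_nonneg (ht0 w u) (hLy0 w)) hx₁1 hx₁d
    (by
      intro w
      by_cases h : (L w : ℝ) * y₁ w = 0
      · exact Or.inl (hzero w h)
      · right
        rw [← Finset.sum_div, htd w (Finset.mem_univ w)]
        exact div_self h)
    (by
      intro w u h
      apply htR w (Finset.mem_univ _) u (Finset.mem_univ _)
      intro h0
      apply h
      simp [h0])
  have hrow : ∀ u, ∑ v, x₂ u v ≤ if u ∈ O then (L u : ℝ) else 0 := by
    intro u
    rw [hx₂r]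
    refine le_trans (Finset.sum_le_sum fun w _ => ?_) (htk u (Finset.mem_univ u))
    rcases (hLy0 w).eq_or_lt with h | h
    · rw [← h, div_zero, mul_zero]; exact ht0 w u
    · rw [mul_div_assoc', div_le_iff₀ h, mul_comm]
      exact mul_le_mul_of_nonneg_left (hx₁L w) (ht0 w u)
  refine ⟨x₂, fun u => if u ∈ O then 1 else 0, 0, Fin.elim0, ?_, fun i => i.elim0,
    fun i => i.elim0, ?_⟩
  · refine ⟨hx₂0, ?_, ?_, ?_, ?_, hx₂1, ?_, ?_⟩
    · intro u
      simp only
      split_ifs <;> norm_num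
    · rw [← hy₁k, ← hOc]
      simp
    · intro u v
      simp only
      split_ifs with h
      · rw [← hx₂1 v]
        exact Finset.single_le_sum (f := fun u => x₂ u v) (fun u _ => hx₂0 u v) (Finset.mem_univ u)
      · have h1 := hrow u
        rw [if_neg h] at h1
        exact (Finset.single_le_sum (f := fun v => x₂ u v) (fun v _ => hx₂0 u v)
          (Finset.mem_univ v)).trans h1
    · intro u
      have h1 := hrow u
      simp only
      split_ifs at h1 ⊢ <;> simpa using h1
    · intro u
      simp only
      split_ifs <;> norm_num
    · intro u v h
      by_contra hne
      exact h ⟨hG.preconnected u v, hx₂d u v hne⟩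
  · intro v _
    by_cases h : v ∈ O
    · exact ⟨1, by simp [h]⟩
    · exact ⟨0, by simp [h]⟩
end
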